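/- arXiv:0803.1248 — 2 statements merged into one kernel-verified Lean document; each statement's English description precedes it below -/
import Mathlib

section
/- Let P be a testable graph property. Then a function W ∈ W₀ belongs to the closure P̄ if and only if E(d₁(G(k,W),P)) → 0 as k → ∞, where E(d₁(G(k,W),P)) = Σ_F t_ind(F,W) · d₁(F,P), the sum (with values in [0,∞]) ranging over all simple graphs F on vertex set {1,…,k}. -/
open MeasureTheory Filter Topology
open scoped ENNReal

noncomputable section

/-- The unit interval `[0,1]` as a subset of `ℝ`. -/
def I01 : Set ℝ := Set.Icc 0 1

/-- `W₀`: symmetric measurable functions `[0,1]² → [0,1]`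
(represented as functions `ℝ → ℝ → ℝ`, with the relevant values on `[0,1]²`). -/
def IsGraphon (W : ℝ → ℝ → ℝ) : Prop :=
  Measurable (Function.uncurry W) ∧ (∀ x y, W x y = W y x) ∧
    ∀ x y, W x y ∈ Set.Icc (0 : ℝ) 1

/-- The `L¹` norm of a kernel on `[0,1]²`. -/
def l1Norm (W : ℝ → ℝ → ℝ) : ℝ :=
  ∫ x in I01, ∫ y in I01, |W x y|

/-- The cut norm of a kernel on `[0,1]²`. -/
def cutNorm (W : ℝ → ℝ → ℝ) : ℝ :=
  sSup { r : ℝ | ∃ S T : Set ℝ, MeasurableSet S ∧ MeasurableSet T ∧ S ⊆ I01 ∧ T ⊆ I01 ∧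
    r = |∫ x in S, ∫ y in T, W x y| }

/-- An invertible measure preserving map of `[0,1]`. -/
structure InvMP where
  toFun : ℝ → ℝ
  invFun : ℝ → ℝ
  maps : ∀ x ∈ I01, toFun x ∈ I01
  mapsInv : ∀ x ∈ I01, invFun x ∈ I01
  measurePreserving :
    MeasurePreserving toFun (volume.restrict I01) (volume.restrict I01)
  measurePreservingInv :
    MeasurePreserving invFun (volume.restrict I01) (volume.restrict I01)
  leftInv : ∀ x ∈ I01, invFun (toFun x) = x
  rightInv : ∀ x ∈ I01, toFun (invFun x) = x

/-- `δ_□`: the cut distance, infimum of the cut norm over invertible measure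
preserving transformations of `[0,1]`. -/
def deltaCut (U W : ℝ → ℝ → ℝ) : ℝ :=
  ⨅ φ : InvMP, cutNorm (fun x y => U x y - W (φ.toFun x) (φ.toFun y))

/-- `δ₁`: the `L¹` distance minimized over invertible measure preserving
transformations of `[0,1]`. -/
def delta1 (U W : ℝ → ℝ → ℝ) : ℝ :=
  ⨅ φ : InvMP, l1Norm (fun x y => U x y - W (φ.toFun x) (φ.toFun y))



/-- A graph property: for each `n`, a set of simple graphs on `Fin n`. -/
def GraphProp := ∀ n : ℕ, Set (SimpleGraph (Fin n))

/-- Invariance under isomorphism (isomorphic graphs necessarily have the same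
number of vertices). -/
def IsGraphProperty (P : GraphProp) : Prop :=
  ∀ (n : ℕ) (G H : SimpleGraph (Fin n)), Nonempty (G ≃g H) → (G ∈ P n ↔ H ∈ P n)

/-- The normalized edit distance between graphs on a common vertex set. -/
def graphD1 {n : ℕ} (G H : SimpleGraph (Fin n)) : ℝ :=
  (symmDiff G.edgeSet H.edgeSet).ncard / (n ^ 2 : ℝ)

/-- The edit distance from a graph to a graph property (∞ if the property
contains no graph on the same number of nodes). -/
def graphD1P {n : ℕ} (G : SimpleGraph (Fin n)) (P : GraphProp) : ℝ≥0∞ :=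
  ⨅ (H : SimpleGraph (Fin n)) (_ : H ∈ P n), ENNReal.ofReal (graphD1 G H)

open Classical in
/-- The step function `W_G` associated with a graph `G` on `{1,…,n}`:
its value on `((i−1)/n, i/n] × ((j−1)/n, j/n]` is `1` iff `ij ∈ E(G)`. -/
def graphonOf {n : ℕ} (G : SimpleGraph (Fin n)) : ℝ → ℝ → ℝ := fun x y =>
  if ∃ i j : Fin n, G.Adj i j ∧ x ∈ Set.Ioc (((i : ℕ) : ℝ) / n) ((((i : ℕ) : ℝ) + 1) / n)
      ∧ y ∈ Set.Ioc (((j : ℕ) : ℝ) / n) ((((j : ℕ) : ℝ) + 1) / n)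
  then 1 else 0

/-- `H` is (isomorphic to) an induced subgraph of `G`. -/
def IsInducedSubgraph {n k : ℕ} (G : SimpleGraph (Fin n)) (H : SimpleGraph (Fin k)) : Prop :=
  ∃ f : Fin k ↪ Fin n, ∀ i j, H.Adj i j ↔ G.Adj (f i) (f j)

/-- The subgraph of `G` induced on the vertex subset `S` has property `P`
(as a graph on `k = |S|` nodes). -/
def inducedMem {n : ℕ} (G : SimpleGraph (Fin n)) (S : Finset (Fin n)) (k : ℕ)
    (P : GraphProp) : Prop :=
  ∃ H : SimpleGraph (Fin k), H ∈ P k ∧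
    ∃ f : Fin k ↪ Fin n, (∀ i, f i ∈ S) ∧ ∀ i j, H.Adj i j ↔ G.Adj (f i) (f j)

/-- The number of `k`-element vertex subsets of `G` inducing a subgraph with property `P`. -/
def goodCount {n : ℕ} (G : SimpleGraph (Fin n)) (k : ℕ) (P : GraphProp) : ℕ :=
  {S : Finset (Fin n) | S.card = k ∧ inducedMem G S k P}.ncard

/-- Testability of a graph property (Definition 1.1 of the paper). -/
def GraphTestable (P : GraphProp) : Prop :=
  ∃ P' : GraphProp, IsGraphProperty P' ∧
    (∀ (n : ℕ) (G : SimpleGraph (Fin n)), G ∈ P n → ∀ k, 1 ≤ k → k ≤ n →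
      2 * n.choose k ≤ 3 * goodCount G k P') ∧
    (∀ ε : ℝ, 0 < ε → ∃ kε : ℕ, 1 ≤ kε ∧
      ∀ (n : ℕ) (G : SimpleGraph (Fin n)) (k : ℕ), kε ≤ k → k ≤ n →
        ENNReal.ofReal ε ≤ graphD1P G P →
        3 * goodCount G k P' ≤ n.choose k)

def cube (k : ℕ) : Set (Fin k → ℝ) := Set.univ.pi fun _ => I01

open Classical in
/-- The homomorphism density `t(F,W)`. -/
def homDensity {k : ℕ} (F : SimpleGraph (Fin k)) (W : ℝ → ℝ → ℝ) : ℝ :=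
  ∫ x in cube k, ∏ i : Fin k, ∏ j : Fin k,
    if i < j ∧ F.Adj i j then W (x i) (x j) else 1

open Classical in
/-- The induced density `t_ind(F,W)`. -/
def indDensity {k : ℕ} (F : SimpleGraph (Fin k)) (W : ℝ → ℝ → ℝ) : ℝ :=
  ∫ x in cube k, ∏ i : Fin k, ∏ j : Fin k,
    if i < j then (if F.Adj i j then W (x i) (x j) else 1 - W (x i) (x j)) else 1

/-- Isomorphism of functions in `W₀`: equality of all homomorphism densities. -/
def GraphonIso (U W : ℝ → ℝ → ℝ) : Prop :=
  ∀ (k : ℕ) (F : SimpleGraph (Fin k)), homDensity F U = homDensity F W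

open Classical in
/-- `P(G(k,W) ∈ R')`, the probability that the `W`-random graph on `k` nodes
has property `R'`. -/
def probIn (k : ℕ) (W : ℝ → ℝ → ℝ) (R' : GraphProp) : ℝ :=
  ∑ F : SimpleGraph (Fin k), if F ∈ R' k then indDensity F W else 0

/-- The `L¹` distance from `W` to a set `R` of kernels, with value `∞` for `R = ∅`. -/
def d1SetE (W : ℝ → ℝ → ℝ) (R : Set (ℝ → ℝ → ℝ)) : ℝ≥0∞ :=
  ⨅ (U : ℝ → ℝ → ℝ) (_ : U ∈ R), ENNReal.ofReal (l1Norm fun x y => W x y - U x y)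

/-- The cut-norm distance from `W` to a set `R` of kernels, with value `∞` for `R = ∅`. -/
def dCutSetE (W : ℝ → ℝ → ℝ) (R : Set (ℝ → ℝ → ℝ)) : ℝ≥0∞ :=
  ⨅ (U : ℝ → ℝ → ℝ) (_ : U ∈ R), ENNReal.ofReal (cutNorm fun x y => W x y - U x y)

/-- The open ball `B₁(R,c)` (within `W₀`). -/
def ball1 (R : Set (ℝ → ℝ → ℝ)) (c : ℝ) : Set (ℝ → ℝ → ℝ) :=
  {W | IsGraphon W ∧ d1SetE W R < ENNReal.ofReal c}

/-- The open ball `B_□(R,c)` (within `W₀`). -/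
def ballCut (R : Set (ℝ → ℝ → ℝ)) (c : ℝ) : Set (ℝ → ℝ → ℝ) :=
  {W | IsGraphon W ∧ dCutSetE W R < ENNReal.ofReal c}

/-- A graphon property: a set of graphons invariant under isomorphism. -/
def IsGraphonProperty (R : Set (ℝ → ℝ → ℝ)) : Prop :=
  (∀ W ∈ R, IsGraphon W) ∧
    ∀ U W, IsGraphon U → IsGraphon W → GraphonIso U W → (U ∈ R ↔ W ∈ R)

/-- A set of graphons is closed if it is closed in the cut norm. -/
def CutClosed (R : Set (ℝ → ℝ → ℝ)) : Prop :=
  ∀ W, IsGraphon W →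
    (∀ ε : ℝ, 0 < ε → ∃ U ∈ R, cutNorm (fun x y => W x y - U x y) < ε) → W ∈ R

/-- Testability of a graphon property. -/
def GraphonTestable (R : Set (ℝ → ℝ → ℝ)) : Prop :=
  ∃ R' : GraphProp, IsGraphProperty R' ∧
    (∀ W ∈ R, ∀ k : ℕ, 1 ≤ k → (2 : ℝ) / 3 ≤ probIn k W R') ∧
    (∀ ε : ℝ, 0 < ε → ∃ kε : ℕ, 1 ≤ kε ∧ ∀ k, kε ≤ k → ∀ W, IsGraphon W →
      ENNReal.ofReal ε ≤ d1SetE W R → probIn k W R' ≤ 1 / 3)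

/-- The closure `P̄` of a graph property: limits of convergent sequences
of graphs in `P` with sizes tending to infinity. -/
def closureP (P : GraphProp) : Set (ℝ → ℝ → ℝ) :=
  {W | IsGraphon W ∧ ∃ (n : ℕ → ℕ) (G : ∀ m, SimpleGraph (Fin (n m))),
    (∀ m, G m ∈ P (n m)) ∧ Tendsto n atTop atTop ∧
    Tendsto (fun m => deltaCut (graphonOf (G m)) W) atTop (nhds 0)}

/-- A graph property is robust if graphs whose `W_G` is `d₁`-close to `P̄`
are themselves close to `P` in edit distance. -/
def Robust (P : GraphProp) : Prop :=
  ∀ ε : ℝ, 0 < ε → ∃ (N : ℕ) (ε' : ℝ), 1 ≤ N ∧ 0 < ε' ∧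
    ∀ (n : ℕ), N ≤ n → ∀ G : SimpleGraph (Fin n),
      d1SetE (graphonOf G) (closureP P) ≤ ENNReal.ofReal ε' →
      graphD1P G P ≤ ENNReal.ofReal ε

/-- A hereditary graph property: closed under induced subgraphs. -/
def Hereditary (P : GraphProp) : Prop :=
  ∀ (n : ℕ) (G : SimpleGraph (Fin n)), G ∈ P n →
    ∀ (k : ℕ) (H : SimpleGraph (Fin k)), IsInducedSubgraph G H → H ∈ P k

/-- `U` is a flexing of `W`: `U ∈ W₀` agrees with `W` wherever `W` takes value `0` or `1`. -/
def Flexing (U W : ℝ → ℝ → ℝ) : Prop :=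
  IsGraphon U ∧ ∀ x y, (W x y = 0 ∨ W x y = 1) → U x y = W x y

/-- A function property is flexible if it is preserved under flexing. -/
def FlexibleFamily (R : Set (ℝ → ℝ → ℝ)) : Prop :=
  ∀ W ∈ R, ∀ U, Flexing U W → U ∈ R

/-- `U' ≤ W'` almost everywhere on `[0,1]²`. -/
def aeLE (U W : ℝ → ℝ → ℝ) : Prop :=
  ∀ᵐ p ∂(volume.restrict (I01 ×ˢ I01)), U p.1 p.2 ≤ W p.1 p.2

/-- `U ⪯ W`: up to isomorphism, `U ≤ W` almost everywhere. -/
def graphonLE (U W : ℝ → ℝ → ℝ) : Prop :=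
  ∃ U' W', IsGraphon U' ∧ IsGraphon W' ∧ GraphonIso U U' ∧ GraphonIso W W' ∧ aeLE U' W'

/-- The upward closure of a graph property: graphs having a spanning subgraph in `P`. -/
def upP (P : GraphProp) : GraphProp :=
  fun n => {G | ∃ H : SimpleGraph (Fin n), H ∈ P n ∧ H ≤ G}

/-- The upward closure of a function property. -/
def upR (R : Set (ℝ → ℝ → ℝ)) : Set (ℝ → ℝ → ℝ) :=
  {W | IsGraphon W ∧ ∃ U ∈ R, graphonLE U W}

/-- A stepfunction: constant on the products of a finite measurable partition of `[0,1]`. -/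
def IsStepfunction (W : ℝ → ℝ → ℝ) : Prop :=
  ∃ (m : ℕ) (S : Fin m → Set ℝ), (∀ i, MeasurableSet (S i)) ∧
    (⋃ i, S i) = I01 ∧ (∀ i j, i ≠ j → Disjoint (S i) (S j)) ∧
    ∀ i j : Fin m, ∀ x ∈ S i, ∀ x' ∈ S i, ∀ y ∈ S j, ∀ y' ∈ S j, W x y = W x' y'

open Classical in
/-- A testable graphon functional: its value can be estimated from `W`-random graphs. -/
def TestableFunctional (f : (ℝ → ℝ → ℝ) → ℝ) : Prop :=
  ∃ g : ∀ n : ℕ, SimpleGraph (Fin n) → ℝ,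
    (∀ (n : ℕ) (G H : SimpleGraph (Fin n)), Nonempty (G ≃g H) → g n G = g n H) ∧
    ∀ ε : ℝ, 0 < ε → ∃ kε : ℕ, 1 ≤ kε ∧ ∀ k, kε ≤ k → ∀ W, IsGraphon W →
      (∑ F : SimpleGraph (Fin k), if ε < |f W - g k F| then indDensity F W else 0) < 1 / 3



/-- Ordered pairs `i < j` in `Fin n`. -/
abbrev Pr (n : ℕ) := {p : Fin n × Fin n // p.1 < p.2}

open Classical in
/-- Adjacency indicator. -/
def adjI {n : ℕ} (F : SimpleGraph (Fin n)) (i j : Fin n) : ℝ := if F.Adj i j then 1 else 0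

lemma adjI_cases {n : ℕ} (F : SimpleGraph (Fin n)) (i j : Fin n) :
    (F.Adj i j ∧ adjI F i j = 1) ∨ (¬ F.Adj i j ∧ adjI F i j = 0) := by
  unfold adjI; by_cases h : F.Adj i j <;> simp [h]

lemma adjI_comm {n : ℕ} (F : SimpleGraph (Fin n)) (i j : Fin n) : adjI F i j = adjI F j i := by
  by_cases h : F.Adj i j
  · simp [adjI, h, h.symm]
  · have h' : ¬ F.Adj j i := fun h' => h h'.symm
    simp [adjI, h, h']

lemma adjI_self {n : ℕ} (F : SimpleGraph (Fin n)) (i : Fin n) : adjI F i i = 0 := by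
  unfold adjI; simp

lemma adjI_mem {n : ℕ} (F : SimpleGraph (Fin n)) (i j : Fin n) :
    0 ≤ adjI F i j ∧ adjI F i j ≤ 1 := by
  rcases adjI_cases F i j with h | h <;> simp [h.2]

/-- Probability of `F` when edges are independent with probabilities `w`. -/
def pw {n : ℕ} (F : SimpleGraph (Fin n)) (w : Fin n → Fin n → ℝ) : ℝ :=
  ∏ e : Pr n, (adjI F e.1.1 e.1.2 * w e.1.1 e.1.2 + (1 - adjI F e.1.1 e.1.2) * (1 - w e.1.1 e.1.2))

lemma prod_pairs {n : ℕ} (f : Fin n → Fin n → ℝ) :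
    (∏ i : Fin n, ∏ j : Fin n, if i < j then f i j else 1) = ∏ e : Pr n, f e.1.1 e.1.2 := by
  rw [← Fintype.prod_prod_type' (fun i j => if i < j then f i j else 1)]
  rw [← Finset.prod_filter (fun p : Fin n × Fin n => p.1 < p.2) (fun p => f p.1 p.2)]
  rw [Finset.prod_subtype (p := fun p : Fin n × Fin n => p.1 < p.2)]
  simp

lemma graph_ext_pr {n : ℕ} {F G : SimpleGraph (Fin n)}
    (h : ∀ e : Pr n, F.Adj e.1.1 e.1.2 ↔ G.Adj e.1.1 e.1.2) : F = G := by
  ext i j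
  rcases lt_trichotomy i j with hij | hij | hij
  · exact h ⟨(i, j), hij⟩
  · subst hij; simp
  · rw [F.adj_comm, G.adj_comm]; exact h ⟨(j, i), hij⟩

open Classical in
/-- Graphs are functions on pairs. -/
def graphEquiv (n : ℕ) : SimpleGraph (Fin n) ≃ (Pr n → Bool) where
  toFun F := fun e => decide (F.Adj e.1.1 e.1.2)
  invFun b :=
    { Adj := fun i j => (∃ h : i < j, b ⟨(i, j), h⟩ = true) ∨ (∃ h : j < i, b ⟨(j, i), h⟩ = true)
      symm := ⟨fun i j h => h.symm⟩
      loopless := ⟨fun i h => by rcases h with ⟨h, _⟩ | ⟨h, _⟩ <;> exact lt_irrefl _ h⟩ }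
  left_inv F := by
    apply graph_ext_pr
    rintro ⟨⟨i, j⟩, h⟩
    have h' : i < j := h
    simp [h', h'.not_gt]
  right_inv b := by
    funext ⟨⟨i, j⟩, h⟩
    have h' : i < j := h
    simp [h', h'.not_gt]

lemma sum_graph_prod {n : ℕ} (a b : Pr n → ℝ) :
    ∑ F : SimpleGraph (Fin n), ∏ e : Pr n,
      (adjI F e.1.1 e.1.2 * a e + (1 - adjI F e.1.1 e.1.2) * b e) = ∏ e, (a e + b e) := by
  have h1 : ∏ e, (a e + b e) = ∏ e : Pr n, ∑ c : Bool, (if c then a e else b e) := by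
    refine Finset.prod_congr rfl fun e _ => ?_
    simp
  rw [h1, Finset.prod_univ_sum, Fintype.piFinset_univ]
  refine Fintype.sum_equiv (graphEquiv n) _ _ fun F => ?_
  refine Finset.prod_congr rfl fun e _ => ?_
  unfold adjI graphEquiv
  by_cases h : F.Adj e.1.1 e.1.2 <;> simp [h]

lemma sum_pw_mul_prod {n : ℕ} {ι : Type*} [Fintype ι] (w : Fin n → Fin n → ℝ) (c : ι → Pr n)
    (hc : Function.Injective c) (a b : ι → ℝ) :
    ∑ F : SimpleGraph (Fin n), pw F w * ∏ i, (adjI F (c i).1.1 (c i).1.2 * a i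
      + (1 - adjI F (c i).1.1 (c i).1.2) * b i)
    = ∏ i, (w (c i).1.1 (c i).1.2 * a i + (1 - w (c i).1.1 (c i).1.2) * b i) := by
  classical
  have key : ∀ f : ι → ℝ, ∏ i, f i = ∏ e : Pr n, Function.extend c f 1 e := by
    intro f
    have : ∏ i, f i = ∏ e ∈ Finset.univ.image c, Function.extend c f 1 e := by
      rw [Finset.prod_image (fun x _ y _ h => hc h)]
      exact Finset.prod_congr rfl fun i _ => (hc.extend_apply _ _ _).symm
    rw [this]
    apply Finset.prod_subset (Finset.subset_univ _)
    intro e _ he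
    rw [Function.extend_apply']
    · rfl
    · rintro ⟨i, rfl⟩; exact he (Finset.mem_image_of_mem _ (Finset.mem_univ _))
  have e1 : ∀ F : SimpleGraph (Fin n), pw F w * ∏ i, (adjI F (c i).1.1 (c i).1.2 * a i
      + (1 - adjI F (c i).1.1 (c i).1.2) * b i) =
      ∏ e : Pr n, (adjI F e.1.1 e.1.2 * (w e.1.1 e.1.2 * Function.extend c a 1 e) +
        (1 - adjI F e.1.1 e.1.2) * ((1 - w e.1.1 e.1.2) * Function.extend c b 1 e)) := by
    intro F
    rw [key, pw, ← Finset.prod_mul_distrib]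
    refine Finset.prod_congr rfl fun e _ => ?_
    by_cases he : ∃ i, c i = e
    · obtain ⟨i, rfl⟩ := he
      simp only [hc.extend_apply]
      rcases adjI_cases F (c i).1.1 (c i).1.2 with h | h <;> simp [h.2]
    · rw [Function.extend_apply' _ _ _ he, Function.extend_apply' _ _ _ he,
        Function.extend_apply' _ _ _ he]
      simp
  rw [Finset.sum_congr rfl fun F _ => e1 F, sum_graph_prod, key]
  refine Finset.prod_congr rfl fun e _ => ?_
  by_cases he : ∃ i, c i = e
  · obtain ⟨i, rfl⟩ := he
    simp only [hc.extend_apply]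
  · rw [Function.extend_apply' _ _ _ he, Function.extend_apply' _ _ _ he,
        Function.extend_apply' _ _ _ he]
    simp

lemma sum_pw {n : ℕ} (w : Fin n → Fin n → ℝ) : ∑ F : SimpleGraph (Fin n), pw F w = 1 := by
  unfold pw
  rw [sum_graph_prod]; simp

lemma pw_nonneg {n : ℕ} (F : SimpleGraph (Fin n)) (w : Fin n → Fin n → ℝ)
    (hw : ∀ i j, 0 ≤ w i j ∧ w i j ≤ 1) : 0 ≤ pw F w := by
  refine Finset.prod_nonneg fun e _ => ?_
  have := adjI_mem F e.1.1 e.1.2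
  have := hw e.1.1 e.1.2
  nlinarith

lemma pw_le_one {n : ℕ} (F : SimpleGraph (Fin n)) (w : Fin n → Fin n → ℝ)
    (hw : ∀ i j, 0 ≤ w i j ∧ w i j ≤ 1) : pw F w ≤ 1 := by
  rw [← sum_pw w]
  exact Finset.single_le_sum (f := fun F => pw F w) (fun F _ => pw_nonneg F w hw) (Finset.mem_univ F)

/-- The map on pairs induced by an order embedding. -/
def prMap {n k : ℕ} (f : Fin k ↪o Fin n) (e : Pr k) : Pr n :=
  ⟨(f e.1.1, f e.1.2), f.strictMono e.2⟩

lemma prMap_inj {n k : ℕ} (f : Fin k ↪o Fin n) : Function.Injective (prMap f) := by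
  rintro ⟨⟨a, b⟩, h⟩ ⟨⟨c, d⟩, h'⟩ he
  simp [prMap] at he
  simp [he]

open Classical in
lemma ind_eq_prod {n k : ℕ} (F : SimpleGraph (Fin n)) (F1 : SimpleGraph (Fin k))
    (f : Fin k ↪o Fin n) :
    (if F.comap f = F1 then (1:ℝ) else 0) = ∏ e : Pr k,
      (adjI F (prMap f e).1.1 (prMap f e).1.2 * adjI F1 e.1.1 e.1.2 +
        (1 - adjI F (prMap f e).1.1 (prMap f e).1.2) * (1 - adjI F1 e.1.1 e.1.2)) := by
  split_ifs with h
  · subst h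
    symm
    apply Finset.prod_eq_one
    intro e _
    have : adjI (SimpleGraph.comap f F) e.1.1 e.1.2 = adjI F (prMap f e).1.1 (prMap f e).1.2 := by
      simp only [adjI, prMap, SimpleGraph.comap_adj]
      congr
    rw [this]
    rcases adjI_cases F (prMap f e).1.1 (prMap f e).1.2 with h | h <;> simp [h.2]
  · have : ∃ e : Pr k, ¬ ((F.comap f).Adj e.1.1 e.1.2 ↔ F1.Adj e.1.1 e.1.2) := by
      by_contra hcon
      push Not at hcon
      exact h (graph_ext_pr hcon)
    obtain ⟨e, he⟩ := this
    symm
    apply Finset.prod_eq_zero (Finset.mem_univ e)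
    simp only [SimpleGraph.comap_adj] at he
    simp only [prMap]
    rcases adjI_cases F (f e.1.1) (f e.1.2) with h | h <;>
    rcases adjI_cases F1 e.1.1 e.1.2 with h' | h' <;> simp_all

lemma sum_pw_two {n k : ℕ} (w : Fin n → Fin n → ℝ) (f g : Fin k ↪o Fin n)
    (hfg : ∀ i j, f i ≠ g j) (h1 h2 : SimpleGraph (Fin k) → ℝ) :
    ∑ F : SimpleGraph (Fin n), pw F w * (h1 (F.comap f) * h2 (F.comap g)) =
    (∑ F1, h1 F1 * pw F1 (fun i j => w (f i) (f j))) *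
      (∑ F2, h2 F2 * pw F2 (fun i j => w (g i) (g j))) := by
  classical
  have hh : ∀ (h : SimpleGraph (Fin k) → ℝ) (F : SimpleGraph (Fin k)),
      h F = ∑ F1, h F1 * (if F = F1 then (1:ℝ) else 0) := by
    intro h F; simp
  have main : ∀ F1 F2 : SimpleGraph (Fin k),
      ∑ F : SimpleGraph (Fin n), pw F w * ((if F.comap f = F1 then (1:ℝ) else 0) *
        (if F.comap g = F2 then (1:ℝ) else 0)) =
      pw F1 (fun i j => w (f i) (f j)) * pw F2 (fun i j => w (g i) (g j)) := by
    intro F1 F2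
    have hinj : Function.Injective (Sum.elim (prMap f) (prMap g)) := by
      apply Function.Injective.sumElim (prMap_inj f) (prMap_inj g)
      intro a b hab
      simp only [prMap, Subtype.mk.injEq, Prod.mk.injEq] at hab
      exact hfg _ _ hab.1
    have := sum_pw_mul_prod w (Sum.elim (prMap f) (prMap g)) hinj
      (Sum.elim (fun e => adjI F1 e.1.1 e.1.2) (fun e => adjI F2 e.1.1 e.1.2))
      (Sum.elim (fun e => 1 - adjI F1 e.1.1 e.1.2) (fun e => 1 - adjI F2 e.1.1 e.1.2))
    simp only [Fintype.prod_sum_type, Sum.elim_inl, Sum.elim_inr] at this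
    rw [Finset.sum_congr rfl fun F _ => by rw [ind_eq_prod F F1 f, ind_eq_prod F F2 g], this]
    congr 1 <;> unfold pw <;> refine Finset.prod_congr rfl fun e _ => ?_ <;> simp only [prMap] <;> ring
  calc _ = ∑ F : SimpleGraph (Fin n), ∑ F1, ∑ F2, (h1 F1 * h2 F2) *
        (pw F w * ((if F.comap f = F1 then (1:ℝ) else 0) *
        (if F.comap g = F2 then (1:ℝ) else 0))) := by
        refine Finset.sum_congr rfl fun F _ => ?_
        conv_lhs => rw [hh h1 (F.comap f), hh h2 (F.comap g), Finset.sum_mul_sum, Finset.mul_sum]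
        refine Finset.sum_congr rfl fun F1 _ => ?_
        rw [Finset.mul_sum]
        refine Finset.sum_congr rfl fun F2 _ => ?_
        ring
    _ = ∑ F1, ∑ F2, (h1 F1 * h2 F2) * (pw F1 (fun i j => w (f i) (f j)) * pw F2 (fun i j => w (g i) (g j))) := by
        rw [Finset.sum_comm]
        refine Finset.sum_congr rfl fun F1 _ => ?_
        rw [Finset.sum_comm]
        refine Finset.sum_congr rfl fun F2 _ => ?_
        rw [← Finset.mul_sum, main]
    _ = _ := by
        rw [Finset.sum_mul_sum]
        refine Finset.sum_congr rfl fun F1 _ => ?_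
        refine Finset.sum_congr rfl fun F2 _ => ?_
        ring

/-- Centered adjacency matrix with zero diagonal. -/
def cA {n : ℕ} (w : Fin n → Fin n → ℝ) (F : SimpleGraph (Fin n)) (i j : Fin n) : ℝ :=
  if i = j then 0 else adjI F i j - w i j

lemma cA_comm {n : ℕ} (w : Fin n → Fin n → ℝ) (hs : ∀ i j, w i j = w j i)
    (F : SimpleGraph (Fin n)) (i j : Fin n) : cA w F i j = cA w F j i := by
  unfold cA; simp [adjI_comm F i j, hs i j, eq_comm]

lemma cA_abs {n : ℕ} (w : Fin n → Fin n → ℝ) (hw : ∀ i j, 0 ≤ w i j ∧ w i j ≤ 1)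
    (F : SimpleGraph (Fin n)) (i j : Fin n) : |cA w F i j| ≤ 1 := by
  unfold cA
  split_ifs
  · simp
  · have := adjI_mem F i j
    have := hw i j
    rw [abs_le]; constructor <;> linarith

open Classical in
/-- Toggle the edge `ij`. -/
def toggle {n : ℕ} (i j : Fin n) (F : SimpleGraph (Fin n)) : SimpleGraph (Fin n) where
  Adj a b := a ≠ b ∧ (if (a = i ∧ b = j) ∨ (a = j ∧ b = i) then ¬ F.Adj a b else F.Adj a b)
  symm := ⟨by
    intro a b h
    refine ⟨h.1.symm, ?_⟩
    have := h.2
    by_cases h1 : (a = i ∧ b = j) ∨ (a = j ∧ b = i)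
    · have h2 : (b = i ∧ a = j) ∨ (b = j ∧ a = i) := by tauto
      simp only [h1, h2, if_true] at this ⊢
      rwa [F.adj_comm]
    · have h2 : ¬ ((b = i ∧ a = j) ∨ (b = j ∧ a = i)) := by tauto
      simp only [h1, h2, if_false] at this ⊢
      rwa [F.adj_comm]⟩
  loopless := ⟨fun a h => h.1 rfl⟩

lemma toggle_adj_ne {n : ℕ} (i j : Fin n) (F : SimpleGraph (Fin n)) (a b : Fin n)
    (h : ¬ ((a = i ∧ b = j) ∨ (a = j ∧ b = i))) : (toggle i j F).Adj a b ↔ F.Adj a b := by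
  simp only [toggle, h, if_false]
  exact ⟨fun h => h.2, fun h => ⟨h.ne, h⟩⟩

lemma toggle_adj {n : ℕ} {i j : Fin n} (hij : i ≠ j) (F : SimpleGraph (Fin n)) :
    (toggle i j F).Adj i j ↔ ¬ F.Adj i j := by
  simp [toggle, hij]

lemma toggle_toggle {n : ℕ} {i j : Fin n} (hij : i ≠ j) (F : SimpleGraph (Fin n)) :
    toggle i j (toggle i j F) = F := by
  ext a b
  by_cases h : (a = i ∧ b = j) ∨ (a = j ∧ b = i)
  · rcases h with ⟨rfl, rfl⟩ | ⟨rfl, rfl⟩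
    · rw [toggle_adj hij, toggle_adj hij]; simp
    · rw [SimpleGraph.adj_comm, toggle_adj hij, toggle_adj hij, F.adj_comm]; simp
  · rw [toggle_adj_ne _ _ _ _ _ h, toggle_adj_ne _ _ _ _ _ h]

lemma pw_toggle {n : ℕ} (w : Fin n → Fin n → ℝ) {i j : Fin n} (hij : i < j)
    (F : SimpleGraph (Fin n)) :
    pw F w * cA w F i j + pw (toggle i j F) w * cA w (toggle i j F) i j = 0 := by
  classical
  have hne := hij.ne
  have e : ∀ F, pw F w = _ := fun F =>
    (Finset.mul_prod_erase Finset.univ (fun e : Pr n => (adjI F e.1.1 e.1.2 * w e.1.1 e.1.2 + (1 - adjI F e.1.1 e.1.2) * (1 - w e.1.1 e.1.2))) (Finset.mem_univ (⟨(i,j), hij⟩ : Pr n))).symm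
  rw [e F, e (toggle i j F)]
  have h2 : ∏ e ∈ Finset.univ.erase (⟨(i,j), hij⟩ : Pr n), (adjI (toggle i j F) e.1.1 e.1.2 * w e.1.1 e.1.2 + (1 - adjI (toggle i j F) e.1.1 e.1.2) * (1 - w e.1.1 e.1.2)) =
    ∏ e ∈ Finset.univ.erase (⟨(i,j), hij⟩ : Pr n), (adjI F e.1.1 e.1.2 * w e.1.1 e.1.2 + (1 - adjI F e.1.1 e.1.2) * (1 - w e.1.1 e.1.2)) := by
    refine Finset.prod_congr rfl fun e he => ?_
    have : adjI (toggle i j F) e.1.1 e.1.2 = adjI F e.1.1 e.1.2 := by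
      unfold adjI
      rw [toggle_adj_ne]
      rintro (⟨h1, h2⟩ | ⟨h1, h2⟩)
      · exact (Finset.mem_erase.1 he).1 (Subtype.ext (Prod.ext h1 h2))
      · have := e.2
        rw [h1, h2] at this
        exact absurd this hij.not_gt
    rw [this]
  rw [h2]
  simp only [cA, hne, if_false]
  rcases adjI_cases F i j with h | h <;> rcases adjI_cases (toggle i j F) i j with h' | h' <;>
    rw [toggle_adj hne] at h' <;> simp only [h.2, h'.2]
  · exact absurd h.1 h'.1
  · ring
  · ring
  · exact absurd h.1 h'.1

lemma sum_pw_cA_lt {n : ℕ} (w : Fin n → Fin n → ℝ) {i j : Fin n} (hij : i < j)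
    (R : SimpleGraph (Fin n) → ℝ) (hR : ∀ F, R (toggle i j F) = R F) :
    ∑ F : SimpleGraph (Fin n), pw F w * (cA w F i j * R F) = 0 := by
  refine Finset.sum_involution (fun F _ => toggle i j F) ?_ ?_ ?_ ?_
  · intro F _
    rw [hR]
    linear_combination R F * pw_toggle w hij F
  · intro F _ _ h
    have := toggle_adj hij.ne F
    rw [h] at this
    tauto
  · simp
  · intro F _; exact toggle_toggle hij.ne F

lemma toggle_comm {n : ℕ} (i j : Fin n) (F : SimpleGraph (Fin n)) : toggle i j F = toggle j i F := by
  ext a b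
  by_cases h : (a = i ∧ b = j) ∨ (a = j ∧ b = i)
  · have h2 : (a = j ∧ b = i) ∨ (a = i ∧ b = j) := by tauto
    simp only [toggle, h, h2, if_true]
  · have h2 : ¬ ((a = j ∧ b = i) ∨ (a = i ∧ b = j)) := by tauto
    simp only [toggle, h, h2, if_false]

lemma sum_pw_cA {n : ℕ} (w : Fin n → Fin n → ℝ) (hs : ∀ i j, w i j = w j i) (i j : Fin n)
    (R : SimpleGraph (Fin n) → ℝ) (hR : ∀ F, R (toggle i j F) = R F) :
    ∑ F : SimpleGraph (Fin n), pw F w * (cA w F i j * R F) = 0 := by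
  rcases lt_trichotomy i j with hij | hij | hij
  · exact sum_pw_cA_lt w hij R hR
  · subst hij; simp [cA]
  · rw [Finset.sum_congr rfl fun F _ => by rw [cA_comm w hs F i j]]
    exact sum_pw_cA_lt w hij R (fun F => by rw [toggle_comm, hR])

lemma cA_toggle_ne {n : ℕ} (w : Fin n → Fin n → ℝ) (i j : Fin n) (F : SimpleGraph (Fin n)) (a b : Fin n)
    (h : ¬ ((a = i ∧ b = j) ∨ (a = j ∧ b = i))) : cA w (toggle i j F) a b = cA w F a b := by
  unfold cA adjI
  rw [toggle_adj_ne _ _ _ _ _ h]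

lemma sum_pw_four {n : ℕ} (w : Fin n → Fin n → ℝ) (hs : ∀ i j, w i j = w j i) (i i' j j' : Fin n)
    (hi : i ≠ i') (hj : j ≠ j') :
    ∑ F : SimpleGraph (Fin n), pw F w *
      ((cA w F i j * cA w F i' j) * (cA w F i j' * cA w F i' j')) = 0 := by
  by_cases h : j' = i
  · subst h; simp [cA]
  by_cases h2 : i' = j
  · subst h2; simp [cA]
  have := sum_pw_cA w hs i j (fun F => cA w F i' j * (cA w F i j' * cA w F i' j')) (by
    intro F
    rw [cA_toggle_ne, cA_toggle_ne, cA_toggle_ne] <;> grind)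
  rw [← this]
  refine Finset.sum_congr rfl fun F _ => ?_
  ring

/-- The 4-cycle quantity. -/
def Q4 {n : ℕ} (A : Fin n → Fin n → ℝ) : ℝ := ∑ i, ∑ i', (∑ j, A i j * A i' j) ^ 2

lemma abs_sum_pw_le {n : ℕ} (w : Fin n → Fin n → ℝ) (hw : ∀ i j, 0 ≤ w i j ∧ w i j ≤ 1)
    (R : SimpleGraph (Fin n) → ℝ) (hR : ∀ F, R F ≤ 1) :
    ∑ F : SimpleGraph (Fin n), pw F w * R F ≤ 1 := by
  rw [← sum_pw w]
  refine Finset.sum_le_sum fun F _ => ?_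
  have := pw_nonneg F w hw
  nlinarith [hR F]

lemma sum_pw_Q4 {n : ℕ} (w : Fin n → Fin n → ℝ) (hs : ∀ i j, w i j = w j i)
    (hw : ∀ i j, 0 ≤ w i j ∧ w i j ≤ 1) :
    ∑ F : SimpleGraph (Fin n), pw F w * Q4 (cA w F) ≤ 2 * (n:ℝ) ^ 3 := by
  have h1 : ∑ F : SimpleGraph (Fin n), pw F w * Q4 (cA w F) = ∑ i, ∑ i', ∑ j, ∑ j',
      ∑ F : SimpleGraph (Fin n), pw F w *
      ((cA w F i j * cA w F i' j) * (cA w F i j' * cA w F i' j')) := by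
    have hq : ∀ F : SimpleGraph (Fin n), Q4 (cA w F) = ∑ i, ∑ i', ∑ j, ∑ j',
      (cA w F i j * cA w F i' j) * (cA w F i j' * cA w F i' j') := by
      intro F
      simp only [Q4, sq, Finset.sum_mul_sum]
    simp only [hq, Finset.mul_sum]
    rw [Finset.sum_comm]
    refine Finset.sum_congr rfl fun i _ => ?_
    rw [Finset.sum_comm]
    refine Finset.sum_congr rfl fun i' _ => ?_
    rw [Finset.sum_comm]
    refine Finset.sum_congr rfl fun j _ => ?_
    rw [Finset.sum_comm]
  have h2 : ∀ i i' j j' : Fin n, ∑ F : SimpleGraph (Fin n), pw F w *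
      ((cA w F i j * cA w F i' j) * (cA w F i j' * cA w F i' j')) ≤
      (if i = i' then 1 else 0) + (if j = j' then 1 else 0) := by
    intro i i' j j'
    have hb : ∑ F : SimpleGraph (Fin n), pw F w *
      ((cA w F i j * cA w F i' j) * (cA w F i j' * cA w F i' j')) ≤ 1 := by
      apply abs_sum_pw_le w hw
      intro F
      apply le_trans (le_abs_self _)
      rw [abs_mul, abs_mul, abs_mul]
      have := cA_abs w hw F
      have a1 := mul_le_one₀ (this i j) (abs_nonneg _) (this i' j)
      have a2 := mul_le_one₀ (this i j') (abs_nonneg _) (this i' j')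
      exact mul_le_one₀ a1 (by positivity) a2
    by_cases hi : i = i'
    · simp only [hi, if_true]
      subst hi
      split_ifs <;> linarith
    · by_cases hj : j = j'
      · simp only [hi, hj, if_true, if_false]
        subst hj
        linarith
      · simp only [hi, hj, if_false]
        rw [sum_pw_four w hs i i' j j' hi hj]; simp
  rw [h1]
  calc _ ≤ ∑ i : Fin n, ∑ i' : Fin n, ∑ j : Fin n, ∑ j' : Fin n,
      ((if i = i' then (1:ℝ) else 0) + (if j = j' then 1 else 0)) :=
      Finset.sum_le_sum fun i _ => Finset.sum_le_sum fun i' _ => Finset.sum_le_sum fun j _ =>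
        Finset.sum_le_sum fun j' _ => h2 i i' j j'
    _ = 2 * (n:ℝ) ^ 3 := by
      simp [Finset.sum_add_distrib]
      ring


/-- Uniform measure on `[0,1]`. -/
abbrev mu01 : Measure ℝ := volume.restrict I01

instance : IsProbabilityMeasure mu01 := ⟨by simp [mu01, I01]⟩

/-- Uniform measure on the cube. -/
abbrev piI (k : ℕ) : Measure (Fin k → ℝ) := Measure.pi fun _ => mu01

lemma restrict_cube (k : ℕ) : (volume : Measure (Fin k → ℝ)).restrict (cube k) = piI k := by
  unfold cube piI mu01
  rw [volume_pi, Measure.restrict_pi_pi]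

lemma measurable_pair {k : ℕ} {W : ℝ → ℝ → ℝ} (hW : Measurable (Function.uncurry W)) (i j : Fin k) :
    Measurable (fun x : Fin k → ℝ => W (x i) (x j)) := by
  have h : Measurable (fun x : Fin k → ℝ => (x i, x j)) :=
    (measurable_pi_apply i).prodMk (measurable_pi_apply j)
  exact hW.comp h

lemma graphon_bd {W : ℝ → ℝ → ℝ} (hW : IsGraphon W) (x y : ℝ) : 0 ≤ W x y ∧ W x y ≤ 1 := hW.2.2 x y

lemma measurable_pw {k : ℕ} (F : SimpleGraph (Fin k)) {W : ℝ → ℝ → ℝ} (hW : Measurable (Function.uncurry W)) :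
    Measurable (fun x : Fin k → ℝ => pw F (fun i j => W (x i) (x j))) := by
  unfold pw
  refine Finset.measurable_prod _ fun e _ => ?_
  have := measurable_pair hW e.1.1 e.1.2
  exact (this.const_mul _).add ((measurable_const.sub this).const_mul _)

lemma integrable_bdd {α : Type*} [MeasurableSpace α] {μ : Measure α} [IsFiniteMeasure μ] {f : α → ℝ}
    (hf : Measurable f) (C : ℝ) (hC : ∀ x, |f x| ≤ C) : Integrable f μ :=
  Integrable.of_bound hf.aestronglyMeasurable C (Eventually.of_forall hC)

lemma integrable_pw {k : ℕ} (F : SimpleGraph (Fin k)) {W : ℝ → ℝ → ℝ} (hW : IsGraphon W) :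
    Integrable (fun x : Fin k → ℝ => pw F (fun i j => W (x i) (x j))) (piI k) := by
  refine integrable_bdd (measurable_pw F hW.1) 1 fun x => ?_
  rw [abs_of_nonneg (pw_nonneg _ _ fun i j => graphon_bd hW _ _)]
  exact pw_le_one _ _ fun i j => graphon_bd hW _ _

lemma indDensity_eq {k : ℕ} (F : SimpleGraph (Fin k)) (W : ℝ → ℝ → ℝ) :
    indDensity F W = ∫ x, pw F (fun i j => W (x i) (x j)) ∂piI k := by
  unfold indDensity
  rw [restrict_cube]
  congr 1
  funext x
  rw [prod_pairs (fun i j => _)]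
  unfold pw
  refine Finset.prod_congr rfl fun e _ => ?_
  rcases adjI_cases F e.1.1 e.1.2 with h | h <;> simp [h.1, h.2]

lemma indDensity_nonneg {k : ℕ} (F : SimpleGraph (Fin k)) {W : ℝ → ℝ → ℝ} (hW : IsGraphon W) :
    0 ≤ indDensity F W := by
  rw [indDensity_eq]
  exact integral_nonneg fun x => pw_nonneg _ _ fun i j => graphon_bd hW _ _

/-- Expectation of a graph function under `G(k,W)`. -/
def EG {k : ℕ} (W : ℝ → ℝ → ℝ) (h : SimpleGraph (Fin k) → ℝ) : ℝ :=
  ∑ F : SimpleGraph (Fin k), h F * indDensity F W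

lemma EG_eq {k : ℕ} {W : ℝ → ℝ → ℝ} (hW : IsGraphon W) (h : SimpleGraph (Fin k) → ℝ) :
    EG W h = ∫ x, ∑ F, h F * pw F (fun i j => W (x i) (x j)) ∂piI k := by
  unfold EG
  rw [integral_finsetSum _ fun F _ => (integrable_pw F hW).const_mul _]
  refine Finset.sum_congr rfl fun F _ => ?_
  rw [integral_const_mul, indDensity_eq]

lemma EG_one {k : ℕ} {W : ℝ → ℝ → ℝ} (hW : IsGraphon W) :
    ∑ F : SimpleGraph (Fin k), indDensity F W = 1 := by
  have := EG_eq hW (fun _ : SimpleGraph (Fin k) => (1:ℝ))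
  simp only [EG, one_mul, sum_pw] at this
  rw [this]; simp

lemma mp_comp_inj {ι κ : Type*} [Fintype ι] [Fintype κ] (c : ι → κ) (hc : Function.Injective c) :
    MeasurePreserving (fun x : κ → ℝ => fun i => x (c i)) (Measure.pi fun _ => mu01)
      (Measure.pi fun _ => mu01) := by
  classical
  have hm : Measurable (fun x : κ → ℝ => fun i => x (c i)) :=
    measurable_pi_lambda _ fun i => measurable_pi_apply _
  refine ⟨hm, ?_⟩
  symm
  apply Measure.pi_eq
  intro s hs
  rw [Measure.map_apply hm (MeasurableSet.univ_pi hs)]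
  have : (fun x : κ → ℝ => fun i => x (c i)) ⁻¹' (Set.univ.pi s) =
      Set.univ.pi (fun e => Function.extend c s (fun _ => Set.univ) e) := by
    ext x
    simp only [Set.mem_preimage, Set.mem_univ_pi]
    constructor
    · intro h e
      by_cases he : ∃ i, c i = e
      · obtain ⟨i, rfl⟩ := he
        rw [hc.extend_apply]; exact h i
      · rw [Function.extend_apply' _ _ _ he]; trivial
    · intro h i
      have := h (c i)
      rwa [hc.extend_apply] at this
  rw [this, Measure.pi_pi]
  have h2 : ∏ i, mu01 (s i) = ∏ e ∈ Finset.univ.image c, mu01 (Function.extend c s (fun _ => Set.univ) e) := by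
    rw [Finset.prod_image (fun x _ y _ h => hc h)]
    exact Finset.prod_congr rfl fun i _ => by rw [hc.extend_apply]
  rw [h2]
  symm
  apply Finset.prod_subset (Finset.subset_univ _)
  intro e _ he
  rw [Function.extend_apply']
  · exact measure_univ
  · rintro ⟨i, rfl⟩; exact he (Finset.mem_image_of_mem _ (Finset.mem_univ _))

lemma integral_two_disjoint {n k : ℕ} (f g : Fin k → Fin n) (hf : Function.Injective f)
    (hg : Function.Injective g) (hfg : ∀ i j, f i ≠ g j) (u v : (Fin k → ℝ) → ℝ)
    (hu : Measurable u) (hv : Measurable v) :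
    ∫ x, u (fun i => x (f i)) * v (fun i => x (g i)) ∂piI n = (∫ x, u x ∂piI k) * ∫ x, v x ∂piI k := by
  have h1 := mp_comp_inj (Sum.elim f g) (hf.sumElim hg hfg)
  have h2 := (measurePreserving_sumPiEquivProdPi (X := fun _ : Fin k ⊕ Fin k => ℝ) (fun _ => mu01)).comp h1
  rw [← integral_prod_mul, ← h2.map_eq, integral_map h2.measurable.aemeasurable]
  · rfl
  · exact ((hu.comp measurable_fst).mul (hv.comp measurable_snd)).aestronglyMeasurable

lemma EG_two {n k : ℕ} {W : ℝ → ℝ → ℝ} (hW : IsGraphon W) (f g : Fin k ↪o Fin n)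
    (hfg : ∀ i j, f i ≠ g j) (h1 h2 : SimpleGraph (Fin k) → ℝ) :
    EG W (fun F : SimpleGraph (Fin n) => h1 (F.comap f) * h2 (F.comap g)) = EG W h1 * EG W h2 := by
  rw [EG_eq hW, EG_eq hW, EG_eq hW, ← integral_two_disjoint f g f.injective g.injective hfg]
  · congr 1
    funext x
    rw [← sum_pw_two (fun i j => W (x i) (x j)) f g hfg h1 h2]
    exact Finset.sum_congr rfl fun F _ => mul_comm _ _
  · exact Finset.measurable_sum _ fun F _ => (measurable_pw F hW.1).const_mul _
  · exact Finset.measurable_sum _ fun F _ => (measurable_pw F hW.1).const_mul _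

lemma mp_update {k : ℕ} (i : Fin k) :
    MeasurePreserving (fun p : (Fin k → ℝ) × ℝ => Function.update p.1 i p.2)
      ((piI k).prod mu01) (piI k) := by
  classical
  have hm : Measurable (fun p : (Fin k → ℝ) × ℝ => Function.update p.1 i p.2) := by
    refine measurable_pi_lambda _ fun j => ?_
    by_cases h : j = i
    · subst h; simpa using measurable_snd
    · simp only [Function.update_of_ne h]
      exact (measurable_pi_apply j).comp measurable_fst
  refine ⟨hm, ?_⟩
  symm
  apply Measure.pi_eq
  intro s hs
  rw [Measure.map_apply hm (MeasurableSet.univ_pi hs)]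
  have : (fun p : (Fin k → ℝ) × ℝ => Function.update p.1 i p.2) ⁻¹' (Set.univ.pi s) =
      (Set.univ.pi (Function.update s i Set.univ)) ×ˢ (s i) := by
    ext p
    simp only [Set.mem_preimage, Set.mem_univ_pi, Set.mem_prod]
    constructor
    · intro h
      refine ⟨fun j => ?_, by simpa using h i⟩
      by_cases hj : j = i
      · subst hj; simp
      · simpa [hj] using h j
    · rintro ⟨h, h'⟩ j
      by_cases hj : j = i
      · subst hj; simpa using h'
      · simpa [hj] using h j
  rw [this, Measure.prod_prod, Measure.pi_pi,
    ← Finset.mul_prod_erase Finset.univ _ (Finset.mem_univ i),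
    ← Finset.mul_prod_erase Finset.univ (fun i => mu01 (s i)) (Finset.mem_univ i)]
  simp only [Function.update_self, measure_univ, one_mul]
  rw [mul_comm]
  congr 1
  refine Finset.prod_congr rfl fun j hj => ?_
  rw [Function.update_of_ne (Finset.ne_of_mem_erase hj)]

lemma integral_update {k : ℕ} (i : Fin k) (f : (Fin k → ℝ) → ℝ) (hf : Integrable f (piI k)) :
    ∫ x, f x ∂piI k = ∫ x, ∫ s, f (Function.update x i s) ∂mu01 ∂piI k := by
  have h := mp_update i
  conv_lhs => rw [← h.map_eq]
  rw [integral_map h.measurable.aemeasurable, integral_prod]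
  · exact h.integrable_comp_of_integrable hf
  · rw [h.map_eq]; exact hf.aestronglyMeasurable

lemma ae_mem_cube (k : ℕ) : ∀ᵐ x ∂piI k, ∀ i, x i ∈ I01 := by
  rw [← restrict_cube]
  have : MeasurableSet (cube k) := MeasurableSet.univ_pi fun _ => measurableSet_Icc
  filter_upwards [ae_restrict_mem this] with x hx i
  exact hx i (Set.mem_univ i)


/-- `k`-subsets. -/
abbrev KSub (n k : ℕ) := {S : Finset (Fin n) // S.card = k}

/-- Increasing enumeration of a `k`-subset. -/
def kem {n k : ℕ} (S : KSub n k) : Fin k ↪o Fin n := S.1.orderEmbOfFin S.2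

lemma kem_mem {n k : ℕ} (S : KSub n k) (i : Fin k) : kem S i ∈ S.1 :=
  Finset.orderEmbOfFin_mem _ _ _

lemma inducedMem_iff {n k : ℕ} (G : SimpleGraph (Fin n)) (S : KSub n k) (P : GraphProp)
    (hP : IsGraphProperty P) : inducedMem G S.1 k P ↔ G.comap (kem S) ∈ P k := by
  constructor
  · rintro ⟨H, hH, f, hf, hadj⟩
    refine (hP k H _ ?_).1 hH
    let f' : Fin k → S.1 := fun i => ⟨f i, hf i⟩
    have hinj : Function.Injective f' := fun a b h => f.injective (by simpa [f'] using h)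
    have hbij : Function.Bijective f' := by
      rw [Fintype.bijective_iff_injective_and_card]
      exact ⟨hinj, by simp [S.2]⟩
    let e : Fin k ≃ Fin k := (Equiv.ofBijective f' hbij).trans (S.1.orderIsoOfFin S.2).symm.toEquiv
    have he : ∀ i, kem S (e i) = f i := by
      intro i
      have : ((S.1.orderIsoOfFin S.2) (e i) : Fin n) = f i := by
        simp [e, f']
      rw [← this]; rfl
    exact ⟨⟨e, by intro a b; simp [he, hadj]⟩⟩
  · intro h
    exact ⟨_, h, (kem S).toEmbedding, fun i => kem_mem S i, fun i j => by simp⟩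

open Classical in
/-- Indicator of a property. -/
def indP {k : ℕ} (P : GraphProp) (F : SimpleGraph (Fin k)) : ℝ := if F ∈ P k then 1 else 0

lemma indP_mem {k : ℕ} (P : GraphProp) (F : SimpleGraph (Fin k)) : 0 ≤ indP P F ∧ indP P F ≤ 1 := by
  unfold indP; split_ifs <;> simp

lemma goodCount_eq {n k : ℕ} (G : SimpleGraph (Fin n)) (P : GraphProp)
    (hP : IsGraphProperty P) :
    (goodCount G k P : ℝ) = ∑ S : KSub n k, indP P (G.comap (kem S)) := by
  classical
  unfold goodCount indP
  have h1 : {S : Finset (Fin n) | S.card = k ∧ inducedMem G S k P} =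
      (fun S : KSub n k => S.1) '' {S | G.comap (kem S) ∈ P k} := by
    ext S
    simp only [Set.mem_ofPred_eq, Set.mem_image]
    constructor
    · rintro ⟨h, h'⟩
      exact ⟨⟨S, h⟩, (inducedMem_iff G ⟨S, h⟩ P hP).1 h', rfl⟩
    · rintro ⟨S, h, rfl⟩
      exact ⟨S.2, (inducedMem_iff G S P hP).2 h⟩
  rw [h1, Set.ncard_image_of_injective _ Subtype.val_injective, Finset.sum_boole,
    Set.ncard_eq_toFinset_card']
  congr 2
  ext S; simp

lemma card_KSub (n k : ℕ) : Fintype.card (KSub n k) = n.choose k := by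
  simp

lemma card_contain (n k : ℕ) (v : Fin n) (hn : 0 < n) (hk : 0 < k) :
    n * (Finset.univ.filter (fun S : KSub n k => v ∈ S.1)).card = k * n.choose k := by
  classical
  obtain ⟨m, rfl⟩ : ∃ m, n = m + 1 := ⟨n - 1, by omega⟩
  obtain ⟨l, rfl⟩ : ∃ l, k = l + 1 := ⟨k - 1, by omega⟩
  have h : (Finset.univ.filter (fun S : KSub (m+1) (l+1) => v ∈ S.1)).card = m.choose l := by
    have : (Finset.powersetCard l (Finset.univ.erase v)).card = m.choose l := by
      rw [Finset.card_powersetCard, Finset.card_erase_of_mem (Finset.mem_univ _)]; simp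
    rw [← this]
    refine Finset.card_bij (fun S _ => S.1.erase v) ?_ ?_ ?_
    · intro S hS
      simp only [Finset.mem_filter, Finset.mem_univ, true_and] at hS
      rw [Finset.mem_powersetCard]
      refine ⟨Finset.erase_subset_erase _ (Finset.subset_univ _), ?_⟩
      rw [Finset.card_erase_of_mem hS, S.2]; simp
    · intro S hS T hT h
      simp only [Finset.mem_filter, Finset.mem_univ, true_and] at hS hT
      apply Subtype.ext
      rw [← Finset.insert_erase hS, ← Finset.insert_erase hT, h]
    · intro T hT
      rw [Finset.mem_powersetCard] at hT
      have hv : v ∉ T := fun h => by simpa using hT.1 h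
      refine ⟨⟨insert v T, by rw [Finset.card_insert_of_notMem hv, hT.2]⟩, by simp, by simp [hv]⟩
  rw [h, Nat.add_one_mul_choose_eq]
  ring

lemma card_meet (n k : ℕ) (hn : 0 < n) (hk : 0 < k) (S : KSub n k) :
    n * (Finset.univ.filter (fun T : KSub n k => ∃ v ∈ S.1, v ∈ T.1)).card ≤ k ^ 2 * n.choose k := by
  classical
  have h : Finset.univ.filter (fun T : KSub n k => ∃ v ∈ S.1, v ∈ T.1) ⊆
    S.1.biUnion (fun v => Finset.univ.filter (fun T : KSub n k => v ∈ T.1)) := by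
    intro T; simp
  calc _ ≤ n * ∑ v ∈ S.1, (Finset.univ.filter (fun T : KSub n k => v ∈ T.1)).card :=
        Nat.mul_le_mul_left _ ((Finset.card_le_card h).trans Finset.card_biUnion_le)
    _ = ∑ v ∈ S.1, k * n.choose k := by
        rw [Finset.mul_sum]
        exact Finset.sum_congr rfl fun v _ => card_contain n k v hn hk
    _ = k ^ 2 * n.choose k := by
        rw [Finset.sum_const, S.2]; simp; ring

lemma EG_mono {k : ℕ} {W : ℝ → ℝ → ℝ} (hW : IsGraphon W) (h1 h2 : SimpleGraph (Fin k) → ℝ)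
    (h : ∀ F, h1 F ≤ h2 F) : EG W h1 ≤ EG W h2 :=
  Finset.sum_le_sum fun F _ => mul_le_mul_of_nonneg_right (h F) (indDensity_nonneg F hW)

lemma EG_const {k : ℕ} {W : ℝ → ℝ → ℝ} (hW : IsGraphon W) (c : ℝ) :
    EG W (fun _ : SimpleGraph (Fin k) => c) = c := by
  unfold EG; rw [← Finset.mul_sum, EG_one hW, mul_one]

lemma EG_sub {k : ℕ} (W : ℝ → ℝ → ℝ) (h1 h2 : SimpleGraph (Fin k) → ℝ) :
    EG W (fun F => h1 F - h2 F) = EG W h1 - EG W h2 := by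
  unfold EG; rw [← Finset.sum_sub_distrib]
  exact Finset.sum_congr rfl fun F _ => by ring

lemma concentration {n k : ℕ} (hn : 0 < n) (hk : 0 < k) {W : ℝ → ℝ → ℝ} (hW : IsGraphon W)
    (P : GraphProp) (hP : IsGraphProperty P) :
    EG W (fun F : SimpleGraph (Fin n) =>
      ((goodCount F k P : ℝ) - EG W (indP (k := k) P) * n.choose k) ^ 2) * n ≤
      k ^ 2 * (n.choose k : ℝ) ^ 2 := by
  classical
  set q := EG W (indP (k := k) P) with hq
  have hq0 : 0 ≤ q := by
    have := EG_mono hW (fun _ => 0) (indP (k := k) P) fun F => (indP_mem P F).1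
    rwa [EG_const hW] at this
  have hq1 : q ≤ 1 := by
    have := EG_mono hW (indP (k := k) P) (fun _ => 1) fun F => (indP_mem P F).2
    rwa [EG_const hW] at this
  let h : SimpleGraph (Fin k) → ℝ := fun F => indP P F - q
  have hh : EG W h = 0 := by
    simp only [h]; rw [EG_sub, EG_const hW]; simp [hq]
  have hb : ∀ F, |h F| ≤ 1 := by
    intro F; have := indP_mem P F
    simp only [h]; rw [abs_le]; constructor <;> linarith
  have e1 : ∀ F : SimpleGraph (Fin n), ((goodCount F k P : ℝ) - q * n.choose k) ^ 2 =
      ∑ S : KSub n k, ∑ T : KSub n k, h (F.comap (kem S)) * h (F.comap (kem T)) := by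
    intro F
    rw [← Finset.sum_mul_sum, ← sq]
    congr 1
    simp only [h]
    rw [Finset.sum_sub_distrib, goodCount_eq F P hP, Finset.sum_const, Finset.card_univ, card_KSub]
    simp [mul_comm]
  have e2 : EG W (fun F : SimpleGraph (Fin n) => ((goodCount F k P : ℝ) - q * n.choose k) ^ 2) =
      ∑ S : KSub n k, ∑ T : KSub n k,
        EG W (fun F : SimpleGraph (Fin n) => h (F.comap (kem S)) * h (F.comap (kem T))) := by
    unfold EG
    simp only [e1, Finset.sum_mul]
    rw [Finset.sum_comm]
    refine Finset.sum_congr rfl fun S _ => ?_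
    rw [Finset.sum_comm]
  have e3 : ∀ S T : KSub n k,
      EG W (fun F : SimpleGraph (Fin n) => h (F.comap (kem S)) * h (F.comap (kem T))) ≤
      if ∃ v ∈ S.1, v ∈ T.1 then 1 else 0 := by
    intro S T
    split_ifs with hST
    · rw [← EG_const (k := n) hW 1]
      apply EG_mono hW
      intro F
      apply (le_abs_self _).trans
      rw [abs_mul]
      exact mul_le_one₀ (hb _) (abs_nonneg _) (hb _)
    · rw [EG_two hW, hh]
      · simp
      · intro i j hij
        exact hST ⟨kem S i, kem_mem S i, hij ▸ kem_mem T j⟩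
  rw [e2]
  calc _ ≤ (∑ S : KSub n k, ∑ T : KSub n k, if ∃ v ∈ S.1, v ∈ T.1 then (1:ℝ) else 0) * n := by
        gcongr with S _ T _; exact e3 S T
    _ = ∑ S : KSub n k, ((n * (Finset.univ.filter (fun T : KSub n k => ∃ v ∈ S.1, v ∈ T.1)).card : ℕ) : ℝ) := by
        rw [Finset.sum_mul]
        refine Finset.sum_congr rfl fun S _ => ?_
        rw [Finset.sum_boole]; push_cast; ring
    _ ≤ ∑ S : KSub n k, ((k ^ 2 * n.choose k : ℕ) : ℝ) := 
        Finset.sum_le_sum fun S _ => Nat.cast_le.2 (card_meet n k hn hk S)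
    _ = _ := by
        rw [Finset.sum_const, Finset.card_univ, card_KSub]; push_cast; simp; ring


/-- `D` is a bounded measurable kernel with all rectangle integrals at most `c`. -/
def CutBd (D : ℝ → ℝ → ℝ) (c : ℝ) : Prop :=
  Measurable (Function.uncurry D) ∧ (∀ x y, |D x y| ≤ 1) ∧
  ∀ S T : Set ℝ, MeasurableSet S → MeasurableSet T → S ⊆ I01 → T ⊆ I01 →
    |∫ x in S, ∫ y in T, D x y| ≤ c

lemma measurable_I01 : MeasurableSet I01 := measurableSet_Icc

lemma restrict_sub {S : Set ℝ} (hS : S ⊆ I01) (hm : MeasurableSet S) :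
    mu01.restrict S = volume.restrict S := by
  rw [mu01, Measure.restrict_restrict hm, Set.inter_eq_left.2 hS]

lemma int_le_of_sets (φ : ℝ → ℝ) (hφ : Measurable φ) (M : ℝ) (hM : ∀ x, |φ x| ≤ M) (c : ℝ)
    (h : ∀ S, MeasurableSet S → S ⊆ I01 → ∫ x in S, φ x ≤ c)
    (f : ℝ → ℝ) (hf : Measurable f) (hf' : ∀ x, 0 ≤ f x ∧ f x ≤ 1) :
    ∫ x, f x * φ x ∂mu01 ≤ c := by
  have hS : MeasurableSet {x | 0 < φ x} := measurableSet_lt measurable_const hφ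
  have hM0 : 0 ≤ M := (abs_nonneg _).trans (hM 0)
  have h1 : ∫ x, f x * φ x ∂mu01 ≤ ∫ x, {x | 0 < φ x}.indicator φ x ∂mu01 := by
    apply integral_mono
    · refine integrable_bdd (hf.mul hφ) M fun x => ?_
      rw [abs_mul, abs_of_nonneg (hf' x).1]
      have := hM x
      have := hf' x
      nlinarith [abs_nonneg (φ x)]
    · refine integrable_bdd (hφ.indicator hS) M fun x => ?_
      by_cases hx : x ∈ {x | 0 < φ x}
      · simpa [Set.indicator_of_mem hx] using hM x
      · simpa [Set.indicator_of_notMem hx] using hM0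
    · intro x
      have := hf' x
      by_cases hx : x ∈ {x | 0 < φ x}
      · have hx' : 0 < φ x := hx
        simp only [Set.indicator_of_mem hx]
        nlinarith
      · have hx' : φ x ≤ 0 := not_lt.1 hx
        simp only [Set.indicator_of_notMem hx]
        nlinarith
  refine h1.trans ?_
  rw [integral_indicator hS, mu01, Measure.restrict_restrict hS]
  exact h _ (hS.inter measurable_I01) Set.inter_subset_right

lemma abs_int_le_of_sets (φ : ℝ → ℝ) (hφ : Measurable φ) (M : ℝ) (hM : ∀ x, |φ x| ≤ M) (c : ℝ)
    (h : ∀ S, MeasurableSet S → S ⊆ I01 → |∫ x in S, φ x| ≤ c)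
    (f : ℝ → ℝ) (hf : Measurable f) (hf' : ∀ x, 0 ≤ f x ∧ f x ≤ 1) :
    |∫ x, f x * φ x ∂mu01| ≤ c := by
  rw [abs_le]
  constructor
  · have := int_le_of_sets (fun x => - φ x) hφ.neg M (by simpa using hM) c (by
      intro S hS hS'
      rw [integral_neg]
      exact (neg_le_abs _).trans (h S hS hS')) f hf hf'
    simp only [mul_neg, integral_neg] at this
    linarith
  · exact int_le_of_sets φ hφ M hM c (fun S hS hS' => (le_abs_self _).trans (h S hS hS')) f hf hf'

lemma meas_int_right {D : ℝ → ℝ → ℝ} (hD : Measurable (Function.uncurry D)) (ν : Measure ℝ) [SFinite ν] :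
    Measurable (fun x => ∫ y, D x y ∂ν) :=
  (StronglyMeasurable.integral_prod_right (f := D) hD.stronglyMeasurable).measurable

lemma abs_int_le_one (f : ℝ → ℝ) (hf : ∀ x, |f x| ≤ 1) (ν : Measure ℝ) [IsFiniteMeasure ν]
    (hν : ν.real Set.univ ≤ 1) : |∫ x, f x ∂ν| ≤ 1 := by
  have := norm_integral_le_of_norm_le_const (μ := ν) (f := f) (C := 1) (Eventually.of_forall hf)
  rw [one_mul] at this
  exact this.trans hν

lemma real_sub_le {S : Set ℝ} (hS : S ⊆ I01) : (volume.restrict S).real Set.univ ≤ 1 := by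
  rw [measureReal_restrict_apply_univ]
  have : volume.real I01 = 1 := by simp [I01, Measure.real]
  rw [← this]
  exact measureReal_mono hS (by simp [I01])

lemma fin_sub {S : Set ℝ} (hS : S ⊆ I01) : IsFiniteMeasure (volume.restrict S) :=
  ⟨by rw [Measure.restrict_apply_univ]; exact (measure_mono hS).trans_lt (by simp [I01])⟩

lemma CutBd.fun_bound {D : ℝ → ℝ → ℝ} {c : ℝ} (h : CutBd D c) (f g : ℝ → ℝ) (hf : Measurable f)
    (hf' : ∀ x, 0 ≤ f x ∧ f x ≤ 1) (hg : Measurable g) (hg' : ∀ x, 0 ≤ g x ∧ g x ≤ 1) :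
    |∫ s, ∫ t, D s t * (f s * g t) ∂mu01 ∂mu01| ≤ c := by
  obtain ⟨hm, hb, hc⟩ := h
  have hfD : Measurable (Function.uncurry fun t s => f s * D s t) :=
    (hf.comp measurable_snd).mul (hm.comp measurable_swap)
  have habs : ∀ t s, |f s * D s t| ≤ 1 := by
    intro t s
    rw [abs_mul, abs_of_nonneg (hf' s).1]
    exact mul_le_one₀ (hf' s).2 (abs_nonneg _) (hb s t)
  have e1 : ∫ s, ∫ t, D s t * (f s * g t) ∂mu01 ∂mu01 =
      ∫ t, g t * (∫ s, f s * D s t ∂mu01) ∂mu01 := by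
    rw [integral_integral_swap]
    · congr 1; funext t
      rw [← integral_const_mul]
      congr 1; funext s; ring
    · refine integrable_bdd (hm.mul ((hf.comp measurable_fst).mul (hg.comp measurable_snd))) 1 ?_
      rintro ⟨s, t⟩
      simp only [Function.uncurry, abs_mul, abs_of_nonneg (hf' s).1, abs_of_nonneg (hg' t).1]
      exact mul_le_one₀ (hb s t) (mul_nonneg (hf' s).1 (hg' t).1)
        (mul_le_one₀ (hf' s).2 (hg' t).1 (hg' t).2)
  rw [e1]
  refine abs_int_le_of_sets _ (meas_int_right hfD mu01) 1
    (fun t => abs_int_le_one _ (habs t) _ (by simp)) c ?_ g hg hg'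
  intro T hT hT'
  have := fin_sub hT'
  rw [integral_integral_swap]
  · simp only [integral_const_mul]
    refine abs_int_le_of_sets _ (meas_int_right hm _) 1
      (fun s => abs_int_le_one _ (hb s) _ (real_sub_le hT')) c ?_ f hf hf'
    intro S hS hS'
    exact hc S T hS hT hS' hT'
  · exact integrable_bdd hfD 1 fun p => habs p.1 p.2

lemma count_one {k : ℕ} {D : ℝ → ℝ → ℝ} {c : ℝ} (h : CutBd D c) (e0 : Pr k) (s : Finset (Pr k))
    (hs : e0 ∉ s) (R : Pr k → ℝ → ℝ → ℝ) (hRm : ∀ e, Measurable (Function.uncurry (R e)))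
    (hR : ∀ e x y, 0 ≤ R e x y ∧ R e x y ≤ 1) :
    |∫ x, D (x e0.1.1) (x e0.1.2) * ∏ e ∈ s, R e (x e.1.1) (x e.1.2) ∂piI k| ≤ c := by
  classical
  obtain ⟨⟨i, j⟩, hij⟩ := e0
  have hij' : i < j := hij
  have hne := hij'.ne
  simp only
  have hprod : ∀ (s : Finset (Pr k)) (x : Fin k → ℝ), 0 ≤ ∏ e ∈ s, R e (x e.1.1) (x e.1.2) ∧
      ∏ e ∈ s, R e (x e.1.1) (x e.1.2) ≤ 1 := fun s x =>
    ⟨Finset.prod_nonneg fun e _ => (hR _ _ _).1,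
      Finset.prod_le_one (fun e _ => (hR _ _ _).1) fun e _ => (hR _ _ _).2⟩
  have hpm : ∀ (s : Finset (Pr k)), Measurable (fun x : Fin k → ℝ => ∏ e ∈ s, R e (x e.1.1) (x e.1.2)) :=
    fun s => Finset.measurable_prod _ fun e _ => measurable_pair (hRm e) _ _
  set Φ : (Fin k → ℝ) → ℝ := fun x => D (x i) (x j) * ∏ e ∈ s, R e (x e.1.1) (x e.1.2) with hΦ
  have hΦm : Measurable Φ := (measurable_pair h.1 i j).mul (hpm s)
  have hΦb : ∀ x, |Φ x| ≤ 1 := by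
    intro x
    rw [hΦ]
    simp only [abs_mul]
    rw [abs_of_nonneg (hprod s x).1]
    exact mul_le_one₀ (h.2.1 _ _) (hprod s x).1 (hprod s x).2
  have hupd : ∀ i, Measurable (fun p : (Fin k → ℝ) × ℝ => Function.update p.1 i p.2) :=
    fun i => (mp_update i).measurable
  have e1 : ∫ x, Φ x ∂piI k = ∫ x, ∫ s, ∫ t, Φ (Function.update (Function.update x i s) j t) ∂mu01 ∂mu01 ∂piI k := by
    rw [integral_update j Φ (integrable_bdd hΦm 1 hΦb)]
    have hm2 : Measurable fun x => ∫ t, Φ (Function.update x j t) ∂mu01 :=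
      (StronglyMeasurable.integral_prod_right (f := fun x t => Φ (Function.update x j t))
        (hΦm.comp (hupd j)).stronglyMeasurable).measurable
    rw [integral_update i _ (integrable_bdd hm2 1 fun x => abs_int_le_one _ (fun t => hΦb _) _ (by simp))]
  rw [e1]
  have key : ∀ x : Fin k → ℝ, |∫ s, ∫ t, Φ (Function.update (Function.update x i s) j t) ∂mu01 ∂mu01| ≤ c := by
    intro x
    let s1 := s.filter (fun e => e.1.1 = i ∨ e.1.2 = i)
    let s2 := s.filter (fun e => ¬ (e.1.1 = i ∨ e.1.2 = i))
    let f : ℝ → ℝ := fun u => ∏ e ∈ s1, R e (Function.update x i u e.1.1) (Function.update x i u e.1.2)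
    let g : ℝ → ℝ := fun t => ∏ e ∈ s2, R e (Function.update x j t e.1.1) (Function.update x j t e.1.2)
    have hfg : ∀ u t, Φ (Function.update (Function.update x i u) j t) = D u t * (f u * g t) := by
      intro u t
      simp only [hΦ]
      rw [← Finset.prod_filter_mul_prod_filter_not s (fun e => e.1.1 = i ∨ e.1.2 = i)]
      congr 1
      · simp [hne]
      · congr 1
        · refine Finset.prod_congr rfl fun e he => ?_
          have he' := (Finset.mem_filter.1 he)
          have hlt := e.2
          have h0 : ¬ (e.1.1 = i ∧ e.1.2 = j) := by
            rintro ⟨h1, h2⟩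
            exact hs ((Subtype.ext (Prod.ext h1 h2) : e = ⟨(i, j), hij⟩) ▸ he'.1)
          have h1 : e.1.1 ≠ j := by
            intro h1
            rcases he'.2 with h2 | h2
            · exact hne (h2.symm.trans h1)
            · rw [h1, h2] at hlt; exact hlt.not_gt hij'
          have h2 : e.1.2 ≠ j := by
            intro h2
            rcases he'.2 with h3 | h3
            · exact h0 ⟨h3, h2⟩
            · exact hne (h3.symm.trans h2)
          rw [Function.update_of_ne h1, Function.update_of_ne h2]
        · refine Finset.prod_congr rfl fun e he => ?_
          have he' := (Finset.mem_filter.1 he).2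
          push Not at he'
          rw [Function.update_comm hne, Function.update_of_ne he'.1, Function.update_of_ne he'.2]
    simp only [hfg]
    have hu : ∀ i, Measurable (fun u : ℝ => Function.update x i u) :=
      fun i => measurable_update x
    exact h.fun_bound f g ((hpm s1).comp (hu i)) (fun u => hprod s1 _)
      ((hpm s2).comp (hu j)) (fun u => hprod s2 _)
  have := norm_integral_le_of_norm_le_const (μ := piI k) (C := c)
    (f := fun x => ∫ s, ∫ t, Φ (Function.update (Function.update x i s) j t) ∂mu01 ∂mu01)
    (Eventually.of_forall key)
  simpa using this

/-- Edge factor. -/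
def facF {k : ℕ} (F : SimpleGraph (Fin k)) (U : ℝ → ℝ → ℝ) (e : Pr k) (y z : ℝ) : ℝ :=
  adjI F e.1.1 e.1.2 * U y z + (1 - adjI F e.1.1 e.1.2) * (1 - U y z)

lemma facF_bd {k : ℕ} (F : SimpleGraph (Fin k)) {U : ℝ → ℝ → ℝ} (hU : IsGraphon U) (e : Pr k) (y z : ℝ) :
    0 ≤ facF F U e y z ∧ facF F U e y z ≤ 1 := by
  have := graphon_bd hU y z
  unfold facF
  rcases adjI_cases F e.1.1 e.1.2 with h | h <;> rw [h.2] <;> constructor <;> linarith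

lemma facF_meas {k : ℕ} (F : SimpleGraph (Fin k)) {U : ℝ → ℝ → ℝ} (hU : IsGraphon U) (e : Pr k) :
    Measurable (Function.uncurry (facF F U e)) :=
  (hU.1.const_mul _).add ((measurable_const.sub hU.1).const_mul _)

lemma counting {k : ℕ} (F : SimpleGraph (Fin k)) {U W : ℝ → ℝ → ℝ} (hU : IsGraphon U) (hW : IsGraphon W)
    {c : ℝ} (h : CutBd (fun x y => U x y - W x y) c) :
    |indDensity F U - indDensity F W| ≤ Fintype.card (Pr k) * c := by
  classical
  let R : Finset (Pr k) → Pr k → ℝ → ℝ → ℝ := fun s e => if e ∈ s then facF F U e else facF F W e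
  have hRm : ∀ s e, Measurable (Function.uncurry (R s e)) := by
    intro s e; simp only [R]; split_ifs
    · exact facF_meas F hU e
    · exact facF_meas F hW e
  have hRb : ∀ s e x y, 0 ≤ R s e x y ∧ R s e x y ≤ 1 := by
    intro s e x y; simp only [R]; split_ifs
    · exact facF_bd F hU e _ _
    · exact facF_bd F hW e _ _
  have hIntg : ∀ s, Integrable (fun x : Fin k → ℝ => ∏ e, R s e (x e.1.1) (x e.1.2)) (piI k) := by
    intro s
    refine integrable_bdd (Finset.measurable_prod _ fun e _ => measurable_pair (hRm s e) _ _) 1 fun x => ?_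
    rw [abs_of_nonneg (Finset.prod_nonneg fun e _ => (hRb s e _ _).1)]
    exact Finset.prod_le_one (fun e _ => (hRb s e _ _).1) fun e _ => (hRb s e _ _).2
  have step : ∀ s : Finset (Pr k), |(∫ x, ∏ e, R s e (x e.1.1) (x e.1.2) ∂piI k) -
      ∫ x, ∏ e, R ∅ e (x e.1.1) (x e.1.2) ∂piI k| ≤ s.card * c := by
    intro s
    induction s using Finset.induction_on with
    | empty => simp
    | insert e0 s he ih =>
      have hd : |(∫ x, ∏ e, R (insert e0 s) e (x e.1.1) (x e.1.2) ∂piI k) -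
        ∫ x, ∏ e, R s e (x e.1.1) (x e.1.2) ∂piI k| ≤ c := by
        rw [← integral_sub (hIntg _) (hIntg _)]
        have e1 : ∀ x : Fin k → ℝ, (∏ e, R (insert e0 s) e (x e.1.1) (x e.1.2)) -
            ∏ e, R s e (x e.1.1) (x e.1.2) = (2 * adjI F e0.1.1 e0.1.2 - 1) *
            ((U (x e0.1.1) (x e0.1.2) - W (x e0.1.1) (x e0.1.2)) *
              ∏ e ∈ Finset.univ.erase e0, R s e (x e.1.1) (x e.1.2)) := by
          intro x
          rw [← Finset.mul_prod_erase Finset.univ (fun e => R (insert e0 s) e (x e.1.1) (x e.1.2)) (Finset.mem_univ e0),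
            ← Finset.mul_prod_erase Finset.univ (fun e => R s e (x e.1.1) (x e.1.2)) (Finset.mem_univ e0)]
          have : ∏ e ∈ Finset.univ.erase e0, R (insert e0 s) e (x e.1.1) (x e.1.2) =
              ∏ e ∈ Finset.univ.erase e0, R s e (x e.1.1) (x e.1.2) := by
            refine Finset.prod_congr rfl fun e he' => ?_
            have := Finset.ne_of_mem_erase he'
            simp only [R, Finset.mem_insert, this, false_or]
          rw [this]
          simp only [R, Finset.mem_insert_self, he, if_true, if_false, facF]
          ring
        simp only [e1]
        rw [integral_const_mul, abs_mul]
        have h1 : |2 * adjI F e0.1.1 e0.1.2 - 1| = 1 := by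
          rcases adjI_cases F e0.1.1 e0.1.2 with h | h <;> rw [h.2] <;> norm_num
        rw [h1, one_mul]
        exact count_one h e0 _ (Finset.notMem_erase _ _) (R s) (hRm s) (hRb s)
      rw [Finset.card_insert_of_notMem he]
      push_cast
      calc _ ≤ _ := abs_sub_le _ (∫ x, ∏ e, R s e (x e.1.1) (x e.1.2) ∂piI k) _
        _ ≤ c + s.card * c := add_le_add hd ih
        _ = _ := by ring
  have := step Finset.univ
  simp only [R, Finset.mem_univ, if_true, Finset.notMem_empty, if_false, Finset.card_univ] at this
  rw [indDensity_eq, indDensity_eq]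
  exact this


/-- The `i`-th block. -/
def blkS (n : ℕ) (i : Fin n) : Set ℝ := Set.Ioc (((i : ℕ) : ℝ) / n) ((((i : ℕ) : ℝ) + 1) / n)

lemma blkS_meas (n : ℕ) (i : Fin n) : MeasurableSet (blkS n i) := measurableSet_Ioc

lemma blkS_unique {n : ℕ} {i j : Fin n} {x : ℝ} (hi : x ∈ blkS n i) (hj : x ∈ blkS n j) : i = j := by
  have hn : (0:ℝ) < n := by exact_mod_cast i.pos
  simp only [blkS, Set.mem_Ioc, div_lt_iff₀ hn, le_div_iff₀ hn] at hi hj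
  have h1 : ((i:ℕ):ℝ) < (j:ℕ) + 1 := by linarith
  have h2 : ((j:ℕ):ℝ) < (i:ℕ) + 1 := by linarith
  have h1' : (i:ℕ) < (j:ℕ) + 1 := by exact_mod_cast h1
  have h2' : (j:ℕ) < (i:ℕ) + 1 := by exact_mod_cast h2
  exact Fin.ext (by omega)

lemma blkS_sub (n : ℕ) (i : Fin n) : blkS n i ⊆ I01 := by
  intro x hx
  have hn : (0:ℝ) < n := by exact_mod_cast i.pos
  have hi : ((i:ℕ):ℝ) + 1 ≤ n := by exact_mod_cast i.2
  refine ⟨le_trans (by positivity) hx.1.le, hx.2.trans ?_⟩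
  rw [div_le_one hn]; exact hi

lemma blkS_vol (n : ℕ) (i : Fin n) : volume.real (blkS n i) = 1 / n := by
  have hn : (0:ℝ) < n := by exact_mod_cast i.pos
  rw [blkS, Measure.real, Real.volume_Ioc, ENNReal.toReal_ofReal]
  · field_simp; ring
  · have : (((i : ℕ) : ℝ) + 1) / n - ((i : ℕ) : ℝ) / n = 1 / n := by field_simp; ring
    rw [this]; positivity

lemma graphonOf_blk {n : ℕ} (G : SimpleGraph (Fin n)) {i j : Fin n} {x y : ℝ} (hx : x ∈ blkS n i)
    (hy : y ∈ blkS n j) : graphonOf G x y = adjI G i j := by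
  have : (∃ i j : Fin n, G.Adj i j ∧ x ∈ Set.Ioc (((i : ℕ) : ℝ) / n) ((((i : ℕ) : ℝ) + 1) / n)
      ∧ y ∈ Set.Ioc (((j : ℕ) : ℝ) / n) ((((j : ℕ) : ℝ) + 1) / n)) ↔ G.Adj i j := by
    constructor
    · rintro ⟨i', j', h, hx', hy'⟩
      rw [blkS_unique hx hx', blkS_unique hy hy']; exact h
    · intro h; exact ⟨i, j, h, hx, hy⟩
  unfold graphonOf
  by_cases h : G.Adj i j
  · rw [if_pos (this.2 h)]; simp [adjI, h]
  · rw [if_neg (fun h' => h (this.1 h'))]; simp [adjI, h]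

lemma graphonOf_isGraphon {n : ℕ} (G : SimpleGraph (Fin n)) : IsGraphon (graphonOf G) := by
  classical
  refine ⟨?_, ?_, ?_⟩
  · have hm : MeasurableSet {p : ℝ × ℝ | ∃ i j : Fin n, G.Adj i j ∧ p.1 ∈ Set.Ioc (((i : ℕ) : ℝ) / n) ((((i : ℕ) : ℝ) + 1) / n)
      ∧ p.2 ∈ Set.Ioc (((j : ℕ) : ℝ) / n) ((((j : ℕ) : ℝ) + 1) / n)} := by
      have : {p : ℝ × ℝ | ∃ i j : Fin n, G.Adj i j ∧ p.1 ∈ Set.Ioc (((i : ℕ) : ℝ) / n) ((((i : ℕ) : ℝ) + 1) / n)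
      ∧ p.2 ∈ Set.Ioc (((j : ℕ) : ℝ) / n) ((((j : ℕ) : ℝ) + 1) / n)} =
        ⋃ i : Fin n, ⋃ j : Fin n, ⋃ _ : G.Adj i j, (blkS n i) ×ˢ (blkS n j) := by
        ext p
        simp only [Set.mem_iUnion, Set.mem_prod, Set.mem_ofPred_eq, blkS, exists_prop]
      rw [this]
      exact MeasurableSet.iUnion fun i => MeasurableSet.iUnion fun j => MeasurableSet.iUnion fun _ =>
        (blkS_meas n i).prod (blkS_meas n j)
    exact Measurable.ite hm measurable_const measurable_const
  · intro x y
    unfold graphonOf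
    have : (∃ i j : Fin n, G.Adj i j ∧ x ∈ Set.Ioc (((i : ℕ) : ℝ) / n) ((((i : ℕ) : ℝ) + 1) / n)
      ∧ y ∈ Set.Ioc (((j : ℕ) : ℝ) / n) ((((j : ℕ) : ℝ) + 1) / n)) ↔
      (∃ i j : Fin n, G.Adj i j ∧ y ∈ Set.Ioc (((i : ℕ) : ℝ) / n) ((((i : ℕ) : ℝ) + 1) / n)
      ∧ x ∈ Set.Ioc (((j : ℕ) : ℝ) / n) ((((j : ℕ) : ℝ) + 1) / n)) :=
      ⟨fun ⟨i, j, h, h1, h2⟩ => ⟨j, i, h.symm, h2, h1⟩, fun ⟨i, j, h, h1, h2⟩ => ⟨j, i, h.symm, h2, h1⟩⟩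
    simp only [this]
  · intro x y
    unfold graphonOf
    split_ifs <;> simp

lemma pw_comap {n k : ℕ} (G : SimpleGraph (Fin n)) (f : Fin k → Fin n) (x : Fin k → ℝ)
    (hx : ∀ i, x i ∈ blkS n (f i)) : pw (G.comap f) (fun i j => graphonOf G (x i) (x j)) = 1 := by
  unfold pw
  apply Finset.prod_eq_one
  intro e _
  beta_reduce
  rw [graphonOf_blk G (hx _) (hx _)]
  have : adjI (SimpleGraph.comap f G) e.1.1 e.1.2 = adjI G (f e.1.1) (f e.1.2) := by
    by_cases h : G.Adj (f e.1.1) (f e.1.2) <;> simp [adjI, h]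
  rw [this]
  rcases adjI_cases G (f e.1.1) (f e.1.2) with h | h <;> simp [h.2]

lemma EG_graphonOf_ge {n k : ℕ} (G : SimpleGraph (Fin n)) (P : GraphProp) (hP : IsGraphProperty P) :
    (goodCount G k P : ℝ) * k.factorial * (1 / n) ^ k ≤ EG (graphonOf G) (indP (k := k) P) := by
  classical
  have hG := graphonOf_isGraphon G
  let src : Finset (KSub n k × Equiv.Perm (Fin k)) :=
    (Finset.univ.filter fun S : KSub n k => G.comap (kem S) ∈ P k) ×ˢ Finset.univ
  let mk : KSub n k × Equiv.Perm (Fin k) → (Fin k → Fin n) := fun p i => kem p.1 (p.2 i)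
  have hmk : Function.Injective mk := by
    rintro ⟨S, π⟩ ⟨T, τ⟩ h
    have h' : ∀ i, kem S (π i) = kem T (τ i) := fun i => congrFun h i
    have hST : S = T := by
      apply Subtype.ext
      have hr : ∀ S : KSub n k, (S.1 : Set (Fin n)) = Set.range (kem S) := fun S =>
        (Finset.range_orderEmbOfFin S.1 S.2).symm
      apply Finset.coe_injective
      rw [hr, hr]
      ext v
      constructor
      · rintro ⟨i, rfl⟩
        exact ⟨τ (π.symm i), by rw [← h']; simp⟩
      · rintro ⟨i, rfl⟩
        exact ⟨π (τ.symm i), by rw [h']; simp⟩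
    subst hST
    have : π = τ := by
      ext i
      have := (kem S).injective (h' i)
      rw [this]
    rw [this]
  let T := src.image mk
  have hcard : (T.card : ℝ) = (goodCount G k P : ℝ) * k.factorial := by
    rw [Finset.card_image_of_injective _ hmk, Finset.card_product, goodCount_eq G P hP]
    unfold indP
    rw [Finset.sum_boole]
    simp [Fintype.card_perm]
  have hT : ∀ f ∈ T, G.comap f ∈ P k := by
    intro f hf
    obtain ⟨⟨S, π⟩, hS, rfl⟩ := Finset.mem_image.1 hf
    have hS' : G.comap (kem S) ∈ P k := by
      simpa [src] using hS
    refine (hP k (G.comap (kem S)) _ ⟨⟨π.symm, ?_⟩⟩).1 hS'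
    intro a b
    simp [mk]
  let box : (Fin k → Fin n) → Set (Fin k → ℝ) := fun f => Set.univ.pi fun i => blkS n (f i)
  have hbm : ∀ f, MeasurableSet (box f) := fun f => MeasurableSet.univ_pi fun i => blkS_meas _ _
  have hbv : ∀ f, (piI k).real (box f) = (1 / n) ^ k := by
    intro f
    rw [Measure.real, Measure.pi_pi, ENNReal.toReal_prod]
    have : ∀ i, (mu01 (blkS n (f i))).toReal = 1 / n := by
      intro i
      rw [mu01, Measure.restrict_apply (blkS_meas _ _), Set.inter_eq_left.2 (blkS_sub _ _)]
      exact blkS_vol n (f i)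
    simp [this]
  rw [EG_eq hG, ← hcard]
  have h1 : (T.card : ℝ) * (1 / n) ^ k = ∫ x, ∑ f ∈ T, (box f).indicator (fun _ => (1:ℝ)) x ∂piI k := by
    rw [integral_finsetSum _ fun f _ => (integrable_const (1:ℝ)).indicator (hbm f)]
    simp only [integral_indicator (hbm _), integral_const, smul_eq_mul, mul_one,
      measureReal_restrict_apply_univ, hbv, Finset.sum_const, nsmul_eq_mul]
  rw [h1]
  have hq0 : ∀ x : Fin k → ℝ, ∀ F : SimpleGraph (Fin k), 0 ≤ indP P F * pw F (fun i j => graphonOf G (x i) (x j)) :=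
    fun x F => mul_nonneg (indP_mem P F).1 (pw_nonneg _ _ fun i j => graphon_bd hG _ _)
  apply integral_mono
  · exact integrable_finsetSum _ fun f _ => (integrable_const (1:ℝ)).indicator (hbm f)
  · exact integrable_finsetSum _ fun F _ => (integrable_pw F hG).const_mul _
  · intro x
    simp only
    by_cases hx : ∃ f ∈ T, x ∈ box f
    · obtain ⟨f, hf, hxf⟩ := hx
      have hxf' : ∀ i, x i ∈ blkS n (f i) := fun i => hxf i (Set.mem_univ i)
      rw [Finset.sum_eq_single f]
      · rw [Set.indicator_of_mem hxf]
        refine le_trans ?_ (Finset.single_le_sum (fun F _ => hq0 x F) (Finset.mem_univ (G.comap f)))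
        rw [pw_comap G f x hxf']
        simp [indP, hT f hf]
      · intro g _ hgf
        apply Set.indicator_of_notMem
        intro hxg
        exact hgf (funext fun i => blkS_unique (hxg i (Set.mem_univ i)) (hxf' i))
      · intro h; exact absurd hf h
    · push Not at hx
      rw [Finset.sum_eq_zero fun f hf => Set.indicator_of_notMem (hx f hf) _]
      exact Finset.sum_nonneg fun F _ => hq0 x F

lemma indDensity_invMP {k : ℕ} (F : SimpleGraph (Fin k)) {W : ℝ → ℝ → ℝ} (hW : IsGraphon W) (φ : InvMP) :
    indDensity F (fun x y => W (φ.toFun x) (φ.toFun y)) = indDensity F W := by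
  rw [indDensity_eq, indDensity_eq]
  have h : MeasurePreserving (fun (a : Fin k → ℝ) i => φ.toFun (a i)) (piI k) (piI k) :=
    measurePreserving_pi (ι := Fin k) (fun _ => mu01) (fun _ => mu01) (fun _ => φ.measurePreserving)
  conv_rhs => rw [← h.map_eq]
  rw [integral_map h.measurable.aemeasurable]
  exact (measurable_pw F hW.1).aestronglyMeasurable

lemma invMP_graphon {W : ℝ → ℝ → ℝ} (hW : IsGraphon W) (φ : InvMP) :
    IsGraphon (fun x y => W (φ.toFun x) (φ.toFun y)) := by
  have h := φ.measurePreserving.measurable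
  refine ⟨?_, fun x y => hW.2.1 _ _, fun x y => hW.2.2 _ _⟩
  exact hW.1.comp ((h.comp measurable_fst).prodMk (h.comp measurable_snd))

lemma cutBd_cutNorm {U W : ℝ → ℝ → ℝ} (hU : IsGraphon U) (hW : IsGraphon W) :
    CutBd (fun x y => U x y - W x y) (cutNorm (fun x y => U x y - W x y)) := by
  have hb : ∀ x y, |U x y - W x y| ≤ 1 := by
    intro x y
    have := graphon_bd hU x y
    have := graphon_bd hW x y
    rw [abs_le]; constructor <;> linarith
  refine ⟨hU.1.sub hW.1, hb, ?_⟩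
  intro S T hS hT hS' hT'
  refine le_csSup ⟨1, ?_⟩ ⟨S, T, hS, hT, hS', hT', rfl⟩
  rintro r ⟨S, T, hS, hT, hS', hT', rfl⟩
  have := fin_sub hS'
  have := fin_sub hT'
  exact abs_int_le_one _ (fun x => abs_int_le_one _ (hb x) _ (real_sub_le hT')) _ (real_sub_le hS')

def InvMP.refl : InvMP where
  toFun := id
  invFun := id
  maps := fun _ h => h
  mapsInv := fun _ h => h
  measurePreserving := MeasurePreserving.id _
  measurePreservingInv := MeasurePreserving.id _
  leftInv := fun _ _ => rfl
  rightInv := fun _ _ => rfl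

instance : Nonempty InvMP := ⟨InvMP.refl⟩

lemma EG_close {k : ℕ} {U W : ℝ → ℝ → ℝ} (hU : IsGraphon U) (hW : IsGraphon W) (c : ℝ)
    (hc : deltaCut U W < c) (P : GraphProp) :
    EG U (indP (k := k) P) - EG W (indP (k := k) P) ≤
      Fintype.card (SimpleGraph (Fin k)) * (Fintype.card (Pr k) * c) := by
  obtain ⟨φ, hφ⟩ := exists_lt_of_ciInf_lt hc
  have hWφ := invMP_graphon hW φ
  have hb := cutBd_cutNorm hU hWφ
  unfold EG
  rw [← Finset.sum_sub_distrib]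
  calc _ ≤ ∑ F : SimpleGraph (Fin k), ((Fintype.card (Pr k) : ℝ) * c) := by
        refine Finset.sum_le_sum fun F _ => ?_
        have h1 := counting F hU hWφ hb
        rw [indDensity_invMP F hW φ] at h1
        have h2 := indP_mem P F
        have h3 : |indDensity F U - indDensity F W| ≤ Fintype.card (Pr k) * c :=
          h1.trans (mul_le_mul_of_nonneg_left hφ.le (by positivity))
        rw [← mul_sub]
        calc _ ≤ |indP P F * (indDensity F U - indDensity F W)| := le_abs_self _
          _ = indP P F * |indDensity F U - indDensity F W| := by rw [abs_mul, abs_of_nonneg h2.1]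
          _ ≤ 1 * |indDensity F U - indDensity F W| := mul_le_mul_of_nonneg_right h2.2 (abs_nonneg _)
          _ ≤ _ := by rw [one_mul]; exact h3
    _ = _ := by rw [Finset.sum_const, Finset.card_univ, nsmul_eq_mul]

lemma closure_prob_ge (P P' : GraphProp) (hP' : IsGraphProperty P')
    (h1 : ∀ (n : ℕ) (G : SimpleGraph (Fin n)), G ∈ P n → ∀ k, 1 ≤ k → k ≤ n →
      2 * n.choose k ≤ 3 * goodCount G k P')
    {W : ℝ → ℝ → ℝ} (hW : IsGraphon W) (hmem : W ∈ closureP P) (k : ℕ) (hk : 1 ≤ k) :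
    2 / 3 ≤ EG W (indP (k := k) P') := by
  obtain ⟨-, n, G, hG, hn, hδ⟩ := hmem
  set C : ℝ := Fintype.card (SimpleGraph (Fin k)) * Fintype.card (Pr k) with hC
  have hnr : Tendsto (fun m => ((n m : ℕ) : ℝ)) atTop atTop := tendsto_natCast_atTop_atTop.comp hn
  have hlim : Tendsto (fun m => 2 / 3 * (1 - ((k:ℝ) - 1) / (n m)) ^ k
      - C * (deltaCut (graphonOf (G m)) W + 1 / ((m:ℝ) + 1))) atTop
      (𝓝 (2 / 3 * (1 - 0) ^ k - C * (0 + 0))) := by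
    have hdiv : Tendsto (fun m => ((k:ℝ) - 1) / (n m)) atTop (𝓝 0) := hnr.const_div_atTop _
    exact (((tendsto_const_nhds.sub hdiv).pow k).const_mul _).sub
      ((hδ.add tendsto_one_div_add_atTop_nhds_zero_nat).const_mul _)
  have : (2:ℝ) / 3 * (1 - 0) ^ k - C * (0 + 0) = 2 / 3 := by simp
  rw [this] at hlim
  refine le_of_tendsto hlim ?_
  filter_upwards [hn.eventually_ge_atTop k] with m hm
  have hGg := graphonOf_isGraphon (G m)
  have hclose := EG_close (k := k) hGg hW (deltaCut (graphonOf (G m)) W + 1 / ((m:ℝ) + 1))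
    (by have : (0:ℝ) < 1 / ((m:ℝ) + 1) := by positivity
        linarith) P'
  have hge := EG_graphonOf_ge (k := k) (G m) P' hP'
  have hcnt := h1 (n m) (G m) (hG m) k hk hm
  have hcnt' : 2 * ((n m).choose k : ℝ) ≤ 3 * goodCount (G m) k P' := by exact_mod_cast hcnt
  have hN : (0:ℝ) < n m := by exact_mod_cast lt_of_lt_of_le hk hm
  have hdesc : ((n m : ℝ) + 1 - k) ^ k ≤ ((n m).choose k : ℝ) * k.factorial := by
    have := Nat.pow_sub_le_descFactorial (n m) k
    rw [Nat.descFactorial_eq_factorial_mul_choose, mul_comm] at this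
    have h' : (((n m + 1 - k) ^ k : ℕ) : ℝ) ≤ (((n m).choose k * k.factorial : ℕ) : ℝ) := by
      exact_mod_cast this
    rw [Nat.cast_pow, Nat.cast_sub (by omega)] at h'
    push_cast at h'
    exact h'
  have e1 : (1 - ((k:ℝ) - 1) / (n m)) ^ k = ((n m : ℝ) + 1 - k) ^ k * (1 / n m) ^ k := by
    rw [← mul_pow]; congr 1; field_simp; ring
  have e2 : 2 / 3 * (1 - ((k:ℝ) - 1) / (n m)) ^ k ≤ (goodCount (G m) k P' : ℝ) * k.factorial * (1 / n m) ^ k := by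
    rw [e1, ← mul_assoc]
    apply mul_le_mul_of_nonneg_right _ (by positivity)
    have hf : (0:ℝ) < k.factorial := by exact_mod_cast k.factorial_pos
    nlinarith
  rw [hC]
  linarith


lemma graphD1_nonneg {n : ℕ} (G H : SimpleGraph (Fin n)) : 0 ≤ graphD1 G H := by
  unfold graphD1; positivity

lemma graphD1_le_one {n : ℕ} (G H : SimpleGraph (Fin n)) : graphD1 G H ≤ 1 := by
  classical
  unfold graphD1
  apply div_le_one_of_le₀ _ (by positivity)
  have h1 : (symmDiff G.edgeSet H.edgeSet).ncard ≤ (Set.univ : Set (Fin n × Fin n)).ncard := by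
    have hs : symmDiff G.edgeSet H.edgeSet ⊆ (fun p : Fin n × Fin n => s(p.1, p.2)) '' Set.univ := by
      intro e _
      induction e using Sym2.ind with
      | _ a b => exact ⟨(a, b), Set.mem_univ _, rfl⟩
    exact (Set.ncard_le_ncard hs (Set.toFinite _)).trans (Set.ncard_image_le (Set.toFinite _))
  have h2 : (Set.univ : Set (Fin n × Fin n)).ncard = n ^ 2 := by
    rw [Set.ncard_univ, Nat.card_prod]; simp [sq]
  rw [h2] at h1
  exact_mod_cast h1

lemma forward_dir (P : GraphProp) (hT : GraphTestable P)
    (W : ℝ → ℝ → ℝ) (hW : IsGraphon W) (hmem : W ∈ closureP P) :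
      Tendsto (fun k => ∑ F : SimpleGraph (Fin k),
        ENNReal.ofReal (indDensity F W) * graphD1P F P) atTop (nhds 0) := by
  classical
  obtain ⟨P', hP', h1, h2⟩ := hT
  rw [ENNReal.tendsto_nhds_zero]
  intro ε' hε'
  by_cases htop : ε' = ⊤
  · exact Eventually.of_forall fun k => htop ▸ le_top
  set ε : ℝ := ε'.toReal / 2 with hεdef
  have hε : 0 < ε := by
    have := ENNReal.toReal_pos hε'.ne' htop
    positivity
  obtain ⟨k, hk1, hk⟩ := h2 ε hε
  set q := EG W (indP (k := k) P') with hq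
  have hq23 : 2 / 3 ≤ q := closure_prob_ge P P' hP' h1 hW hmem k hk1
  have hlim : Tendsto (fun n : ℕ => 9 * (k:ℝ) ^ 2 / n) atTop (𝓝 0) :=
    tendsto_const_nhds.div_atTop tendsto_natCast_atTop_atTop
  filter_upwards [eventually_ge_atTop k, hlim.eventually (gt_mem_nhds (lt_min hε one_pos))] with n hn hsmall
  have hn0 : 0 < n := by omega
  have hnR : (0:ℝ) < n := by exact_mod_cast hn0
  let bad : SimpleGraph (Fin n) → ℝ := fun F => if ENNReal.ofReal ε ≤ graphD1P F P then 1 else 0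
  have hC : (0:ℝ) < n.choose k := by exact_mod_cast Nat.choose_pos hn
  have hpt : ∀ F : SimpleGraph (Fin n), bad F * ((n.choose k : ℝ) ^ 2 / 9) ≤
      ((goodCount F k P' : ℝ) - q * n.choose k) ^ 2 := by
    intro F
    by_cases hF : ENNReal.ofReal ε ≤ graphD1P F P
    · have := hk n F k le_rfl hn hF
      have h3 : 3 * (goodCount F k P' : ℝ) ≤ n.choose k := by exact_mod_cast this
      simp only [bad, if_pos hF]
      have h4 : (n.choose k : ℝ) / 3 ≤ q * n.choose k - goodCount F k P' := by nlinarith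
      nlinarith
    · simp only [bad, if_neg hF, zero_mul]; positivity
  have hbad : EG W bad ≤ 9 * (k:ℝ) ^ 2 / n := by
    have hconc := concentration hn0 (by omega : 0 < k) hW P' hP'
    rw [← hq] at hconc
    have := EG_mono hW _ _ hpt
    have e : EG W (fun F => bad F * ((n.choose k : ℝ) ^ 2 / 9)) = EG W bad * ((n.choose k : ℝ) ^ 2 / 9) := by
      unfold EG; rw [Finset.sum_mul]; exact Finset.sum_congr rfl fun F _ => by ring
    rw [e] at this
    rw [le_div_iff₀ hnR]
    have h5 : EG W bad * n * (n.choose k : ℝ) ^ 2 ≤ 9 * (k:ℝ) ^ 2 * (n.choose k : ℝ) ^ 2 := by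
      nlinarith
    exact le_of_mul_le_mul_right h5 (by positivity)
  have hb1 : EG W bad < 1 := lt_of_le_of_lt hbad (hsmall.trans_le (min_le_right _ _))
  have hb2 : EG W bad ≤ ε := (hbad.trans_lt (hsmall.trans_le (min_le_left _ _))).le
  obtain ⟨F0, hF0⟩ : ∃ F : SimpleGraph (Fin n), ¬ ENNReal.ofReal ε ≤ graphD1P F P := by
    by_contra hcon
    push Not at hcon
    have : bad = fun _ => 1 := by funext F; simp [bad, hcon F]
    rw [this, EG_const hW] at hb1
    exact lt_irrefl _ hb1
  have hne : ∃ H, H ∈ P n := by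
    by_contra hcon
    push Not at hcon
    apply hF0
    unfold graphD1P
    simp [hcon]
  obtain ⟨H0, hH0⟩ := hne
  have hle1 : ∀ F : SimpleGraph (Fin n), graphD1P F P ≤ 1 := by
    intro F
    refine (iInf₂_le H0 hH0).trans ?_
    rw [ENNReal.ofReal_le_one]
    exact graphD1_le_one F H0
  have hbd : ∀ F : SimpleGraph (Fin n), graphD1P F P ≤ ENNReal.ofReal (ε + bad F) := by
    intro F
    by_cases hF : ENNReal.ofReal ε ≤ graphD1P F P
    · refine (hle1 F).trans ?_
      simp only [bad, if_pos hF, ENNReal.one_le_ofReal]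
      linarith
    · simp only [bad, if_neg hF, add_zero]
      exact (not_le.1 hF).le
  have hb0 : ∀ F, 0 ≤ bad F := fun F => by simp only [bad]; split_ifs <;> simp
  calc ∑ F : SimpleGraph (Fin n), ENNReal.ofReal (indDensity F W) * graphD1P F P
      ≤ ∑ F : SimpleGraph (Fin n), ENNReal.ofReal ((ε + bad F) * indDensity F W) := by
        refine Finset.sum_le_sum fun F _ => ?_
        rw [mul_comm, ENNReal.ofReal_mul (add_nonneg hε.le (hb0 F))]
        gcongr
        exact hbd F
    _ = ENNReal.ofReal (∑ F : SimpleGraph (Fin n), (ε + bad F) * indDensity F W) := by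
        rw [ENNReal.ofReal_sum_of_nonneg fun F _ =>
          mul_nonneg (add_nonneg hε.le (hb0 F)) (indDensity_nonneg F hW)]
    _ ≤ ENNReal.ofReal ε'.toReal := by
        apply ENNReal.ofReal_le_ofReal
        simp only [add_mul, Finset.sum_add_distrib]
        rw [← Finset.mul_sum, EG_one hW]
        have : ∑ F : SimpleGraph (Fin n), bad F * indDensity F W = EG W bad := rfl
        rw [this]
        linarith
    _ = ε' := ENNReal.ofReal_toReal htop


/-- Indicator function of a block. -/
def bI (k : ℕ) (i : Fin k) (y : ℝ) : ℝ := (blkS k i).indicator (fun _ => (1:ℝ)) y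

/-- Step function with the given matrix of values. -/
def stepF {k : ℕ} (M : Fin k → Fin k → ℝ) (y z : ℝ) : ℝ := ∑ i, ∑ j, M i j * bI k i y * bI k j z

lemma bI_meas (k : ℕ) (i : Fin k) : Measurable (bI k i) :=
  measurable_const.indicator (blkS_meas k i)

lemma bI_mem (k : ℕ) (i : Fin k) (y : ℝ) : 0 ≤ bI k i y ∧ bI k i y ≤ 1 := by
  unfold bI Set.indicator; split_ifs <;> simp

lemma bI_in {k : ℕ} {i : Fin k} {y : ℝ} (h : y ∈ blkS k i) (j : Fin k) :
    bI k j y = if j = i then 1 else 0 := by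
  unfold bI Set.indicator
  by_cases hj : j = i
  · subst hj; simp [h]
  · rw [if_neg hj, if_neg]; intro h'; exact hj (blkS_unique h' h)

lemma stepF_in {k : ℕ} (M : Fin k → Fin k → ℝ) {i j : Fin k} {y z : ℝ} (hy : y ∈ blkS k i)
    (hz : z ∈ blkS k j) : stepF M y z = M i j := by
  unfold stepF
  simp [bI_in hy, bI_in hz]

lemma stepF_meas {k : ℕ} (M : Fin k → Fin k → ℝ) : Measurable (Function.uncurry (stepF M)) := by
  unfold stepF Function.uncurry
  refine Finset.measurable_sum _ fun i _ => Finset.measurable_sum _ fun j _ => ?_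
  exact (((bI_meas k i).comp measurable_fst).const_mul _).mul ((bI_meas k j).comp measurable_snd)

lemma stepF_bdd {k : ℕ} (M : Fin k → Fin k → ℝ) (y z : ℝ) : |stepF M y z| ≤ ∑ i, ∑ j, |M i j| := by
  unfold stepF
  refine (Finset.abs_sum_le_sum_abs _ _).trans (Finset.sum_le_sum fun i _ => ?_)
  refine (Finset.abs_sum_le_sum_abs _ _).trans (Finset.sum_le_sum fun j _ => ?_)
  rw [abs_mul, abs_mul, abs_of_nonneg (bI_mem k i y).1, abs_of_nonneg (bI_mem k j z).1]
  have h1 := bI_mem k i y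
  have h2 := bI_mem k j z
  have h3 : bI k i y * bI k j z ≤ 1 := mul_le_one₀ h1.2 h2.1 h2.2
  nlinarith [abs_nonneg (M i j)]

lemma exists_blk {k : ℕ} (hk : 0 < k) {y : ℝ} (hy : y ∈ I01) (h0 : y ≠ 0) : ∃ i, y ∈ blkS k i := by
  have hkR : (0:ℝ) < k := by exact_mod_cast hk
  have hy0 : 0 < y := lt_of_le_of_ne hy.1 (Ne.symm h0)
  have hc : 0 < ⌈y * k⌉₊ := Nat.ceil_pos.2 (by positivity)
  have hc2 : ⌈y * k⌉₊ ≤ k := Nat.ceil_le.2 (by have := hy.2; nlinarith)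
  refine ⟨⟨⌈y * k⌉₊ - 1, by omega⟩, ?_⟩
  have e : ((⌈y * k⌉₊ - 1 : ℕ) : ℝ) = (⌈y * k⌉₊ : ℝ) - 1 := by
    rw [Nat.cast_sub hc]; simp
  simp only [blkS, Set.mem_Ioc, e]
  rw [div_lt_iff₀ hkR, le_div_iff₀ hkR]
  have h1 := Nat.ceil_lt_add_one (show 0 ≤ y * k by positivity)
  have h2 := Nat.le_ceil (y * k)
  constructor <;> linarith

lemma graphonOf_step {k : ℕ} (H : SimpleGraph (Fin k)) (y z : ℝ) :
    graphonOf H y z = stepF (adjI H) y z := by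
  by_cases hy : ∃ i, y ∈ blkS k i
  · by_cases hz : ∃ j, z ∈ blkS k j
    · obtain ⟨i, hi⟩ := hy
      obtain ⟨j, hj⟩ := hz
      rw [graphonOf_blk H hi hj, stepF_in _ hi hj]
    · have : graphonOf H y z = 0 := by
        unfold graphonOf; rw [if_neg]; rintro ⟨i, j, _, _, h⟩; exact hz ⟨j, h⟩
      rw [this]; unfold stepF; symm
      refine Finset.sum_eq_zero fun i _ => Finset.sum_eq_zero fun j _ => ?_
      have : bI k j z = 0 := Set.indicator_of_notMem (fun h => hz ⟨j, h⟩) _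
      rw [this, mul_zero]
  · have : graphonOf H y z = 0 := by
      unfold graphonOf; rw [if_neg]; rintro ⟨i, j, _, h, _⟩; exact hy ⟨i, h⟩
    rw [this]; unfold stepF; symm
    refine Finset.sum_eq_zero fun i _ => Finset.sum_eq_zero fun j _ => ?_
    have : bI k i y = 0 := Set.indicator_of_notMem (fun h => hy ⟨i, h⟩) _
    rw [this, mul_zero, zero_mul]

lemma integral_stepF {k : ℕ} (M : Fin k → Fin k → ℝ) (μ ν : Measure ℝ) [IsFiniteMeasure μ] [IsFiniteMeasure ν] :
    ∫ y, ∫ z, stepF M y z ∂ν ∂μ = ∑ i, ∑ j, M i j * μ.real (blkS k i) * ν.real (blkS k j) := by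
  have hIntg : ∀ (μ : Measure ℝ) [IsFiniteMeasure μ] (i : Fin k), Integrable (bI k i) μ := fun μ _ i =>
    integrable_bdd (bI_meas k i) 1 fun y => by rw [abs_of_nonneg (bI_mem k i y).1]; exact (bI_mem k i y).2
  have hval : ∀ (μ : Measure ℝ) [IsFiniteMeasure μ] (i : Fin k), ∫ y, bI k i y ∂μ = μ.real (blkS k i) := by
    intro μ _ i
    unfold bI
    rw [integral_indicator (blkS_meas k i)]
    simp
  have h1 : ∀ y, ∫ z, stepF M y z ∂ν = ∑ i, ∑ j, M i j * bI k i y * ν.real (blkS k j) := by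
    intro y
    unfold stepF
    rw [integral_finsetSum _ fun i _ => integrable_finsetSum _ fun j _ => (hIntg ν j).const_mul _]
    refine Finset.sum_congr rfl fun i _ => ?_
    rw [integral_finsetSum _ fun j _ => (hIntg ν j).const_mul _]
    refine Finset.sum_congr rfl fun j _ => ?_
    rw [integral_const_mul, hval]
  simp only [h1]
  rw [integral_finsetSum _ fun i _ => integrable_finsetSum _ fun j _ => ((hIntg μ i).const_mul _).mul_const _]
  refine Finset.sum_congr rfl fun i _ => ?_
  rw [integral_finsetSum _ fun j _ => ((hIntg μ i).const_mul _).mul_const _]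
  refine Finset.sum_congr rfl fun j _ => ?_
  rw [integral_mul_const, integral_const_mul, hval]

lemma Q4_bound {k : ℕ} (hk : 0 < k) (M : Fin k → Fin k → ℝ) (s t : Fin k → ℝ) (hs0 : ∀ i, 0 ≤ s i)
    (hs : ∀ i, s i ≤ 1 / k) (ht0 : ∀ i, 0 ≤ t i) (ht : ∀ i, t i ≤ 1 / k) (ρ : ℝ) (hρ : 0 ≤ ρ)
    (hQ : Q4 M ≤ (ρ * k) ^ 4) : |∑ i, ∑ j, M i j * s i * t j| ≤ ρ := by
  have hkR : (0:ℝ) < k := by exact_mod_cast hk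
  set c : Fin k → ℝ := fun j => ∑ i, M i j * s i with hc
  have e1 : ∑ i, ∑ j, M i j * s i * t j = ∑ j, c j * t j := by
    rw [Finset.sum_comm]
    exact Finset.sum_congr rfl fun j _ => by rw [hc, Finset.sum_mul]
  have hsq : ∀ (t : Fin k → ℝ), (∀ i, 0 ≤ t i) → (∀ i, t i ≤ 1 / k) → ∑ j, t j ^ 2 ≤ 1 / k := by
    intro t h0 h1
    calc ∑ j, t j ^ 2 ≤ ∑ _j : Fin k, (1 / (k:ℝ)) ^ 2 := Finset.sum_le_sum fun j _ =>
          pow_le_pow_left₀ (h0 j) (h1 j) 2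
      _ = 1 / k := by simp; field_simp
  have h1 : (∑ j, c j * t j) ^ 2 ≤ (∑ j, c j ^ 2) * (1 / k) :=
    (Finset.sum_mul_sq_le_sq_mul_sq _ _ _).trans
      (mul_le_mul_of_nonneg_left (hsq t ht0 ht) (Finset.sum_nonneg fun j _ => sq_nonneg _))
  have e2 : ∑ j, c j ^ 2 = ∑ p : Fin k × Fin k, (∑ j, M p.1 j * M p.2 j) * (s p.1 * s p.2) := by
    rw [Fintype.sum_prod_type]
    simp only [hc, sq, Finset.sum_mul_sum]
    rw [Finset.sum_comm]
    refine Finset.sum_congr rfl fun i _ => ?_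
    rw [Finset.sum_comm]
    refine Finset.sum_congr rfl fun i' _ => ?_
    rw [Finset.sum_mul]
    exact Finset.sum_congr rfl fun j _ => by ring
  have h2 : (∑ j, c j ^ 2) ^ 2 ≤ Q4 M * (1 / k * (1 / k)) := by
    rw [e2]
    refine (Finset.sum_mul_sq_le_sq_mul_sq _ _ _).trans ?_
    have : ∑ p : Fin k × Fin k, (∑ j, M p.1 j * M p.2 j) ^ 2 = Q4 M := by
      rw [Fintype.sum_prod_type]; rfl
    rw [this]
    apply mul_le_mul_of_nonneg_left _ (by unfold Q4; positivity)
    have : ∑ p : Fin k × Fin k, (s p.1 * s p.2) ^ 2 = (∑ i, s i ^ 2) * (∑ i, s i ^ 2) := by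
      rw [Fintype.sum_prod_type, Finset.sum_mul_sum]
      exact Finset.sum_congr rfl fun i _ => Finset.sum_congr rfl fun j _ => by ring
    rw [this]
    exact mul_le_mul (hsq s hs0 hs) (hsq s hs0 hs) (Finset.sum_nonneg fun j _ => sq_nonneg _) (by positivity)
  rw [e1]
  have h3 : |∑ j, c j * t j| ^ 4 ≤ ρ ^ 4 := by
    have hx : |∑ j, c j * t j| ^ 4 = ((∑ j, c j * t j) ^ 2) ^ 2 := by
      rw [← sq_abs (∑ j, c j * t j)]; ring
    rw [hx]
    calc ((∑ j, c j * t j) ^ 2) ^ 2 ≤ ((∑ j, c j ^ 2) * (1 / k)) ^ 2 := pow_le_pow_left₀ (sq_nonneg _) h1 2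
      _ = (∑ j, c j ^ 2) ^ 2 * (1 / k) ^ 2 := by ring
      _ ≤ (Q4 M * (1 / k * (1 / k))) * (1 / k) ^ 2 := mul_le_mul_of_nonneg_right h2 (by positivity)
      _ ≤ ((ρ * k) ^ 4 * (1 / k * (1 / k))) * (1 / k) ^ 2 := by gcongr
      _ = ρ ^ 4 := by field_simp
  exact le_of_pow_le_pow_left₀ (by norm_num) hρ h3

lemma int2_le {f G : ℝ → ℝ → ℝ} {S T : Set ℝ} (hS' : S ⊆ I01) (hT' : T ⊆ I01)
    (hf : Measurable (Function.uncurry f)) (hG : Measurable (Function.uncurry G)) (Cf CG : ℝ)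
    (hCf : ∀ x y, |f x y| ≤ Cf) (hCG : ∀ x y, |G x y| ≤ CG)
    (hle : ∀ x ∈ I01, ∀ y ∈ I01, x ≠ 0 → y ≠ 0 → |f x y| ≤ G x y) :
    |∫ x in S, ∫ y in T, f x y| ≤ ∫ x, ∫ y, G x y ∂mu01 ∂mu01 := by
  have := fin_sub hS'
  have := fin_sub hT'
  have hfi : ∀ μ : Measure (ℝ × ℝ), IsFiniteMeasure μ → Integrable (Function.uncurry f) μ := fun μ _ =>
    integrable_bdd hf Cf fun p => hCf p.1 p.2
  have hGi : ∀ μ : Measure (ℝ × ℝ), IsFiniteMeasure μ → Integrable (Function.uncurry G) μ := fun μ _ =>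
    integrable_bdd hG CG fun p => hCG p.1 p.2
  rw [integral_integral (hfi _ inferInstance), integral_integral (hGi _ inferInstance)]
  refine (abs_integral_le_integral_abs).trans ?_
  have hle' : (volume.restrict S).prod (volume.restrict T) ≤ mu01.prod mu01 := by
    unfold mu01
    rw [Measure.prod_restrict, Measure.prod_restrict]
    exact Measure.restrict_mono (Set.prod_mono hS' hT') le_rfl
  have hae : ∀ᵐ p ∂(mu01.prod mu01), |f p.1 p.2| ≤ G p.1 p.2 := by
    have h1 : ∀ᵐ x ∂mu01, x ∈ I01 ∧ x ≠ 0 := by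
      have a : ∀ᵐ x ∂mu01, x ∈ I01 := ae_restrict_mem measurableSet_Icc
      have b : ∀ᵐ x ∂mu01, x ≠ 0 := ae_restrict_of_ae (by
        rw [ae_iff]; simp)
      filter_upwards [a, b] with x hx hy using ⟨hx, hy⟩
    have h2 := (Measure.quasiMeasurePreserving_fst (μ := mu01) (ν := mu01)).ae h1
    have h3 := (Measure.quasiMeasurePreserving_snd (μ := mu01) (ν := mu01)).ae h1
    filter_upwards [h2, h3] with p hp hq
    exact hle _ hp.1 _ hq.1 hp.2 hq.2
  calc ∫ p, |f p.1 p.2| ∂((volume.restrict S).prod (volume.restrict T)) ≤ ∫ p, |f p.1 p.2| ∂(mu01.prod mu01) :=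
        integral_mono_measure hle' (Eventually.of_forall fun _ => abs_nonneg _) (hfi _ inferInstance).abs
    _ ≤ _ := integral_mono_ae (hfi _ inferInstance).abs (hGi _ inferInstance) hae


lemma bound_sum {k : ℕ} (M : Fin k → Fin k → ℝ) (s t : Fin k → ℝ) (hs0 : ∀ i, 0 ≤ s i)
    (hs : ∀ i, s i ≤ 1 / k) (ht0 : ∀ i, 0 ≤ t i) (ht : ∀ i, t i ≤ 1 / k) :
    |∑ i, ∑ j, M i j * s i * t j| ≤ 1 / (k:ℝ) ^ 2 * ∑ i, ∑ j, |M i j| := by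
  rw [Finset.mul_sum]
  refine (Finset.abs_sum_le_sum_abs _ _).trans (Finset.sum_le_sum fun i _ => ?_)
  rw [Finset.mul_sum]
  refine (Finset.abs_sum_le_sum_abs _ _).trans (Finset.sum_le_sum fun j _ => ?_)
  rw [abs_mul, abs_mul, abs_of_nonneg (hs0 i), abs_of_nonneg (ht0 j)]
  have h := mul_le_mul (hs i) (ht j) (ht0 j) (by positivity)
  have e : 1 / (k:ℝ) ^ 2 = 1 / k * (1 / k) := by ring
  rw [e, mul_comm (1 / (k:ℝ) * (1 / k)), mul_assoc]
  exact mul_le_mul_of_nonneg_left h (abs_nonneg _)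

lemma det0 {k : ℕ} (hk : 0 < k) {W : ℝ → ℝ → ℝ} (hW : IsGraphon W) (g : ℝ → ℝ → ℝ)
    (hg : Measurable (Function.uncurry g)) (Mg : ℝ) (hMg : ∀ x y, |g x y| ≤ Mg) (η C : ℝ)
    (hC : 0 ≤ C) (hmod : ∀ a b c d, |g a b - g c d| ≤ η + C * ((a - c) ^ 2 + (b - d) ^ 2))
    (x : Fin k → ℝ) (F H : SimpleGraph (Fin k)) (ρ : ℝ) (hρ : 0 ≤ ρ)
    (hQ : Q4 (cA (fun i j => W (x i) (x j)) F) ≤ (ρ * k) ^ 4) :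
    cutNorm (fun y z => graphonOf H y z - W y z) ≤
      1 / (k:ℝ) ^ 2 * (∑ i, ∑ j, |adjI H i j - adjI F i j|) + ρ + 1 / k +
      1 / (k:ℝ) ^ 2 * (∑ i, ∑ j, |W (x i) (x j) - g (x i) (x j)|) + η +
      4 * C * (1 / k * (∑ i, (x i - (i : ℕ) / k) ^ 2) + 1 / (k:ℝ) ^ 2) +
      ∫ y, ∫ z, |g y z - W y z| ∂mu01 ∂mu01 := by
  have hkR : (0:ℝ) < k := by exact_mod_cast hk
  set w : Fin k → Fin k → ℝ := fun i j => W (x i) (x j) with hw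
  have hw1 : ∀ i j, |w i j| ≤ 1 := fun i j => by
    have := graphon_bd hW (x i) (x j)
    rw [abs_of_nonneg this.1]; exact this.2
  refine csSup_le ⟨|∫ y in (∅ : Set ℝ), ∫ z in (∅ : Set ℝ), (graphonOf H y z - W y z)|, ∅, ∅, MeasurableSet.empty, MeasurableSet.empty, Set.empty_subset _,
    Set.empty_subset _, rfl⟩ ?_
  rintro r ⟨S, T, hS, hT, hS', hT', rfl⟩
  have := fin_sub hS'
  have := fin_sub hT'
  set N : Fin k → Fin k → ℝ := fun i j => adjI H i j - w i j with hN
  have hsplit : ∀ y z, graphonOf H y z - W y z = stepF N y z + (stepF w y z - W y z) := by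
    intro y z
    have : stepF N y z = stepF (adjI H) y z - stepF w y z := by
      unfold stepF
      rw [← Finset.sum_sub_distrib]
      refine Finset.sum_congr rfl fun i _ => ?_
      rw [← Finset.sum_sub_distrib]
      exact Finset.sum_congr rfl fun j _ => by simp only [hN]; ring
    rw [graphonOf_step, this]; ring
  have hD2m : Measurable (Function.uncurry fun y z => stepF w y z - W y z) := (stepF_meas w).sub hW.1
  have hD2b : ∀ y z, |stepF w y z - W y z| ≤ (∑ i, ∑ j, |w i j|) + 1 := by
    intro y z
    have h1 := stepF_bdd w y z
    have h2 := graphon_bd hW y z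
    have h3 : |W y z| ≤ 1 := by rw [abs_of_nonneg h2.1]; exact h2.2
    exact (abs_sub _ _).trans (add_le_add h1 h3)
  have e1 : ∫ y in S, ∫ z in T, (graphonOf H y z - W y z) =
      (∫ y in S, ∫ z in T, stepF N y z) + ∫ y in S, ∫ z in T, (stepF w y z - W y z) := by
    simp only [hsplit]
    exact integral_integral_add (f := Function.uncurry (stepF N))
      (g := Function.uncurry fun y z => stepF w y z - W y z)
      (integrable_bdd (stepF_meas N) _ fun p => stepF_bdd N p.1 p.2)
      (integrable_bdd hD2m _ fun p => hD2b p.1 p.2)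
  have hsle : ∀ {S : Set ℝ}, S ⊆ I01 → ∀ i : Fin k, (volume.restrict S).real (blkS k i) ≤ 1 / k := by
    intro S hS' i
    rw [← blkS_vol k i]
    refine ENNReal.toReal_mono ?_ (Measure.restrict_apply_le _ _)
    rw [blkS, Real.volume_Ioc]; exact ENNReal.ofReal_ne_top
  set s : Fin k → ℝ := fun i => (volume.restrict S).real (blkS k i) with hs
  set t : Fin k → ℝ := fun i => (volume.restrict T).real (blkS k i) with ht
  have hs0 : ∀ i, 0 ≤ s i := fun i => measureReal_nonneg
  have ht0 : ∀ i, 0 ≤ t i := fun i => measureReal_nonneg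
  have hs1 : ∀ i, s i ≤ 1 / k := hsle hS'
  have ht1 : ∀ i, t i ≤ 1 / k := hsle hT'
  have hstep : |∫ y in S, ∫ z in T, stepF N y z| ≤
      1 / (k:ℝ) ^ 2 * (∑ i, ∑ j, |adjI H i j - adjI F i j|) + ρ + 1 / k := by
    rw [integral_stepF]
    let M3 : Fin k → Fin k → ℝ := fun i j => if i = j then - w i j else 0
    have e2 : ∑ i, ∑ j, N i j * s i * t j = (∑ i, ∑ j, (adjI H i j - adjI F i j) * s i * t j) +
        (∑ i, ∑ j, cA w F i j * s i * t j) + ∑ i, ∑ j, M3 i j * s i * t j := by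
      rw [← Finset.sum_add_distrib, ← Finset.sum_add_distrib]
      refine Finset.sum_congr rfl fun i _ => ?_
      rw [← Finset.sum_add_distrib, ← Finset.sum_add_distrib]
      refine Finset.sum_congr rfl fun j _ => ?_
      simp only [hN, cA, M3]
      by_cases hij : i = j
      · subst hij
        have : adjI F i i = 0 := by simp [adjI]
        rw [if_pos rfl, if_pos rfl, this]; ring
      · rw [if_neg hij, if_neg hij]; ring
    have b1 := bound_sum (fun i j => adjI H i j - adjI F i j) s t hs0 hs1 ht0 ht1
    have b2 := Q4_bound hk (cA w F) s t hs0 hs1 ht0 ht1 ρ hρ hQ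
    have b3 := bound_sum M3 s t hs0 hs1 ht0 ht1
    have b4 : 1 / (k:ℝ) ^ 2 * ∑ i, ∑ j, |M3 i j| ≤ 1 / k := by
      have : ∑ i, ∑ j, |M3 i j| ≤ k := by
        calc ∑ i, ∑ j, |M3 i j| ≤ ∑ _i : Fin k, (1:ℝ) := by
              refine Finset.sum_le_sum fun i _ => ?_
              rw [Finset.sum_eq_single i]
              · simp only [M3, if_true, abs_neg]; exact hw1 i i
              · intro j _ hj; simp [M3, Ne.symm hj]
              · simp
          _ = k := by simp
      calc 1 / (k:ℝ) ^ 2 * ∑ i, ∑ j, |M3 i j| ≤ 1 / (k:ℝ) ^ 2 * k := by gcongr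
        _ = 1 / (k:ℝ) := by field_simp
    change |∑ i, ∑ j, N i j * s i * t j| ≤ _
    rw [e2]
    refine (abs_add_le _ _).trans ?_
    have := abs_add_le (∑ i, ∑ j, (adjI H i j - adjI F i j) * s i * t j) (∑ i, ∑ j, cA w F i j * s i * t j)
    linarith
  -- the approximation part
  have happ : |∫ y in S, ∫ z in T, (stepF w y z - W y z)| ≤
      1 / (k:ℝ) ^ 2 * (∑ i, ∑ j, |W (x i) (x j) - g (x i) (x j)|) + η +
      4 * C * (1 / k * (∑ i, (x i - (i : ℕ) / k) ^ 2) + 1 / (k:ℝ) ^ 2) +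
      ∫ y, ∫ z, |g y z - W y z| ∂mu01 ∂mu01 := by
    let b : Fin k → ℝ := fun i => (x i - (i : ℕ) / k) ^ 2
    let K : Fin k → Fin k → ℝ := fun i j => |W (x i) (x j) - g (x i) (x j)| +
      (η + 2 * C * (b i + b j + 2 * (1 / (k:ℝ) ^ 2)))
    have hGm : Measurable (Function.uncurry fun y z => stepF K y z + |g y z - W y z|) :=
      (stepF_meas K).add (hg.sub hW.1).abs
    have hgW : ∀ y z, |g y z - W y z| ≤ Mg + 1 := by
      intro y z
      have h2 := graphon_bd hW y z
      have h3 : |W y z| ≤ 1 := by rw [abs_of_nonneg h2.1]; exact h2.2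
      exact (abs_sub _ _).trans (add_le_add (hMg y z) h3)
    have hmain := int2_le hS' hT' hD2m hGm _ ((∑ i, ∑ j, |K i j|) + (Mg + 1)) hD2b (by
      intro y z
      refine (abs_add_le _ _).trans (add_le_add (stepF_bdd K y z) ?_)
      rw [abs_abs]; exact hgW y z) (by
      intro y hy z hz hy0 hz0
      obtain ⟨i, hi⟩ := exists_blk hk hy hy0
      obtain ⟨j, hj⟩ := exists_blk hk hz hz0
      rw [stepF_in w hi hj, stepF_in K hi hj]
      have h1 := hmod (x i) (x j) y z
      have hsq : ∀ (i : Fin k) (y : ℝ), y ∈ blkS k i → (x i - y) ^ 2 ≤ 2 * b i + 2 * (1 / (k:ℝ) ^ 2) := by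
        intro i y hi
        have h2 : 0 ≤ y - (i:ℕ) / k := by linarith [hi.1]
        have h3 : y - (i:ℕ) / k ≤ 1 / k := by
          have := hi.2
          have e : (((i:ℕ):ℝ) + 1) / k = (i:ℕ) / k + 1 / k := by ring
          linarith
        have h4 : (y - (i:ℕ) / k) ^ 2 ≤ (1 / k) ^ 2 := pow_le_pow_left₀ h2 h3 2
        have e : (1 / (k:ℝ)) ^ 2 = 1 / (k:ℝ) ^ 2 := by ring
        rw [e] at h4
        simp only [b]
        nlinarith [sq_nonneg ((x i - (i:ℕ) / k) + (y - (i:ℕ) / k))]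
      have hA := hsq i y hi
      have hB := hsq j z hj
      have h5 : C * ((x i - y) ^ 2 + (x j - z) ^ 2) ≤ 2 * C * (b i + b j + 2 * (1 / (k:ℝ) ^ 2)) := by
        calc _ ≤ C * ((2 * b i + 2 * (1 / (k:ℝ) ^ 2)) + (2 * b j + 2 * (1 / (k:ℝ) ^ 2))) :=
              mul_le_mul_of_nonneg_left (add_le_add hA hB) hC
          _ = _ := by ring
      have e : w i j - W y z = (W (x i) (x j) - g (x i) (x j)) + (g (x i) (x j) - g y z) + (g y z - W y z) := by
        simp only [hw]; ring
      rw [e]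
      refine (abs_add_le _ _).trans (add_le_add_left ((abs_add_le _ _).trans ?_) _)
      simp only [K]
      linarith)
    refine hmain.trans (le_of_eq ?_)
    have e3 : ∫ y, ∫ z, (stepF K y z + |g y z - W y z|) ∂mu01 ∂mu01 =
        (∫ y, ∫ z, stepF K y z ∂mu01 ∂mu01) + ∫ y, ∫ z, |g y z - W y z| ∂mu01 ∂mu01 :=
      integral_integral_add (f := Function.uncurry (stepF K))
        (g := Function.uncurry fun y z => |g y z - W y z|)
        (integrable_bdd (stepF_meas K) _ fun p => stepF_bdd K p.1 p.2)
        (integrable_bdd (hg.sub hW.1).abs (Mg + 1) fun p => by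
          change |(|g p.1 p.2 - W p.1 p.2|)| ≤ Mg + 1
          rw [abs_abs]; exact hgW p.1 p.2)
    rw [e3, integral_stepF]
    congr 1
    have hmu : ∀ i, mu01.real (blkS k i) = 1 / k := by
      intro i
      rw [← blkS_vol k i, mu01, measureReal_restrict_apply (blkS_meas k i), Set.inter_eq_left.2 (blkS_sub k i)]
    simp only [hmu, K, add_mul, Finset.sum_add_distrib, mul_add]
    simp only [Finset.sum_const, Finset.card_univ, Fintype.card_fin, nsmul_eq_mul, ← Finset.mul_sum, ← Finset.sum_mul]
    simp only [b]
    field_simp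
    ring
  calc _ = |(∫ y in S, ∫ z in T, stepF N y z) + ∫ y in S, ∫ z in T, (stepF w y z - W y z)| := by rw [e1]
    _ ≤ _ := (abs_add_le _ _).trans (add_le_add hstep happ)
    _ = _ := by ring


lemma sum2_perm {k : ℕ} (σ : Equiv.Perm (Fin k)) (f : Fin k → Fin k → ℝ) :
    ∑ i, ∑ j, f (σ i) (σ j) = ∑ i, ∑ j, f i j := by
  rw [← Equiv.sum_comp σ (fun i => ∑ j, f i j)]
  exact Finset.sum_congr rfl fun i _ => Equiv.sum_comp σ (fun j => f (σ i) j)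

lemma adjI_perm {k : ℕ} (σ : Equiv.Perm (Fin k)) (H : SimpleGraph (Fin k)) (i j : Fin k) :
    adjI (H.comap σ) i j = adjI H (σ i) (σ j) := by
  by_cases h : H.Adj (σ i) (σ j) <;> simp [adjI, h]

lemma det1 {k : ℕ} (hk : 0 < k) {W : ℝ → ℝ → ℝ} (hW : IsGraphon W) (g : ℝ → ℝ → ℝ)
    (hg : Measurable (Function.uncurry g)) (Mg : ℝ) (hMg : ∀ x y, |g x y| ≤ Mg) (η C : ℝ)
    (hC : 0 ≤ C) (hmod : ∀ a b c d, |g a b - g c d| ≤ η + C * ((a - c) ^ 2 + (b - d) ^ 2))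
    (x : Fin k → ℝ) (σ : Equiv.Perm (Fin k)) (F H : SimpleGraph (Fin k)) (ρ : ℝ) (hρ : 0 ≤ ρ)
    (hQ : Q4 (cA (fun i j => W (x i) (x j)) F) ≤ (ρ * k) ^ 4) :
    cutNorm (fun y z => graphonOf (H.comap σ) y z - W y z) ≤
      1 / (k:ℝ) ^ 2 * (∑ i, ∑ j, |adjI H i j - adjI F i j|) + ρ + 1 / k +
      1 / (k:ℝ) ^ 2 * (∑ i, ∑ j, |W (x i) (x j) - g (x i) (x j)|) + η +
      4 * C * (1 / k * (∑ i, (x (σ i) - (i : ℕ) / k) ^ 2) + 1 / (k:ℝ) ^ 2) +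
      ∫ y, ∫ z, |g y z - W y z| ∂mu01 ∂mu01 := by
  have h := det0 hk hW g hg Mg hMg η C hC hmod (fun i => x (σ i)) (F.comap σ) (H.comap σ) ρ hρ (by
    have e : ∀ i j, cA (fun i j => W (x (σ i)) (x (σ j))) (F.comap σ) i j =
        cA (fun i j => W (x i) (x j)) F (σ i) (σ j) := by
      intro i j
      unfold cA
      rw [adjI_perm]
      simp
    have e2 : Q4 (cA (fun i j => W (x (σ i)) (x (σ j))) (F.comap σ)) =
        Q4 (cA (fun i j => W (x i) (x j)) F) := by
      unfold Q4
      simp only [e]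
      rw [← sum2_perm σ (fun i i' => (∑ j, cA (fun i j => W (x i) (x j)) F i j *
        cA (fun i j => W (x i) (x j)) F i' j) ^ 2)]
      refine Finset.sum_congr rfl fun i _ => Finset.sum_congr rfl fun i' _ => ?_
      rw [Equiv.sum_comp σ (fun j => cA (fun i j => W (x i) (x j)) F (σ i) j *
        cA (fun i j => W (x i) (x j)) F (σ i') j)]
    rw [e2]; exact hQ)
  simp only [adjI_perm] at h
  rw [sum2_perm σ (fun i j => |adjI H i j - adjI F i j|),
    sum2_perm σ (fun i j => |W (x i) (x j) - g (x i) (x j)|)] at h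
  exact h

lemma edit_sum {k : ℕ} (F H : SimpleGraph (Fin k)) :
    1 / (k:ℝ) ^ 2 * (∑ i, ∑ j, |adjI H i j - adjI F i j|) ≤ 2 * graphD1 F H := by
  classical
  let s : Finset (Fin k × Fin k) := Finset.univ.filter fun p => ¬ (F.Adj p.1 p.2 ↔ H.Adj p.1 p.2)
  have e : ∑ i, ∑ j, |adjI H i j - adjI F i j| = (s.card : ℝ) := by
    rw [← Fintype.sum_prod_type' (f := fun i j => |adjI H i j - adjI F i j|), Finset.card_filter]
    push_cast
    refine Finset.sum_congr rfl fun p _ => ?_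
    by_cases h1 : F.Adj p.1 p.2 <;> by_cases h2 : H.Adj p.1 p.2 <;> simp [adjI, h1, h2]
  let f : Fin k × Fin k → Sym2 (Fin k) := fun p => s(p.1, p.2)
  have h1 : s.card ≤ 2 * (s.image f).card := by
    apply Finset.card_le_mul_card_image
    intro a _
    induction a using Sym2.ind with
    | _ a b =>
      refine (Finset.card_le_card (t := {(a, b), (b, a)}) ?_).trans Finset.card_le_two
      intro p hp
      have := (Finset.mem_filter.1 hp).2
      rcases Sym2.eq_iff.1 this with h | h
      · simp [Prod.ext_iff, h.1, h.2]
      · simp [Prod.ext_iff, h.1, h.2]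
  have h2 : (s.image f).card ≤ (symmDiff F.edgeSet H.edgeSet).ncard := by
    rw [← Set.ncard_coe_finset]
    apply Set.ncard_le_ncard _ (Set.toFinite _)
    intro a ha
    obtain ⟨p, hp, rfl⟩ := Finset.mem_image.1 (Finset.mem_coe.1 ha)
    have := (Finset.mem_filter.1 hp).2
    simp only [f, Set.mem_symmDiff, SimpleGraph.mem_edgeSet]
    tauto
  have h3 : (s.card : ℝ) ≤ 2 * (symmDiff F.edgeSet H.edgeSet).ncard := by
    exact_mod_cast h1.trans (by omega)
  rw [e, graphD1, one_div, inv_mul_eq_div, mul_div_assoc']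
  gcongr

/-- Count of indices with smaller value. -/
def loC {k : ℕ} (x : Fin k → ℝ) (c : ℝ) : ℝ := ∑ j, if x j < c then (1:ℝ) else 0
/-- Count of indices with value at most `c`. -/
def hiC {k : ℕ} (x : Fin k → ℝ) (c : ℝ) : ℝ := ∑ j, if x j ≤ c then (1:ℝ) else 0

lemma sort_bound {k : ℕ} (hk : 0 < k) (x : Fin k → ℝ) :
    ∑ i, (x (Tuple.sort x i) - ((i : Fin k) : ℕ) / k) ^ 2 ≤
      ∑ i, ((x i - loC x (x i) / k) ^ 2 + (x i - hiC x (x i) / k) ^ 2) := by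
  have hkR : (0:ℝ) < k := by exact_mod_cast hk
  set σ := Tuple.sort x with hσ
  have hmono : Monotone (x ∘ σ) := Tuple.monotone_sort x
  rw [← Equiv.sum_comp σ (fun i => (x i - loC x (x i) / k) ^ 2 + (x i - hiC x (x i) / k) ^ 2)]
  refine Finset.sum_le_sum fun i _ => ?_
  have hlo : loC x (x (σ i)) ≤ (i:ℕ) := by
    unfold loC
    rw [← Equiv.sum_comp σ, Finset.sum_boole]
    have : (Finset.univ.filter fun j => x (σ j) < x (σ i)) ⊆ Finset.Iio i := by
      intro j hj
      have hj' := (Finset.mem_filter.1 hj).2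
      rw [Finset.mem_Iio]
      by_contra hcon
      exact absurd (hmono (not_lt.1 hcon)) (not_le.2 hj')
    have h2 := Finset.card_le_card this
    rw [Fin.card_Iio] at h2
    exact_mod_cast h2
  have hhi : ((i:ℕ) : ℝ) ≤ hiC x (x (σ i)) := by
    unfold hiC
    rw [← Equiv.sum_comp σ, Finset.sum_boole]
    have : Finset.Iio i ⊆ (Finset.univ.filter fun j => x (σ j) ≤ x (σ i)) := by
      intro j hj
      exact Finset.mem_filter.2 ⟨Finset.mem_univ _, hmono (Finset.mem_Iio.1 hj).le⟩
    have h2 := Finset.card_le_card this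
    rw [Fin.card_Iio] at h2
    exact_mod_cast h2
  have a1 : loC x (x (σ i)) / k ≤ (i:ℕ) / k := by gcongr
  have a2 : ((i:ℕ) : ℝ) / k ≤ hiC x (x (σ i)) / k := by gcongr
  rcases le_total (x (σ i)) ((i:ℕ) / k) with h | h
  · nlinarith [sq_nonneg (x (σ i) - loC x (x (σ i)) / k)]
  · nlinarith [sq_nonneg (x (σ i) - hiC x (x (σ i)) / k)]

/-- Clamp to the unit interval. -/
def clp (c : ℝ) : ℝ := max 0 (min 1 c)

lemma clp_mem (c : ℝ) : clp c ∈ I01 := ⟨le_max_left _ _, max_le zero_le_one (min_le_left _ _)⟩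
lemma clp_of_mem {c : ℝ} (h : c ∈ I01) : clp c = c := by
  unfold clp; rw [min_eq_right h.2, max_eq_right h.1]
lemma clp_meas : Measurable clp := measurable_const.max (measurable_const.min measurable_id)

lemma var_bound {k : ℕ} (h : ℝ → ℝ → ℝ) (hm : Measurable (Function.uncurry h))
    (hb : ∀ s c, 0 ≤ h s c ∧ h s c ≤ 1) (hIntg : ∀ c ∈ I01, ∫ s, h s c ∂mu01 = c) (i : Fin k) :
    ∫ x, (∑ j, (clp (x i) - h (x j) (clp (x i)))) ^ 2 ∂piI k ≤ k := by
  let e : Fin k → (Fin k → ℝ) → ℝ := fun j x => clp (x i) - h (x j) (clp (x i))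
  have em : ∀ j, Measurable (e j) := fun j => by
    have h1 : Measurable fun x : Fin k → ℝ => clp (x i) := clp_meas.comp (measurable_pi_apply i)
    exact h1.sub (hm.comp ((measurable_pi_apply j).prodMk h1))
  have eb : ∀ j x, |e j x| ≤ 1 := fun j x => by
    have h1 := clp_mem (x i)
    have h2 := hb (x j) (clp (x i))
    rw [abs_le]; constructor <;> simp only [e] <;> linarith [h1.1, h1.2]
  have eeb : ∀ j j' x, |e j x * e j' x| ≤ 1 := fun j j' x => by
    rw [abs_mul]; exact mul_le_one₀ (eb j x) (abs_nonneg _) (eb j' x)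
  have eei : ∀ j j', Integrable (fun x => e j x * e j' x) (piI k) := fun j j' =>
    integrable_bdd ((em j).mul (em j')) 1 (eeb j j')
  have key : ∀ j j', j ≠ j' → j ≠ i → ∫ x, e j x * e j' x ∂piI k = 0 := by
    intro j j' hjj hji
    rw [integral_update j _ (eei j j')]
    have : ∀ x : Fin k → ℝ, ∫ s, e j (Function.update x j s) * e j' (Function.update x j s) ∂mu01 = 0 := by
      intro x
      have h1 : ∀ s, e j (Function.update x j s) * e j' (Function.update x j s) =
          (clp (x i) - h s (clp (x i))) * e j' x := by
        intro s
        simp only [e, Function.update_self, Function.update_of_ne hji.symm, Function.update_of_ne hjj.symm]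
      simp only [h1]
      rw [integral_mul_const, integral_sub (integrable_const _), hIntg _ (clp_mem _)]
      · simp
      · exact integrable_bdd (hm.comp (measurable_id.prodMk measurable_const)) 1 fun s => by
          rw [abs_of_nonneg (hb _ _).1]; exact (hb _ _).2
    simp [this]
  have off : ∀ j j', j ≠ j' → ∫ x, e j x * e j' x ∂piI k = 0 := by
    intro j j' hjj
    by_cases hji : j = i
    · have := key j' j hjj.symm (fun h => hjj (hji.trans h.symm))
      simpa only [mul_comm] using this
    · exact key j j' hjj hji
  have expand : ∀ x, (∑ j, (clp (x i) - h (x j) (clp (x i)))) ^ 2 = ∑ j, ∑ j', e j x * e j' x := by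
    intro x; rw [sq, Finset.sum_mul_sum]
  simp only [expand]
  rw [integral_finsetSum _ fun j _ => integrable_finsetSum _ fun j' _ => eei j j']
  calc _ ≤ ∑ _j : Fin k, (1:ℝ) := by
        refine Finset.sum_le_sum fun j _ => ?_
        rw [integral_finsetSum _ fun j' _ => eei j j', Finset.sum_eq_single j]
        · calc _ ≤ ∫ _x, (1:ℝ) ∂piI k := integral_mono (eei j j) (integrable_const _) fun x =>
                (le_abs_self _).trans (eeb j j x)
            _ = 1 := by simp
        · intro j' _ hj; exact off j j' hj.symm
        · simp
    _ = k := by simp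

lemma integral_pair_pi {k : ℕ} (i j : Fin k) (hij : i ≠ j) (f : ℝ → ℝ → ℝ)
    (hf : Measurable (Function.uncurry f)) (C : ℝ) (hC : ∀ x y, |f x y| ≤ C) :
    ∫ x, f (x i) (x j) ∂piI k = ∫ y, ∫ z, f y z ∂mu01 ∂mu01 := by
  rw [integral_update j (fun x => f (x i) (x j)) (integrable_bdd (measurable_pair hf i j) C fun x => hC _ _)]
  simp only [Function.update_self, Function.update_of_ne hij]
  have hψ : Measurable fun y => ∫ z, f y z ∂mu01 := meas_int_right hf mu01
  have hψb : ∀ y, |∫ z, f y z ∂mu01| ≤ C := fun y => by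
    have := norm_integral_le_of_norm_le_const (μ := mu01) (f := fun z => f y z) (C := C)
      (Eventually.of_forall fun z => hC y z)
    simpa using this
  rw [integral_update i (fun x => ∫ z, f (x i) z ∂mu01)
    (integrable_bdd (hψ.comp (measurable_pi_apply i)) C fun x => hψb _)]
  simp


lemma approx {W : ℝ → ℝ → ℝ} (hW : IsGraphon W) (κ η : ℝ) (hκ : 0 < κ) (hη : 0 < η) :
    ∃ (g : ℝ → ℝ → ℝ) (Mg C : ℝ), Measurable (Function.uncurry g) ∧ (∀ x y, |g x y| ≤ Mg) ∧ 0 ≤ C ∧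
      (∀ a b c d, |g a b - g c d| ≤ η + C * ((a - c) ^ 2 + (b - d) ^ 2)) ∧
      ∫ y, ∫ z, |g y z - W y z| ∂mu01 ∂mu01 ≤ κ := by
  have hWi : Integrable (Function.uncurry W) (mu01.prod mu01) := integrable_bdd hW.1 1 fun p => by
    have := graphon_bd hW p.1 p.2
    simp only [Function.uncurry]
    rw [abs_of_nonneg this.1]; exact this.2
  obtain ⟨g, hgs, hgκ, hgc, hgi⟩ := hWi.exists_hasCompactSupport_integral_sub_le hκ
  obtain ⟨Mg, hMg⟩ := hgs.exists_bound_of_continuous hgc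
  have huc := hgc.uniformContinuous_of_tendsto_cocompact hgs.is_zero_at_infty
  rw [Metric.uniformContinuous_iff] at huc
  obtain ⟨δ, hδ, hg⟩ := huc η hη
  have hM0 : 0 ≤ Mg := (norm_nonneg _).trans (hMg (0, 0))
  refine ⟨fun a b => g (a, b), Mg, 2 * Mg / δ ^ 2, hgc.measurable, fun x y => hMg (x, y), by positivity, ?_, ?_⟩
  · intro a b c d
    by_cases h : dist (a, b) (c, d) < δ
    · have := hg h
      rw [Real.dist_eq] at this
      have : 0 ≤ 2 * Mg / δ ^ 2 * ((a - c) ^ 2 + (b - d) ^ 2) := by positivity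
      linarith
    · have h1 : |g (a, b) - g (c, d)| ≤ 2 * Mg := by
        have h2 := hMg (a, b)
        have h3 := hMg (c, d)
        rw [Real.norm_eq_abs] at h2 h3
        exact (abs_sub _ _).trans (by linarith)
      have h2 : δ ^ 2 ≤ (a - c) ^ 2 + (b - d) ^ 2 := by
        rw [not_lt, Prod.dist_eq, le_max_iff, Real.dist_eq, Real.dist_eq] at h
        rcases h with h | h
        · have := pow_le_pow_left₀ hδ.le h 2
          rw [sq_abs] at this
          simp only at this
          nlinarith [sq_nonneg (b - d)]
        · have := pow_le_pow_left₀ hδ.le h 2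
          rw [sq_abs] at this
          simp only at this
          nlinarith [sq_nonneg (a - c)]
      have h3 : 2 * Mg ≤ 2 * Mg / δ ^ 2 * ((a - c) ^ 2 + (b - d) ^ 2) := by
        rw [div_mul_eq_mul_div, le_div_iff₀ (by positivity)]
        nlinarith
      linarith
  · have e : ∫ y, ∫ z, |g (y, z) - W y z| ∂mu01 ∂mu01 = ∫ p, ‖Function.uncurry W p - g p‖ ∂(mu01.prod mu01) := by
      have hi : Integrable (fun p => ‖Function.uncurry W p - g p‖) (mu01.prod mu01) := (hWi.sub hgi).norm
      rw [integral_prod _ hi]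
      refine integral_congr_ae (Eventually.of_forall fun y => integral_congr_ae (Eventually.of_forall fun z => ?_))
      simp only [Function.uncurry, Real.norm_eq_abs]
      exact abs_sub_comm _ _
    rw [e]; exact hgκ

lemma int_lt (c : ℝ) (hc : c ∈ I01) : ∫ s, (if s < c then (1:ℝ) else 0) ∂mu01 = c := by
  have : (fun s : ℝ => if s < c then (1:ℝ) else 0) = (Set.Iio c).indicator fun _ => 1 := by
    funext s; simp [Set.indicator]
  rw [this, integral_indicator measurableSet_Iio]
  have e : Set.Iio c ∩ I01 = Set.Ico 0 c := by
    ext s; simp only [I01, Set.mem_inter_iff, Set.mem_Iio, Set.mem_Icc, Set.mem_Ico]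
    have := hc.2
    constructor
    · rintro ⟨h1, h2, h3⟩; exact ⟨h2, h1⟩
    · rintro ⟨h1, h2⟩; exact ⟨h2, h1, by linarith⟩
  simp only [integral_const, smul_eq_mul, mul_one, measureReal_restrict_apply_univ]
  rw [mu01, measureReal_restrict_apply measurableSet_Iio, e, Measure.real, Real.volume_Ico, sub_zero,
    ENNReal.toReal_ofReal hc.1]

lemma int_le (c : ℝ) (hc : c ∈ I01) : ∫ s, (if s ≤ c then (1:ℝ) else 0) ∂mu01 = c := by
  have : (fun s : ℝ => if s ≤ c then (1:ℝ) else 0) = (Set.Iic c).indicator fun _ => 1 := by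
    funext s; simp [Set.indicator]
  rw [this, integral_indicator measurableSet_Iic]
  have e : Set.Iic c ∩ I01 = Set.Icc 0 c := by
    ext s; simp only [I01, Set.mem_inter_iff, Set.mem_Iic, Set.mem_Icc]
    have := hc.2
    constructor
    · rintro ⟨h1, h2, h3⟩; exact ⟨h2, h1⟩
    · rintro ⟨h1, h2⟩; exact ⟨h2, h1, by linarith⟩
  simp only [integral_const, smul_eq_mul, mul_one, measureReal_restrict_apply_univ]
  rw [mu01, measureReal_restrict_apply measurableSet_Iic, e, Measure.real, Real.volume_Icc, sub_zero,
    ENNReal.toReal_ofReal hc.1]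

lemma pick {k : ℕ} {W : ℝ → ℝ → ℝ} (hW : IsGraphon W) (x : Fin k → ℝ) (q : SimpleGraph (Fin k) → ℝ) :
    ∃ F, q F ≤ ∑ F, pw F (fun i j => W (x i) (x j)) * q F := by
  by_contra hcon
  push Not at hcon
  set w := fun i j => W (x i) (x j) with hw
  set m := ∑ F, pw F w * q F with hm
  have h0 : ∀ F : SimpleGraph (Fin k), 0 ≤ pw F w := fun F => pw_nonneg _ _ fun i j => graphon_bd hW _ _
  have h1 : ∑ F : SimpleGraph (Fin k), pw F w * m = m := by rw [← Finset.sum_mul, sum_pw, one_mul]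
  have h2 : ∑ F : SimpleGraph (Fin k), pw F w * m < ∑ F, pw F w * q F := by
    apply Finset.sum_lt_sum
    · intro F _; exact mul_le_mul_of_nonneg_left (hcon F).le (h0 F)
    · by_contra hc
      push Not at hc
      have : ∀ F : SimpleGraph (Fin k), pw F w = 0 := by
        intro F
        by_contra hF
        have hpos : 0 < pw F w := lt_of_le_of_ne (h0 F) (Ne.symm hF)
        have := hc F (Finset.mem_univ F)
        have := mul_lt_mul_of_pos_left (hcon F) hpos
        linarith
      have hs := sum_pw w
      simp [this] at hs
  linarith


/-- Averaged empirical deviation squared. -/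
def devB {k : ℕ} (h : ℝ → ℝ → ℝ) (i : Fin k) (x : Fin k → ℝ) : ℝ :=
  (∑ j, (clp (x i) - h (x j) (clp (x i)))) ^ 2

lemma devB_meas {k : ℕ} (h : ℝ → ℝ → ℝ) (hm : Measurable (Function.uncurry h)) (i : Fin k) :
    Measurable (devB h i) := by
  have h1 : Measurable fun x : Fin k → ℝ => clp (x i) := clp_meas.comp (measurable_pi_apply i)
  exact (Finset.measurable_sum _ fun j _ => h1.sub (hm.comp ((measurable_pi_apply j).prodMk h1))).pow_const 2

lemma devB_bdd {k : ℕ} (h : ℝ → ℝ → ℝ) (hb : ∀ s c, 0 ≤ h s c ∧ h s c ≤ 1) (i : Fin k) (x : Fin k → ℝ) :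
    |devB h i x| ≤ (k:ℝ) ^ 2 := by
  unfold devB
  rw [abs_pow]
  apply pow_le_pow_left₀ (abs_nonneg _)
  refine (Finset.abs_sum_le_sum_abs _ _).trans ?_
  calc _ ≤ ∑ _j : Fin k, (1:ℝ) := Finset.sum_le_sum fun j _ => by
        have h1 := clp_mem (x i)
        have h2 := hb (x j) (clp (x i))
        rw [abs_le]; constructor <;> linarith [h1.1, h1.2]
    _ = k := by simp

/-- indicator of `s < c` -/
def hlt (s c : ℝ) : ℝ := if s < c then 1 else 0
/-- indicator of `s ≤ c` -/
def hle (s c : ℝ) : ℝ := if s ≤ c then 1 else 0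

lemma hlt_meas : Measurable (Function.uncurry hlt) :=
  Measurable.ite (measurableSet_lt measurable_fst measurable_snd) measurable_const measurable_const
lemma hle_meas : Measurable (Function.uncurry hle) :=
  Measurable.ite (measurableSet_le measurable_fst measurable_snd) measurable_const measurable_const
lemma hlt_bd (s c : ℝ) : 0 ≤ hlt s c ∧ hlt s c ≤ 1 := by unfold hlt; split_ifs <;> simp
lemma hle_bd (s c : ℝ) : 0 ≤ hle s c ∧ hle s c ≤ 1 := by unfold hle; split_ifs <;> simp

lemma select_pt {k : ℕ} (hk : 0 < k) {W : ℝ → ℝ → ℝ} (hW : IsGraphon W) (g : ℝ → ℝ → ℝ)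
    (hg : Measurable (Function.uncurry g)) (Mg : ℝ) (hMg : ∀ x y, |g x y| ≤ Mg) (C : ℝ) (hC : 0 ≤ C)
    (d : SimpleGraph (Fin k) → ℝ) (hd : ∀ F, 0 ≤ d F) (κ : ℝ)
    (hκ : ∫ y, ∫ z, |g y z - W y z| ∂mu01 ∂mu01 ≤ κ) (T : ℝ)
    (hT : κ + (Mg + 3 + 2 * C) / k + EG W d ≤ T) :
    ∃ (x : Fin k → ℝ) (F : SimpleGraph (Fin k)),
      Q4 (cA (fun i j => W (x i) (x j)) F) ≤ T * (k:ℝ) ^ 4 ∧ d F ≤ T ∧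
      1 / (k:ℝ) ^ 2 * (∑ i, ∑ j, |W (x i) (x j) - g (x i) (x j)|) ≤ T ∧
      C * (1 / k * ∑ i, ((x i - loC x (x i) / k) ^ 2 + (x i - hiC x (x i) / k) ^ 2)) ≤ T := by
  have hkR : (0:ℝ) < k := by exact_mod_cast hk
  have hM0 : 0 ≤ Mg := (abs_nonneg _).trans (hMg 0 0)
  have hκ0 : 0 ≤ κ := le_trans (integral_nonneg fun y => integral_nonneg fun z => abs_nonneg _) hκ
  let f : ℝ → ℝ → ℝ := fun y z => |g y z - W y z|
  have hfm : Measurable (Function.uncurry f) := (hg.sub hW.1).abs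
  have hfb : ∀ y z, |f y z| ≤ Mg + 1 := by
    intro y z
    have h2 := graphon_bd hW y z
    have h3 : |W y z| ≤ 1 := by rw [abs_of_nonneg h2.1]; exact h2.2
    simp only [f]
    rw [abs_abs]
    exact (abs_sub _ _).trans (add_le_add (hMg y z) h3)
  let A : (Fin k → ℝ) → ℝ := fun x => 1 / (k:ℝ) ^ 2 * ∑ i, ∑ j, f (x i) (x j)
  let B : (Fin k → ℝ) → ℝ := fun x => 1 / (k:ℝ) ^ 3 * ∑ i, (devB hlt i x + devB hle i x)
  let D : (Fin k → ℝ) → ℝ := fun x => ∑ F, d F * pw F (fun i j => W (x i) (x j))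
  have hfi : ∀ i j : Fin k, Integrable (fun x : Fin k → ℝ => f (x i) (x j)) (piI k) := fun i j =>
    integrable_bdd (measurable_pair hfm i j) _ fun x => hfb _ _
  have hAi : Integrable A (piI k) :=
    (integrable_finsetSum _ fun i _ => integrable_finsetSum _ fun j _ => hfi i j).const_mul _
  have hli : ∀ i : Fin k, Integrable (devB hlt i) (piI k) := fun i =>
    integrable_bdd (devB_meas hlt hlt_meas i) _ (devB_bdd hlt hlt_bd i)
  have hhi : ∀ i : Fin k, Integrable (devB hle i) (piI k) := fun i =>
    integrable_bdd (devB_meas hle hle_meas i) _ (devB_bdd hle hle_bd i)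
  have hBi : Integrable B (piI k) :=
    (integrable_finsetSum _ fun i _ => (hli i).add (hhi i)).const_mul _
  have hDi : Integrable D (piI k) := integrable_finsetSum _ fun F _ => (integrable_pw F hW).const_mul _
  have hA : ∫ x, A x ∂piI k ≤ κ + (Mg + 1) / k := by
    simp only [A]
    rw [integral_const_mul, integral_finsetSum _ fun i _ => integrable_finsetSum _ fun j _ => hfi i j]
    have h1 : ∀ i, ∫ x, ∑ j, f (x i) (x j) ∂piI k ≤ k * κ + (Mg + 1) := by
      intro i
      rw [integral_finsetSum _ fun j _ => hfi i j]
      calc _ ≤ ∑ j : Fin k, (κ + if i = j then Mg + 1 else 0) := by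
            refine Finset.sum_le_sum fun j _ => ?_
            by_cases hij : i = j
            · rw [if_pos hij]
              calc _ ≤ ∫ _x, (Mg + 1) ∂piI k := integral_mono (hfi i j) (integrable_const _) fun x =>
                    (le_abs_self _).trans (hfb _ _)
                _ = Mg + 1 := by simp
                _ ≤ _ := by linarith
            · rw [if_neg hij, add_zero, integral_pair_pi i j hij f hfm _ hfb]
              exact hκ
        _ = _ := by rw [Finset.sum_add_distrib]; simp
    calc _ ≤ 1 / (k:ℝ) ^ 2 * ∑ _i : Fin k, (k * κ + (Mg + 1)) :=
          mul_le_mul_of_nonneg_left (Finset.sum_le_sum fun i _ => h1 i) (by positivity)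
      _ = _ := by
          simp only [Finset.sum_const, Finset.card_univ, Fintype.card_fin, nsmul_eq_mul]
          field_simp
  have hB : ∫ x, B x ∂piI k ≤ 2 / k := by
    simp only [B]
    have hlh : ∀ i : Fin k, Integrable (fun x => devB hlt i x + devB hle i x) (piI k) := fun i =>
      (hli i).add (hhi i)
    rw [integral_const_mul, integral_finsetSum _ fun i _ => hlh i]
    have h1 : ∀ i : Fin k, ∫ x, (devB hlt i x + devB hle i x) ∂piI k ≤ 2 * k := by
      intro i
      rw [integral_add (hli i) (hhi i)]
      have a := var_bound hlt hlt_meas hlt_bd int_lt i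
      have b := var_bound hle hle_meas hle_bd int_le i
      unfold devB
      linarith
    calc _ ≤ 1 / (k:ℝ) ^ 3 * ∑ _i : Fin k, (2 * (k:ℝ)) :=
          mul_le_mul_of_nonneg_left (Finset.sum_le_sum fun i _ => h1 i) (by positivity)
      _ = _ := by
          simp only [Finset.sum_const, Finset.card_univ, Fintype.card_fin, nsmul_eq_mul]
          field_simp
  have hD : ∫ x, D x ∂piI k = EG W d := (EG_eq hW d).symm
  have hΦi : Integrable (fun x => A x + C * B x + D x) (piI k) := (hAi.add (hBi.const_mul C)).add hDi
  have hΦ : ∫ x, (A x + C * B x + D x) ∂piI k ≤ κ + (Mg + 1 + 2 * C) / k + EG W d := by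
    have hAB : Integrable (fun x => A x + C * B x) (piI k) := hAi.add (hBi.const_mul C)
    rw [integral_add hAB hDi, integral_add hAi (hBi.const_mul C), hD]
    have eC : ∫ x, C * B x ∂piI k = C * ∫ x, B x ∂piI k := integral_const_mul C B
    have : C * ∫ x, B x ∂piI k ≤ C * (2 / k) := mul_le_mul_of_nonneg_left hB hC
    have e : (Mg + 1 + 2 * C) / k = (Mg + 1) / k + C * (2 / k) := by ring
    linarith
  obtain ⟨x, hxN, hx⟩ := exists_notMem_null_le_integral hΦi (ae_iff.1 (ae_mem_cube k))
  have hxc : ∀ i, x i ∈ I01 := by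
    by_contra h
    exact hxN h
  have hpw0 : ∀ F : SimpleGraph (Fin k), 0 ≤ pw F (fun i j => W (x i) (x j)) := fun F =>
    pw_nonneg _ _ fun i j => graphon_bd hW _ _
  have hA0 : 0 ≤ A x := by
    simp only [A, f]; positivity
  have hB0 : 0 ≤ B x := by
    simp only [B, devB]; positivity
  have hD0 : 0 ≤ D x := Finset.sum_nonneg fun F _ => mul_nonneg (hd F) (hpw0 F)
  have hCB0 : 0 ≤ C * B x := mul_nonneg hC hB0
  have e3 : (Mg + 3 + 2 * C) / k = (Mg + 1 + 2 * C) / k + 2 / k := by ring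
  have h2k : (0:ℝ) ≤ 2 / k := by positivity
  obtain ⟨F, hF⟩ := pick hW x (fun F => Q4 (cA (fun i j => W (x i) (x j)) F) / (k:ℝ) ^ 4 + d F)
  have hsum : ∑ F, pw F (fun i j => W (x i) (x j)) * (Q4 (cA (fun i j => W (x i) (x j)) F) / (k:ℝ) ^ 4 + d F) ≤
      2 / k + D x := by
    have h1 := sum_pw_Q4 (fun i j => W (x i) (x j)) (fun i j => hW.2.1 _ _) (fun i j => graphon_bd hW _ _)
    simp only [mul_add, Finset.sum_add_distrib]
    apply add_le_add
    · simp only [← mul_div_assoc]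
      rw [← Finset.sum_div, div_le_iff₀ (by positivity)]
      calc _ ≤ _ := h1
        _ = _ := by field_simp
    · exact le_of_eq (Finset.sum_congr rfl fun F _ => mul_comm _ _)
  have hQ0 : 0 ≤ Q4 (cA (fun i j => W (x i) (x j)) F) / (k:ℝ) ^ 4 := by unfold Q4; positivity
  have hdF := hd F
  refine ⟨x, F, ?_, by linarith, ?_, ?_⟩
  · rw [← div_le_iff₀ (by positivity)]; linarith
  · have : 1 / (k:ℝ) ^ 2 * (∑ i, ∑ j, |W (x i) (x j) - g (x i) (x j)|) = A x := by
      simp only [A, f]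
      simp only [abs_sub_comm]
    rw [this]; linarith
  · have : 1 / (k:ℝ) * ∑ i, ((x i - loC x (x i) / k) ^ 2 + (x i - hiC x (x i) / k) ^ 2) = B x := by
      have e1 : ∀ i, devB hlt i x = k ^ 2 * (x i - loC x (x i) / k) ^ 2 := by
        intro i
        unfold devB loC hlt
        rw [clp_of_mem (hxc i), Finset.sum_sub_distrib, ← mul_pow]
        congr 1
        simp only [Finset.sum_const, Finset.card_univ, Fintype.card_fin, nsmul_eq_mul]
        field_simp
      have e2 : ∀ i, devB hle i x = k ^ 2 * (x i - hiC x (x i) / k) ^ 2 := by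
        intro i
        unfold devB hiC hle
        rw [clp_of_mem (hxc i), Finset.sum_sub_distrib, ← mul_pow]
        congr 1
        simp only [Finset.sum_const, Finset.card_univ, Fintype.card_fin, nsmul_eq_mul]
        field_simp
      simp only [B, e1, e2, ← mul_add, ← Finset.mul_sum]
      field_simp
    rw [this]; linarith


lemma cutNorm_nonneg' (U : ℝ → ℝ → ℝ) : 0 ≤ cutNorm U := by
  apply Real.sSup_nonneg
  rintro r ⟨S, T, -, -, -, -, rfl⟩
  exact abs_nonneg _

lemma deltaCut_le_cutNorm (U W : ℝ → ℝ → ℝ) :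
    deltaCut U W ≤ cutNorm (fun x y => U x y - W x y) := by
  have hb : BddBelow (Set.range fun φ : InvMP =>
      cutNorm (fun x y => U x y - W (φ.toFun x) (φ.toFun y))) :=
    ⟨0, by rintro _ ⟨φ, rfl⟩; exact cutNorm_nonneg' _⟩
  exact ciInf_le hb InvMP.refl

lemma deltaCut_nonneg' (U W : ℝ → ℝ → ℝ) : 0 ≤ deltaCut U W :=
  Real.iInf_nonneg fun _ => cutNorm_nonneg' _

/-- A nearest graph in the property. -/
lemma exists_nearest {k : ℕ} (P : GraphProp) (hne : (P k).Nonempty) (F : SimpleGraph (Fin k)) :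
    ∃ H ∈ P k, graphD1P F P = ENNReal.ofReal (graphD1 F H) := by
  obtain ⟨H, hH, hmin⟩ := Set.exists_min_image (P k) (fun H => graphD1 F H) (Set.toFinite _) hne
  refine ⟨H, hH, le_antisymm (iInf₂_le H hH) (le_iInf₂ fun H' hH' => ?_)⟩
  exact ENNReal.ofReal_le_ofReal (hmin H' hH')

lemma nearest_expect {k : ℕ} (P : GraphProp) {W : ℝ → ℝ → ℝ} (hW : IsGraphon W) (s : ℝ) (hs : 0 ≤ s)
    (h : ∑ F : SimpleGraph (Fin k), ENNReal.ofReal (indDensity F W) * graphD1P F P ≤ ENNReal.ofReal s) :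
    ∃ N : SimpleGraph (Fin k) → SimpleGraph (Fin k), (∀ F, N F ∈ P k) ∧
      EG W (fun F => graphD1 F (N F)) ≤ s := by
  have hne : (P k).Nonempty := by
    by_contra hc
    rw [Set.not_nonempty_iff_eq_empty] at hc
    have htop : ∀ F : SimpleGraph (Fin k), graphD1P F P = ⊤ := by
      intro F
      simp [graphD1P, hc]
    obtain ⟨F, hF⟩ : ∃ F : SimpleGraph (Fin k), 0 < indDensity F W := by
      by_contra hn
      push Not at hn
      have h1 := EG_one (k := k) hW
      have h2 : ∑ F : SimpleGraph (Fin k), indDensity F W ≤ 0 := Finset.sum_nonpos fun F _ => hn F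
      linarith
    have h3 : ENNReal.ofReal (indDensity F W) * graphD1P F P ≤ ENNReal.ofReal s :=
      (Finset.single_le_sum (f := fun F : SimpleGraph (Fin k) => ENNReal.ofReal (indDensity F W) * graphD1P F P)
        (fun _ _ => zero_le) (Finset.mem_univ F)).trans h
    rw [htop F, ENNReal.mul_top (ENNReal.ofReal_pos.2 hF).ne'] at h3
    exact ENNReal.ofReal_ne_top (top_le_iff.1 h3)
  choose N hN hNd using exists_nearest P hne
  refine ⟨N, hN, ?_⟩
  rw [← ENNReal.ofReal_le_ofReal_iff hs]
  refine le_trans (le_of_eq ?_) h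
  unfold EG
  rw [ENNReal.ofReal_sum_of_nonneg fun F _ => mul_nonneg (graphD1_nonneg _ _) (indDensity_nonneg F hW)]
  refine Finset.sum_congr rfl fun F _ => ?_
  rw [hNd F, mul_comm, ENNReal.ofReal_mul (indDensity_nonneg F hW)]

lemma approx_graph (P : GraphProp) (hP : IsGraphProperty P) (W : ℝ → ℝ → ℝ) (hW : IsGraphon W)
    (hlim : Tendsto (fun k => ∑ F : SimpleGraph (Fin k), ENNReal.ofReal (indDensity F W) * graphD1P F P)
      atTop (nhds 0)) (ε : ℝ) (hε : 0 < ε) :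
    ∀ᶠ k : ℕ in atTop, ∃ G ∈ P k, deltaCut (graphonOf G) W < ε := by
  obtain ⟨ρ, hρ⟩ : ∃ ρ : ℝ, ρ = ε / 8 := ⟨_, rfl⟩
  have hρ0 : 0 < ρ := by rw [hρ]; positivity
  obtain ⟨τ, hτ⟩ : ∃ τ : ℝ, τ = min (ρ ^ 4) (ε / 64) := ⟨_, rfl⟩
  have hτ0 : 0 < τ := by rw [hτ]; exact lt_min (by positivity) (by positivity)
  have hτ1 : τ ≤ ρ ^ 4 := by rw [hτ]; exact min_le_left _ _
  have hτ2 : τ ≤ ε / 64 := by rw [hτ]; exact min_le_right _ _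
  obtain ⟨g, Mg, C, hg, hMg, hC, hmod, hκ⟩ := approx hW (τ / 4) (ε / 16) (by positivity) (by positivity)
  have e1 : ∀ᶠ k : ℕ in atTop, (Mg + 3 + 2 * C) / (k:ℝ) < τ / 4 :=
    (tendsto_const_div_atTop_nhds_zero_nat _).eventually_lt_const (by positivity)
  have e2 : ∀ᶠ k : ℕ in atTop, 1 / (k:ℝ) < ε / 16 :=
    (tendsto_const_div_atTop_nhds_zero_nat _).eventually_lt_const (by positivity)
  have e3 : ∀ᶠ k : ℕ in atTop, 4 * C / (k:ℝ) < ε / 16 :=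
    (tendsto_const_div_atTop_nhds_zero_nat _).eventually_lt_const (by positivity)
  have e4 := hlim.eventually_lt_const (ENNReal.ofReal_pos.2 (show 0 < τ / 4 by positivity))
  filter_upwards [e1, e2, e3, e4, eventually_ge_atTop 1] with k h1 h2 h3 h4 hk
  have hk0 : 0 < k := hk
  have hkR : (1:ℝ) ≤ k := by exact_mod_cast hk
  have hkp : (0:ℝ) < k := by linarith
  obtain ⟨N, hN, hE⟩ := nearest_expect P hW (τ / 4) (by positivity) h4.le
  obtain ⟨x, F, hQ, hd, hA, hB⟩ := select_pt hk0 hW g hg Mg hMg C hC (fun F => graphD1 F (N F))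
    (fun F => graphD1_nonneg _ _) (τ / 4) hκ τ (by linarith)
  have hQ' : Q4 (cA (fun i j => W (x i) (x j)) F) ≤ (ρ * k) ^ 4 := by
    refine hQ.trans ?_
    rw [mul_pow]
    exact mul_le_mul_of_nonneg_right hτ1 (by positivity)
  refine ⟨(N F).comap (Tuple.sort x), ?_, ?_⟩
  · refine (hP k (N F) _ ⟨⟨(Tuple.sort x).symm, ?_⟩⟩).1 (hN F)
    intro a b
    simp
  have key := det1 hk0 hW g hg Mg hMg (ε / 16) C hC hmod x (Tuple.sort x) F (N F) ρ hρ0.le hQ'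
  have hed := edit_sum F (N F)
  have hsb := sort_bound hk0 x
  have hsb' : C * (1 / k * ∑ i, (x (Tuple.sort x i) - ((i : Fin k) : ℕ) / k) ^ 2) ≤ τ := by
    refine le_trans (mul_le_mul_of_nonneg_left (mul_le_mul_of_nonneg_left hsb (by positivity)) hC) hB
  have h5 : 4 * C * (1 / (k:ℝ) ^ 2) ≤ 4 * C / k := by
    rw [div_eq_mul_one_div (4 * C) (k:ℝ)]
    refine mul_le_mul_of_nonneg_left ?_ (by positivity)
    exact one_div_le_one_div_of_le hkp (by nlinarith)
  have hd' : graphD1 F (N F) ≤ τ := hd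
  refine (deltaCut_le_cutNorm _ _).trans_lt (key.trans_lt ?_)
  have e5 : ∀ s : ℝ, 4 * C * (s + 1 / (k:ℝ) ^ 2) = 4 * (C * s) + 4 * C * (1 / (k:ℝ) ^ 2) := fun s => by ring
  rw [e5]
  linarith

lemma backward_dir (P : GraphProp) (hP : IsGraphProperty P) (W : ℝ → ℝ → ℝ) (hW : IsGraphon W)
    (hlim : Tendsto (fun k => ∑ F : SimpleGraph (Fin k), ENNReal.ofReal (indDensity F W) * graphD1P F P)
      atTop (nhds 0)) : W ∈ closureP P := by
  have h : ∀ m : ℕ, ∃ n : ℕ, m ≤ n ∧ ∃ G ∈ P n, deltaCut (graphonOf G) W < 1 / ((m:ℝ) + 1) := by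
    intro m
    obtain ⟨n, h1, h2⟩ := ((eventually_ge_atTop m).and
      (approx_graph P hP W hW hlim (1 / ((m:ℝ) + 1)) (by positivity))).exists
    exact ⟨n, h1, h2⟩
  choose n hn G hG hd using h
  refine ⟨hW, n, G, hG, tendsto_atTop_mono hn tendsto_id, ?_⟩
  exact squeeze_zero (fun m => deltaCut_nonneg' _ _) (fun m => (hd m).le) tendsto_one_div_add_atTop_nhds_zero_nat


theorem mem_closure_iff_expected_dist_tendsto_zero
    (P : GraphProp) (hP : IsGraphProperty P) (hT : GraphTestable P)
    (W : ℝ → ℝ → ℝ) (hW : IsGraphon W) :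
    W ∈ closureP P ↔
      Tendsto (fun k => ∑ F : SimpleGraph (Fin k),
        ENNReal.ofReal (indDensity F W) * graphD1P F P) atTop (nhds 0) := by
  exact ⟨forward_dir P hT W hW, backward_dir P hP W hW⟩

end
end

section
/- Let P be a hereditary graph property. Then for every finite simple graph G, d₁(G,P) ≤ d₁(W_G, P̄). -/
open MeasureTheory Filter Topology
open scoped ENNReal

noncomputable section

lemma aux_integrableOn {f : ℝ × ℝ → ℝ} (hf : Measurable f) {B : ℝ} (hB : ∀ z, |f z| ≤ B)
    {S T : Set ℝ} (hS : S ⊆ I01) (hT : T ⊆ I01) :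
    IntegrableOn f (S ×ˢ T) ((volume : Measure ℝ).prod volume) := by
  refine Measure.integrableOn_of_bounded (M := B) ?_ hf.aestronglyMeasurable
    (Eventually.of_forall fun z => by simpa using hB z)
  rw [Measure.prod_prod]
  refine ENNReal.mul_ne_top ?_ ?_
  · exact ((measure_mono hS).trans_lt (by simp [I01])).ne
  · exact ((measure_mono hT).trans_lt (by simp [I01])).ne

/-- Averaging: choose points in the sets `S i` with small total cost. -/
lemma aux_exists_choice {n : ℕ} (S : Fin n → Set ℝ) (hS : ∀ i, MeasurableSet (S i))
    (hSI : ∀ i, S i ⊆ I01)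
    (hvol : ∀ i, volume (S i) = (n : ℝ≥0∞)⁻¹) (f : Fin n → Fin n → ℝ × ℝ → ℝ)
    (hf : ∀ i j, Measurable (f i j)) (B : ℝ) (hB : ∀ i j z, |f i j z| ≤ B) :
    ∃ x : Fin n → ℝ, (∀ i, x i ∈ S i) ∧
      ∑ p ∈ (Finset.univ : Finset (Fin n)).offDiag, f p.1 p.2 (x p.1, x p.2) ≤
        (n : ℝ) ^ 2 * ∑ p ∈ (Finset.univ : Finset (Fin n)).offDiag,
          ∫ z in S p.1 ×ˢ S p.2, f p.1 p.2 z ∂((volume : Measure ℝ).prod volume) := by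
  let μ : Fin n → Measure ℝ := fun i => (n : ℝ≥0∞) • (volume.restrict (S i))
  have hμ : ∀ i, IsProbabilityMeasure (μ i) := by
    intro i
    constructor
    have hn : (n : ℝ≥0∞) ≠ 0 := by
      have := i.pos
      exact_mod_cast this.ne'
    simp [μ, hvol, ENNReal.mul_inv_cancel hn]
  have hmap : ∀ i j, i ≠ j →
      (Measure.pi μ).map (fun x => (x i, x j)) = (μ i).prod (μ j) := by
    intro i j hij
    have h1 := (ProbabilityTheory.iIndepFun_pi (μ := μ) (X := fun _ x => x)
      (fun i => aemeasurable_id)).indepFun hij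
    rw [ProbabilityTheory.indepFun_iff_map_prod_eq_prod_map_map
      (measurable_pi_apply i).aemeasurable (measurable_pi_apply j).aemeasurable] at h1
    rw [h1]
    congr 1
    · exact (measurePreserving_eval μ i).map_eq
    · exact (measurePreserving_eval μ j).map_eq
  have hint : ∀ i j, Integrable (fun x : Fin n → ℝ => f i j (x i, x j)) (Measure.pi μ) := by
    intro i j
    refine Integrable.of_bound (C := B) ?_ (Eventually.of_forall fun x => by simpa using hB i j _)
    have := hf i j
    exact (this.comp (by fun_prop : Measurable fun x : Fin n → ℝ => (x i, x j))).aestronglyMeasurable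
  have hval : ∀ i j, i ≠ j → ∫ x, f i j (x i, x j) ∂(Measure.pi μ) =
      (n : ℝ) ^ 2 * ∫ z in S i ×ˢ S j, f i j z ∂((volume : Measure ℝ).prod volume) := by
    intro i j hij
    have h1 : ∫ x, f i j (x i, x j) ∂(Measure.pi μ) =
        ∫ z, f i j z ∂((Measure.pi μ).map (fun x => (x i, x j))) := by
      rw [integral_map (by fun_prop) (hf i j).aestronglyMeasurable]
    rw [h1, hmap i j hij]
    simp only [μ]
    rw [Measure.prod_smul_left, Measure.prod_smul_right, Measure.prod_restrict, integral_smul_measure,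
      integral_smul_measure]
    simp
    ring
  have hnull : (Measure.pi μ) {x | ∀ i, x i ∈ S i}ᶜ = 0 := by
    have : ∀ᵐ x ∂(Measure.pi μ), ∀ i, x i ∈ S i := by
      rw [ae_all_iff]
      intro i
      have h0 : ∀ᵐ y ∂(μ i), y ∈ S i :=
        Measure.ae_smul_measure (ae_restrict_mem (hS i)) _
      exact (measurePreserving_eval μ i).quasiMeasurePreserving.ae h0
    exact this
  obtain ⟨x, hx, hle⟩ := exists_notMem_null_le_integral
    (integrable_finsetSum (Finset.univ : Finset (Fin n)).offDiag
      (fun p _ => hint p.1 p.2)) hnull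
  refine ⟨x, by simpa using hx, ?_⟩
  rw [integral_finsetSum _ (fun p _ => hint p.1 p.2)] at hle
  rw [Finset.mul_sum]
  refine hle.trans (le_of_eq (Finset.sum_congr rfl fun p hp => ?_))
  exact hval _ _ (by simpa using hp)

lemma aux_bdd (W : ℝ → ℝ → ℝ) (hW : ∀ x y, |W x y| ≤ 1) :
    BddAbove { r : ℝ | ∃ S T : Set ℝ, MeasurableSet S ∧ MeasurableSet T ∧ S ⊆ I01 ∧ T ⊆ I01 ∧
      r = |∫ x in S, ∫ y in T, W x y| } := by
  refine ⟨1, ?_⟩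
  rintro r ⟨S, T, hS, hT, hSI, hTI, rfl⟩
  have hv : ∀ S : Set ℝ, S ⊆ I01 → volume S < ⊤ ∧ volume.real S ≤ 1 := by
    intro S hSI
    have h1 : volume S ≤ 1 := (measure_mono hSI).trans (by simp [I01])
    exact ⟨h1.trans_lt (by simp), ENNReal.toReal_le_of_le_ofReal zero_le_one (by simpa using h1)⟩
  have h1 : ∀ x ∈ S, ‖∫ y in T, W x y‖ ≤ 1 := by
    intro x _
    refine (norm_setIntegral_le_of_norm_le_const (C := 1) (hv T hTI).1
      (fun y _ => by simpa using hW x y)).trans ?_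
    linarith [(hv T hTI).2]
  refine (norm_setIntegral_le_of_norm_le_const (hv S hSI).1 h1).trans ?_
  linarith [(hv S hSI).2]

lemma aux_le_cutNorm (W : ℝ → ℝ → ℝ) (hm : Measurable (Function.uncurry W))
    (hW : ∀ x y, |W x y| ≤ 1) {S T : Set ℝ} (hS : MeasurableSet S) (hT : MeasurableSet T)
    (hSI : S ⊆ I01) (hTI : T ⊆ I01) :
    |∫ z in S ×ˢ T, W z.1 z.2 ∂((volume : Measure ℝ).prod volume)| ≤ cutNorm W := by
  have h := setIntegral_prod (μ := volume) (ν := volume) (fun z : ℝ × ℝ => W z.1 z.2)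
    (aux_integrableOn (B := 1) hm (fun z => hW _ _) hSI hTI)
  rw [h]
  exact le_csSup (aux_bdd W hW) ⟨S, T, hS, hT, hSI, hTI, rfl⟩

instance aux_nonempty : Nonempty InvMP :=
  ⟨⟨id, id, fun _ h => h, fun _ h => h, MeasurePreserving.id _, MeasurePreserving.id _,
    fun _ _ => rfl, fun _ _ => rfl⟩⟩

lemma aux_graphon_meas {n : ℕ} (G : SimpleGraph (Fin n)) :
    Measurable (Function.uncurry (graphonOf G)) := by
  classical
  unfold graphonOf Function.uncurry
  refine Measurable.ite ?_ measurable_const measurable_const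
  simp only [Set.setOf_exists]
  refine MeasurableSet.iUnion fun i => MeasurableSet.iUnion fun j => ?_
  by_cases h : G.Adj i j
  · simp only [h, true_and]
    exact measurableSet_Ioc.prod measurableSet_Ioc
  · simp [h]

/-- The block of a vertex. -/
def auxBlock (n : ℕ) (i : ℕ) : Set ℝ := Set.Ioc ((i : ℝ) / n) (((i : ℝ) + 1) / n)

lemma auxBlock_meas (n i : ℕ) : MeasurableSet (auxBlock n i) := measurableSet_Ioc

lemma auxBlock_unique {n i j : ℕ} {x : ℝ} (hi : x ∈ auxBlock n i) (hj : x ∈ auxBlock n j) :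
    i = j := by
  rcases Nat.eq_zero_or_pos n with rfl | hn
  · simp [auxBlock] at hi
  have hn' : (0 : ℝ) < n := by exact_mod_cast hn
  simp only [auxBlock, Set.mem_Ioc, div_lt_iff₀ hn', le_div_iff₀ hn'] at hi hj
  have h1 : (i : ℝ) < j + 1 := by linarith
  have h2 : (j : ℝ) < i + 1 := by linarith
  norm_cast at h1 h2
  omega

lemma auxBlock_exists {n : ℕ} {x : ℝ} (hn : 0 < n) (hx : x ∈ Set.Ioc (0 : ℝ) 1) :
    ∃ i : Fin n, x ∈ auxBlock n i := by
  have hn' : (0 : ℝ) < n := by exact_mod_cast hn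
  have hpos : 0 < x * n := mul_pos hx.1 hn'
  have hc : 0 < ⌈x * n⌉₊ := Nat.ceil_pos.2 hpos
  have hle : ⌈x * n⌉₊ ≤ n := Nat.ceil_le.2 (by nlinarith [hx.2])
  refine ⟨⟨⌈x * n⌉₊ - 1, by omega⟩, ?_⟩
  simp only [auxBlock, Set.mem_Ioc, div_lt_iff₀ hn', le_div_iff₀ hn']
  have h1 := Nat.le_ceil (x * n)
  have h2 := Nat.ceil_lt_add_one hpos.le
  rw [Nat.cast_sub hc]
  push_cast
  constructor <;> linarith

lemma auxBlock_subset {n : ℕ} (i : Fin n) : auxBlock n i ⊆ Set.Ioc (0 : ℝ) 1 := by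
  intro x hx
  have hn' : (0 : ℝ) < n := by exact_mod_cast i.pos
  simp only [auxBlock, Set.mem_Ioc, div_lt_iff₀ hn', le_div_iff₀ hn'] at hx
  have h1 : ((i : ℕ) : ℝ) + 1 ≤ n := by exact_mod_cast i.2
  have h0 : (0 : ℝ) ≤ (i : ℕ) := by positivity
  constructor <;> nlinarith

lemma auxBlock_vol (n i : ℕ) : volume (auxBlock n i) = ENNReal.ofReal (1 / n) := by
  rw [auxBlock, Real.volume_Ioc]
  congr 1
  ring

open Classical in
lemma graphonOf_apply {n : ℕ} (G : SimpleGraph (Fin n)) {i j : Fin n} {x y : ℝ}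
    (hx : x ∈ auxBlock n i) (hy : y ∈ auxBlock n j) :
    graphonOf G x y = if G.Adj i j then 1 else 0 := by
  unfold graphonOf
  congr 1
  apply propext
  constructor
  · rintro ⟨i', j', h, h1, h2⟩
    have e1 : i' = i := Fin.ext (auxBlock_unique h1 hx)
    have e2 : j' = j := Fin.ext (auxBlock_unique h2 hy)
    rwa [← e1, ← e2]
  · intro h
    exact ⟨i, j, h, hx, hy⟩

/-- The set of pairs lying in a common block. -/
def auxColl (N : ℕ) : Set (ℝ × ℝ) := ⋃ i : Fin N, auxBlock N i ×ˢ auxBlock N i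

lemma auxColl_meas (N : ℕ) : MeasurableSet (auxColl N) :=
  MeasurableSet.iUnion fun i => (auxBlock_meas _ _).prod (auxBlock_meas _ _)

lemma auxColl_vol (N : ℕ) :
    ((volume : Measure ℝ).prod volume) (auxColl N) ≤ ENNReal.ofReal (1 / N) := by
  refine (measure_iUnion_le _).trans ?_
  simp only [Measure.prod_prod, auxBlock_vol, tsum_fintype, Finset.sum_const, Finset.card_univ,
    Fintype.card_fin, nsmul_eq_mul]
  rw [← ENNReal.ofReal_mul (by positivity), ← ENNReal.ofReal_natCast,
    ← ENNReal.ofReal_mul (by positivity)]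
  apply ENNReal.ofReal_le_ofReal
  rcases Nat.eq_zero_or_pos N with rfl | hn
  · simp
  have hn' : (0 : ℝ) < N := by exact_mod_cast hn
  field_simp
  exact le_rfl

lemma auxColl_int (N : ℕ) (s : Set (ℝ × ℝ)) :
    ∫ z in s, (auxColl N).indicator (fun _ => (1 : ℝ)) z ∂((volume : Measure ℝ).prod volume)
      ≤ 1 / N := by
  rw [integral_indicator (auxColl_meas N)]
  simp only [integral_const, smul_eq_mul, mul_one]
  rw [measureReal_restrict_apply_univ]
  refine ENNReal.toReal_le_of_le_ofReal (by positivity) ?_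
  exact (Measure.restrict_apply_le _ _).trans (auxColl_vol N)

/-- Change of variables along a measure preserving map of `[0,1]`. -/
lemma aux_change {n : ℕ} (φ : InvMP) (f : ℝ × ℝ → ℝ) (hf : Measurable f) (i j : Fin n) :
    ∫ z in (φ.toFun ⁻¹' auxBlock n i ∩ Set.Ioc 0 1) ×ˢ (φ.toFun ⁻¹' auxBlock n j ∩ Set.Ioc 0 1),
      f (φ.toFun z.1, φ.toFun z.2) ∂((volume : Measure ℝ).prod volume) =
    ∫ z in auxBlock n i ×ˢ auxBlock n j, f z ∂((volume : Measure ℝ).prod volume) := by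
  have hI : (volume : Measure ℝ).restrict I01 = volume.restrict (Set.Ioc 0 1) :=
    Measure.restrict_congr_set Ioc_ae_eq_Icc.symm
  have hφm := φ.measurePreserving.measurable
  have key : ∀ i : Fin n, MeasurePreserving φ.toFun
      (volume.restrict (φ.toFun ⁻¹' auxBlock n i ∩ Set.Ioc 0 1))
      (volume.restrict (auxBlock n i)) := by
    intro i
    have h := φ.measurePreserving.restrict_preimage (auxBlock_meas n i)
    rw [hI, Measure.restrict_restrict (hφm (auxBlock_meas n i)),
      Measure.restrict_restrict (auxBlock_meas n i),
      Set.inter_eq_left.2 (auxBlock_subset i)] at h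
    exact h
  have h2 := (key i).prod (key j)
  rw [Measure.prod_restrict, Measure.prod_restrict] at h2
  rw [← h2.map_eq, integral_map h2.measurable.aemeasurable hf.aestronglyMeasurable]
  rfl

lemma aux_vol {n : ℕ} (φ : InvMP) (i : Fin n) :
    volume (φ.toFun ⁻¹' auxBlock n i ∩ Set.Ioc 0 1) = (n : ℝ≥0∞)⁻¹ := by
  have hI : (volume : Measure ℝ).restrict I01 = volume.restrict (Set.Ioc 0 1) :=
    Measure.restrict_congr_set Ioc_ae_eq_Icc.symm
  have hφm := φ.measurePreserving.measurable
  have h := φ.measurePreserving.measure_preimage (auxBlock_meas n i).nullMeasurableSet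
  rw [hI, Measure.restrict_apply (hφm (auxBlock_meas n i)),
    Measure.restrict_apply (auxBlock_meas n i), Set.inter_eq_left.2 (auxBlock_subset i),
    auxBlock_vol] at h
  rw [h, one_div, ENNReal.ofReal_inv_of_pos (by exact_mod_cast i.pos), ENNReal.ofReal_natCast]

/-- The off-diagonal block integrals are bounded by the `L¹` norm. -/
lemma aux_l1 {n : ℕ} (F : ℝ → ℝ → ℝ) (hm : Measurable (Function.uncurry F))
    (hF : ∀ x y, |F x y| ≤ 1) :
    ∑ p ∈ (Finset.univ : Finset (Fin n)).offDiag,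
      ∫ z in auxBlock n p.1 ×ˢ auxBlock n p.2, |F z.1 z.2| ∂((volume : Measure ℝ).prod volume)
      ≤ l1Norm F := by
  have hm' : Measurable (fun z : ℝ × ℝ => |F z.1 z.2|) := by
    have : Measurable (fun z : ℝ × ℝ => F z.1 z.2) := hm
    fun_prop
  have hb : ∀ z : ℝ × ℝ, |(|F z.1 z.2|)| ≤ 1 := fun z => by simpa using hF _ _
  have hsub : ∀ i : Fin n, auxBlock n i ⊆ I01 := fun i =>
    (auxBlock_subset i).trans Set.Ioc_subset_Icc_self
  have h := setIntegral_prod (μ := volume) (ν := volume) (fun z : ℝ × ℝ => |F z.1 z.2|)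
    (aux_integrableOn hm' hb (Set.Subset.refl I01) (Set.Subset.refl I01))
  unfold l1Norm
  simp only at h
  rw [← h, ← integral_biUnion_finset]
  · refine setIntegral_mono_set (aux_integrableOn hm' hb subset_rfl subset_rfl)
      (Eventually.of_forall fun z => abs_nonneg _) (HasSubset.Subset.eventuallyLE ?_)
    refine Set.iUnion₂_subset fun p _ => Set.prod_mono (hsub _) (hsub _)
  · exact fun p _ => (auxBlock_meas _ _).prod (auxBlock_meas _ _)
  · intro p _ q _ hpq
    refine Set.disjoint_left.2 ?_
    rintro z ⟨h1, h2⟩ ⟨h3, h4⟩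
    exact hpq (Prod.ext (Fin.ext (auxBlock_unique h1 h3)) (Fin.ext (auxBlock_unique h2 h4)))
  · exact fun p _ => aux_integrableOn hm' hb (hsub _) (hsub _)

open Classical in
lemma aux_edit {n : ℕ} (G H : SimpleGraph (Fin n)) :
    ((symmDiff G.edgeSet H.edgeSet).ncard : ℝ) ≤
      ∑ p ∈ (Finset.univ : Finset (Fin n)).offDiag,
        |(if G.Adj p.1 p.2 then (1 : ℝ) else 0) - (if H.Adj p.1 p.2 then 1 else 0)| := by
  let D := (Finset.univ : Finset (Fin n)).offDiag.filter
    (fun p => ¬ (G.Adj p.1 p.2 ↔ H.Adj p.1 p.2))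
  have h1 : symmDiff G.edgeSet H.edgeSet ⊆ ((D.image (fun p => s(p.1, p.2)) : Finset _) : Set _) := by
    intro e he
    induction e using Sym2.ind with
    | _ a b =>
      have hab : ¬ (G.Adj a b ↔ H.Adj a b) := by
        simp only [Set.mem_symmDiff, SimpleGraph.mem_edgeSet] at he
        tauto
      have hne : a ≠ b := by
        rintro rfl
        simp at hab
      simp only [Finset.coe_image, Set.mem_image]
      exact ⟨(a, b), by simp [D, hne, hab], rfl⟩
  have h2 : (symmDiff G.edgeSet H.edgeSet).ncard ≤ D.card := by
    refine (Set.ncard_le_ncard h1 (Finset.finite_toSet _)).trans ?_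
    rw [Set.ncard_coe_finset]
    exact Finset.card_image_le
  calc ((symmDiff G.edgeSet H.edgeSet).ncard : ℝ) ≤ D.card := by exact_mod_cast h2
    _ = ∑ p ∈ D, (1 : ℝ) := by simp
    _ ≤ _ := by
      rw [Finset.sum_filter]
      refine Finset.sum_le_sum fun p _ => ?_
      by_cases hg : G.Adj p.1 p.2 <;> by_cases hh : H.Adj p.1 p.2 <;> simp [hg, hh]

open Classical in
lemma aux_main (P : GraphProp) (hher : Hereditary P) {n : ℕ} (G : SimpleGraph (Fin n))
    (U : ℝ → ℝ → ℝ) (hU : U ∈ closureP P) (ε : ℝ) (hε : 0 < ε) :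
    ∃ H ∈ P n, graphD1 G H ≤ l1Norm (fun x y => graphonOf G x y - U x y) + ε := by
  obtain ⟨⟨hUm, -, hU01⟩, N, K, hK, hN, hlim⟩ := hU
  set L := l1Norm (fun x y => graphonOf G x y - U x y) with hL
  have hW01 : ∀ {k : ℕ} (F : SimpleGraph (Fin k)) (x y : ℝ),
      graphonOf F x y = 0 ∨ graphonOf F x y = 1 := by
    intro k F x y
    unfold graphonOf
    split_ifs <;> simp
  have hL0 : 0 ≤ L := by
    rw [hL]; unfold l1Norm
    exact integral_nonneg fun x => integral_nonneg fun y => abs_nonneg _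
  obtain ⟨M, hM⟩ : ∃ M : ℝ, M = (n : ℝ) ^ 2 * (L + ε) + 1 := ⟨_, rfl⟩
  have hM0 : 0 < M := by rw [hM]; positivity
  obtain ⟨η, hη⟩ : ∃ η : ℝ, η = ε / (2 * ((n : ℝ) ^ 2 + 1)) := ⟨_, rfl⟩
  have hη0 : 0 < η := by rw [hη]; positivity
  have hηn : (n : ℝ) ^ 2 * (η + η) ≤ ε := by
    rw [hη]
    have : (0 : ℝ) < (n : ℝ) ^ 2 + 1 := by positivity
    field_simp
    nlinarith
  obtain ⟨N₀, hN₀⟩ := exists_nat_gt (M / η)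
  obtain ⟨m, hm1, hm2, hm3⟩ : ∃ m, deltaCut (graphonOf (K m)) U < η ∧ N₀ ≤ N m ∧ 1 ≤ N m :=
    ((hlim.eventually_lt_const hη0).and ((hN.eventually_ge_atTop N₀).and
      (hN.eventually_ge_atTop 1))).exists
  have hNm : (0 : ℝ) < N m := by exact_mod_cast hm3
  have hMN : M * (1 / N m) ≤ η := by
    have : (N₀ : ℝ) ≤ N m := by exact_mod_cast hm2
    have h3 : M / η < N m := lt_of_lt_of_le hN₀ this
    rw [div_lt_iff₀ hη0] at h3
    rw [mul_one_div, div_le_iff₀ hNm]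
    linarith
  obtain ⟨φ, hφ⟩ := exists_lt_of_ciInf_lt hm1
  have hφm := φ.measurePreserving.measurable
  -- the sets
  let S : Fin n → Set ℝ := fun i => φ.toFun ⁻¹' auxBlock n i ∩ Set.Ioc 0 1
  have hSm : ∀ i, MeasurableSet (S i) := fun i =>
    (hφm (auxBlock_meas _ _)).inter measurableSet_Ioc
  have hSI : ∀ i, S i ⊆ I01 := fun i =>
    Set.inter_subset_right.trans Set.Ioc_subset_Icc_self
  let a : Fin n → Fin n → ℝ := fun i j => if G.Adj i j then 1 else 0
  have ha : ∀ i j, a i j = 0 ∨ a i j = 1 := by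
    intro i j
    simp only [a]
    split_ifs <;> simp
  let w : ℝ × ℝ → ℝ := fun z => graphonOf (K m) z.1 z.2
  have hw : Measurable w := aux_graphon_meas (K m)
  let u : ℝ × ℝ → ℝ := fun z => U z.1 z.2
  have hu : Measurable u := hUm
  let uφ : ℝ × ℝ → ℝ := fun z => u (φ.toFun z.1, φ.toFun z.2)
  have huφ : Measurable uφ := hu.comp (by fun_prop)
  have hu01 : ∀ z, 0 ≤ u z ∧ u z ≤ 1 := fun z => hU01 z.1 z.2
  have hw01 : ∀ z, w z = 0 ∨ w z = 1 := fun z => hW01 _ _ _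
  have hcoll : Measurable ((auxColl (N m)).indicator (fun _ => (1 : ℝ))) :=
    measurable_const.indicator (auxColl_meas _)
  have hcoll01 : ∀ z, 0 ≤ (auxColl (N m)).indicator (fun _ => (1 : ℝ)) z ∧
      (auxColl (N m)).indicator (fun _ => (1 : ℝ)) z ≤ 1 := by
    intro z
    by_cases h : z ∈ auxColl (N m) <;> simp [h]
  let f : Fin n → Fin n → ℝ × ℝ → ℝ := fun i j z =>
    |a i j - w z| + M * (auxColl (N m)).indicator (fun _ => (1 : ℝ)) z
  have hf : ∀ i j, Measurable (f i j) := by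
    intro i j
    simp only [f]
    fun_prop
  have hab : ∀ i j z, |a i j - w z| ≤ 1 := by
    intro i j z
    rcases ha i j with h | h <;> rcases hw01 z with h' | h' <;> simp [h, h']
  have hau : ∀ i j z, |a i j - u z| ≤ 1 := by
    intro i j z
    obtain ⟨h1, h2⟩ := hu01 z
    rw [abs_le]
    rcases ha i j with h | h <;> rw [h] <;> constructor <;> linarith
  obtain ⟨x, hxS, hx⟩ := aux_exists_choice S hSm hSI (fun i => aux_vol φ i) f hf (1 + M) (by
    intro i j z
    obtain ⟨h1, h2⟩ := hcoll01 z
    have h3 := hab i j z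
    have h4 := abs_nonneg (a i j - w z)
    simp only [f]
    rw [abs_of_nonneg (by positivity)]
    nlinarith)
  -- bound each integral
  have hbound : ∀ i j, ∫ z in S i ×ˢ S j, f i j z ∂((volume : Measure ℝ).prod volume) ≤
      ∫ z in auxBlock n i ×ˢ auxBlock n j, |graphonOf G z.1 z.2 - U z.1 z.2|
        ∂((volume : Measure ℝ).prod volume) + (η + η) := by
    intro i j
    have hm_aw : Measurable (fun z => |a i j - w z|) := by fun_prop
    have hm_au : Measurable (fun z => |a i j - uφ z|) := by fun_prop
    have hm_au0 : Measurable (fun z => |a i j - u z|) := by fun_prop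
    have i1 : IntegrableOn (fun z => |a i j - w z|) (S i ×ˢ S j)
        ((volume : Measure ℝ).prod volume) :=
      aux_integrableOn hm_aw (B := 1) (fun z => by simpa using hab i j z) (hSI i) (hSI j)
    have i2 : IntegrableOn (fun z => |a i j - uφ z|) (S i ×ˢ S j)
        ((volume : Measure ℝ).prod volume) :=
      aux_integrableOn hm_au (B := 1) (fun z => by simpa using hau i j _) (hSI i) (hSI j)
    have i3 : IntegrableOn ((auxColl (N m)).indicator (fun _ => (1 : ℝ))) (S i ×ˢ S j)
        ((volume : Measure ℝ).prod volume) :=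
      aux_integrableOn hcoll (B := 1) (fun z => by
        rw [abs_of_nonneg (hcoll01 z).1]; exact (hcoll01 z).2) (hSI i) (hSI j)
    have e1 : ∫ z in S i ×ˢ S j, f i j z ∂((volume : Measure ℝ).prod volume) =
        ∫ z in S i ×ˢ S j, |a i j - w z| ∂((volume : Measure ℝ).prod volume) +
        M * ∫ z in S i ×ˢ S j, (auxColl (N m)).indicator (fun _ => (1 : ℝ)) z
          ∂((volume : Measure ℝ).prod volume) := by
      rw [← integral_const_mul, ← integral_add i1 (i3.const_mul M)]
    have e2 : M * ∫ z in S i ×ˢ S j, (auxColl (N m)).indicator (fun _ => (1 : ℝ)) z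
          ∂((volume : Measure ℝ).prod volume) ≤ η :=
      (mul_le_mul_of_nonneg_left (auxColl_int _ _) hM0.le).trans hMN
    have e3 : ∫ z in S i ×ˢ S j, |a i j - w z| ∂((volume : Measure ℝ).prod volume) -
        ∫ z in S i ×ˢ S j, |a i j - uφ z| ∂((volume : Measure ℝ).prod volume) =
        (1 - 2 * a i j) * ∫ z in S i ×ˢ S j, (w z - uφ z)
          ∂((volume : Measure ℝ).prod volume) := by
      rw [← integral_sub i1 i2, ← integral_const_mul]
      congr 1
      funext z
      have h0 : 0 ≤ uφ z ∧ uφ z ≤ 1 := hu01 _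
      rcases ha i j with h | h <;> rw [h]
      · rw [zero_sub, zero_sub, abs_neg, abs_neg, abs_of_nonneg h0.1,
          abs_of_nonneg (by rcases hw01 z with h | h <;> rw [h]; norm_num)]
        ring
      · rw [abs_of_nonneg (by linarith [h0.2] : 0 ≤ 1 - uφ z),
          abs_of_nonneg (by rcases hw01 z with h | h <;> rw [h] <;> norm_num : 0 ≤ 1 - w z)]
        ring
    have e4 := aux_le_cutNorm
      (fun x y => graphonOf (K m) x y - U (φ.toFun x) (φ.toFun y)) (hw.sub huφ)
      (by
        intro x y
        obtain ⟨h1, h2⟩ := hu01 (φ.toFun x, φ.toFun y)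
        simp only [u] at h1 h2
        rw [abs_le]
        rcases hW01 (K m) x y with h | h <;> rw [h] <;> constructor <;> linarith)
      (hSm i) (hSm j) (hSI i) (hSI j)
    have e5 : (1 - 2 * a i j) * ∫ z in S i ×ˢ S j, (w z - uφ z)
          ∂((volume : Measure ℝ).prod volume) ≤ η := by
      refine le_trans ?_ (e4.trans hφ.le)
      rcases ha i j with h | h <;> rw [h]
      · rw [mul_zero, sub_zero, one_mul]; exact le_abs_self _
      · have : (1 : ℝ) - 2 * 1 = -1 := by norm_num
        rw [this, neg_one_mul]; exact neg_le_abs _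
    have e6 : ∫ z in S i ×ˢ S j, |a i j - uφ z| ∂((volume : Measure ℝ).prod volume) =
        ∫ z in auxBlock n i ×ˢ auxBlock n j, |graphonOf G z.1 z.2 - U z.1 z.2|
        ∂((volume : Measure ℝ).prod volume) := by
      rw [show (∫ z in S i ×ˢ S j, |a i j - uφ z| ∂((volume : Measure ℝ).prod volume)) = _ from
        aux_change φ (fun z => |a i j - u z|) hm_au0 i j]
      refine setIntegral_congr_fun ((auxBlock_meas _ _).prod (auxBlock_meas _ _)) ?_
      intro z hz
      simp only [graphonOf_apply G hz.1 hz.2, a, u]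
    linarith
  have hsum : ∑ p ∈ (Finset.univ : Finset (Fin n)).offDiag, f p.1 p.2 (x p.1, x p.2) ≤
      (n : ℝ) ^ 2 * (L + ε) := by
    refine hx.trans (mul_le_mul_of_nonneg_left ?_ (by positivity))
    refine (Finset.sum_le_sum fun p _ => hbound p.1 p.2).trans ?_
    rw [Finset.sum_add_distrib]
    refine add_le_add (aux_l1 (fun x y => graphonOf G x y - U x y)
      ((aux_graphon_meas G).sub hUm) ?_) ?_
    · intro x y
      obtain ⟨h1, h2⟩ := hu01 (x, y)
      simp only [u] at h1 h2
      rw [abs_le]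
      rcases hW01 G x y with h | h <;> rw [h] <;> constructor <;> linarith
    · rw [Finset.sum_const, nsmul_eq_mul, Finset.offDiag_card, Finset.card_univ, Fintype.card_fin]
      refine le_trans (mul_le_mul_of_nonneg_right ?_ (by positivity)) hηn
      have : n * n - n ≤ n ^ 2 := by rw [pow_two]; omega
      exact_mod_cast this
  have hfn : ∀ i j z, 0 ≤ f i j z := by
    intro i j z
    have := (hcoll01 z).1
    simp only [f]
    positivity
  choose v hv using fun i => auxBlock_exists hm3 (hxS i).2
  have hinj : Function.Injective v := by
    intro i j hij
    by_contra hne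
    have hmem : (x i, x j) ∈ auxColl (N m) :=
      Set.mem_iUnion.2 ⟨v i, hv i, by rw [hij]; exact hv j⟩
    have h1 := Finset.single_le_sum (f := fun p : Fin n × Fin n => f p.1 p.2 (x p.1, x p.2))
      (fun p _ => hfn _ _ _)
      (show (i, j) ∈ (Finset.univ : Finset (Fin n)).offDiag by simp [hne])
    have h2 : M ≤ f i j (x i, x j) := by
      simp only [f, Set.indicator_of_mem hmem, mul_one]
      linarith [abs_nonneg (a i j - w (x i, x j))]
    simp only at h1
    linarith
  refine ⟨(K m).comap v, hher _ _ (hK m) _ _ ⟨⟨v, hinj⟩, fun i j => Iff.rfl⟩, ?_⟩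
  have hfin : ((symmDiff G.edgeSet ((K m).comap v).edgeSet).ncard : ℝ) ≤ (n : ℝ) ^ 2 * (L + ε) := by
    refine (aux_edit _ _).trans (le_trans (Finset.sum_le_sum fun p _ => ?_) hsum)
    have h1 : w (x p.1, x p.2) = if ((K m).comap v).Adj p.1 p.2 then 1 else 0 :=
      graphonOf_apply (K m) (hv p.1) (hv p.2)
    simp only [f]
    rw [h1]
    have := (hcoll01 (x p.1, x p.2)).1
    simp only [a]
    have h3 := mul_nonneg hM0.le this
    refine le_trans (le_of_eq ?_) (le_add_of_nonneg_right h3)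
    congr!
  unfold graphD1
  rcases Nat.eq_zero_or_pos n with h0 | h0
  · subst h0
    simp
    positivity
  · have : (0 : ℝ) < (n : ℝ) ^ 2 := by positivity
    rw [div_le_iff₀ this]
    linarith

theorem hereditary_graph_dist_le_graphon_dist
    (P : GraphProp) (hP : IsGraphProperty P) (hher : Hereditary P)
    {n : ℕ} (G : SimpleGraph (Fin n)) :
    graphD1P G P ≤ d1SetE (graphonOf G) (closureP P) := by
  unfold d1SetE
  refine le_iInf₂ fun U hU => ?_
  refine ENNReal.le_of_forall_pos_le_add fun ε hε _ => ?_
  obtain ⟨H, hH, hle⟩ := aux_main P hher G U hU ε (by exact_mod_cast hε)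
  unfold graphD1P
  refine (iInf₂_le H hH).trans ((ENNReal.ofReal_le_ofReal hle).trans ?_)
  refine ENNReal.ofReal_add_le.trans ?_
  simp

end
end
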